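/- arXiv:0912.2394 — 5 statements merged into one kernel-verified Lean document; each statement's English description precedes it below -/
import Mathlib

section
/- Let a : ℕ → ℕ (indexed from 1) satisfy: a(1) = 1, a(2) = 2, and for every n ≥ 2, a(n+1) is the smallest positive integer not among a(1), …, a(n) whose greatest common divisor with a(n) exceeds 1. Then the sequence has essentially linear growth: there exist real constants c₁ > 0 and c₂ > 0 such that c₁·n < a(n) < c₂·n for all n ≥ 1. -/
/-- The EKG sequence property: `a 1 = 1`, `a 2 = 2`, and for `n ≥ 2`,
`a (n+1)` is the smallest positive integer not among `a 1, …, a n`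
whose gcd with `a n` exceeds 1. -/
def IsEKG (a : ℕ → ℕ) : Prop :=
  a 1 = 1 ∧ a 2 = 2 ∧
    ∀ n, 2 ≤ n →
      IsLeast {m : ℕ | 0 < m ∧ (∀ i, 1 ≤ i → i ≤ n → a i ≠ m) ∧
        1 < Nat.gcd m (a n)} (a (n + 1))


section

open Finset

/-- Among the positive integers up to `X`, at most `X * ∑ 1 / q` are divisible by a member of `S`. -/
theorem card_multiples_le (S : Finset ℕ) (X : ℕ) :
    (#{t ∈ Ioc 0 X | ∃ q ∈ S, q ∣ t} : ℝ) ≤ X * ∑ q ∈ S, (1 / q : ℝ) := by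
  have hsub : {t ∈ Ioc 0 X | ∃ q ∈ S, q ∣ t} ⊆ S.biUnion fun q ↦ {t ∈ Ioc 0 X | q ∣ t} := by
    intro t
    simp only [mem_filter, mem_biUnion]
    rintro ⟨ht, q, hq, hqt⟩
    exact ⟨q, hq, ht, hqt⟩
  have h := (card_le_card hsub).trans card_biUnion_le
  simp only [Nat.Ioc_filter_dvd_card_eq_div] at h
  calc (#{t ∈ Ioc 0 X | ∃ q ∈ S, q ∣ t} : ℝ) ≤ ((∑ q ∈ S, X / q : ℕ) : ℝ) := by exact_mod_cast h
    _ = ∑ q ∈ S, ((X / q : ℕ) : ℝ) := by push_cast; rfl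
    _ ≤ ∑ q ∈ S, (X : ℝ) / q := sum_le_sum fun q _ ↦ Nat.cast_div_le
    _ = X * ∑ q ∈ S, (1 / q : ℝ) := by
      rw [mul_sum]
      exact sum_congr rfl fun q _ ↦ by ring

/-- If a finite set of primes has few multiples up to `X`, then the sum of its reciprocals
is small. -/
theorem mul_sum_inv_le_card_multiples (X : ℕ) (S : Finset ℕ) (hS : ∀ q ∈ S, q.Prime)
    (hcard : 16 * #({t ∈ Ioc 0 X | ∃ q ∈ S, q ∣ t} ∪ S) ≤ X) :
    X * ∑ q ∈ S, (1 / q : ℝ) ≤ 4 * #({t ∈ Ioc 0 X | ∃ q ∈ S, q ∣ t} ∪ S) := by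
  induction S using Finset.induction_on with
  | empty => simp
  | insert q S hqS ih =>
    set V := {t ∈ Ioc 0 X | ∃ q ∈ S, q ∣ t} ∪ S with hV
    set V' := {t ∈ Ioc 0 X | ∃ r ∈ insert q S, r ∣ t} ∪ insert q S with hV'
    have hVV' : V ⊆ V' := by
      intro t
      simp only [hV, hV', mem_union, mem_filter, mem_insert]
      grind
    have hle := card_le_card hVV'
    have ih' := ih (fun r hr ↦ hS r (mem_insert_of_mem hr)) (by omega)
    have hq : q.Prime := hS q (mem_insert_self q S)
    have hq0 : (0 : ℝ) < q := by exact_mod_cast hq.pos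
    rw [sum_insert hqS, mul_add]
    suffices h : (X : ℝ) * (1 / q) + 4 * #V ≤ 4 * #V' by linarith
    by_cases hqX : X < q
    · have hqV : q ∉ V := by
        simp only [hV, mem_union, mem_filter, mem_Ioc]
        grind
      have hqV' : q ∈ V' := by simp [hV']
      have hlt : #V + 1 ≤ #V' := card_lt_card ((ssubset_iff_of_subset hVV').2 ⟨q, hqV', hqV⟩)
      have h1 : (X : ℝ) * (1 / q) ≤ 1 := by
        rw [mul_one_div, div_le_one hq0]
        exact_mod_cast hqX.le
      have h2 : ((#V : ℝ) + 1) ≤ #V' := by exact_mod_cast hlt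
      linarith
    · push Not at hqX
      have hX : 0 < X := hq.pos.trans_le hqX
      have hX' : (0 : ℝ) < X := by exact_mod_cast hX
      set A := {t ∈ Ioc 0 X | q ∣ t} with hA
      have hAcard : #A = X / q := Nat.Ioc_filter_dvd_card_eq_div X q
      have hinter : A ∩ V ⊆ ({t ∈ Ioc 0 (X / q) | ∃ r ∈ S, r ∣ t}).image (q * ·) := by
        intro t
        simp only [hA, hV, mem_inter, mem_union, mem_filter, mem_Ioc, mem_image]
        rintro ⟨⟨⟨ht0, htX⟩, u, rfl⟩, h⟩
        have hu0 : 0 < u := Nat.pos_of_mul_pos_left ht0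
        have huX : u ≤ X / q := by
          rw [Nat.le_div_iff_mul_le hq.pos, mul_comm]
          exact htX
        obtain ⟨r, hr, hrt⟩ : ∃ r ∈ S, r ∣ q * u := by
          rcases h with ⟨-, h⟩ | h
          · exact h
          · exact ⟨_, h, dvd_rfl⟩
        have hrp := hS r (mem_insert_of_mem hr)
        have hrq : r ≠ q := fun e ↦ hqS (e ▸ hr)
        refine ⟨u, ⟨⟨hu0, huX⟩, r, hr, ?_⟩, rfl⟩
        exact (Nat.Coprime.dvd_mul_left ((Nat.coprime_primes hrp hq).2 hrq)).1 hrt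
      have h1 : (#(A ∩ V) : ℝ) ≤ (X / q : ℕ) * ∑ r ∈ S, (1 / r : ℝ) :=
        le_trans (by exact_mod_cast (card_le_card hinter).trans card_image_le)
          (card_multiples_le S (X / q))
      have h2 : A ∪ V ⊆ V' := by
        refine union_subset ?_ hVV'
        intro t
        simp only [hA, hV', mem_union, mem_filter, mem_insert]
        grind
      have h3 : #A + #V ≤ #V' + #(A ∩ V) := by
        rw [← card_union_add_card_inter]
        have := card_le_card h2
        omega
      have h3' : (#A : ℝ) + #V ≤ #V' + #(A ∩ V) := by exact_mod_cast h3
      have hσ : ∑ r ∈ S, (1 / r : ℝ) ≤ 1 / 4 := by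
        have h16 : (16 * #V : ℝ) ≤ X := by
          have : 16 * #V ≤ X := by omega
          exact_mod_cast this
        nlinarith
      have hA2 : (X : ℝ) * (1 / q) ≤ 2 * (X / q : ℕ) := by
        rw [mul_one_div, div_le_iff₀ hq0]
        have hm := Nat.div_add_mod X q
        have hl := Nat.mod_lt X hq.pos
        have h1 : 1 ≤ X / q := (Nat.one_le_div_iff hq.pos).2 hqX
        have : X ≤ 2 * (X / q) * q := by nlinarith
        exact_mod_cast this
      rw [hAcard] at h3'
      have h0 : (0 : ℝ) ≤ (X / q : ℕ) := Nat.cast_nonneg _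
      nlinarith

/-- A version of `mul_sum_inv_le_card_multiples` for a superset of the multiples. -/
theorem mul_sum_inv_le_card {X : ℕ} {S V : Finset ℕ} {b : ℕ} (hS : ∀ q ∈ S, q.Prime)
    (hSV : S ⊆ V) (hV : ∀ t, 0 < t → t ≤ X → ∀ q ∈ S, q ∣ t → t ∈ V)
    (hb : #V ≤ b) (hcard : 16 * b ≤ X) :
    X * ∑ q ∈ S, (1 / q : ℝ) ≤ 4 * b := by
  have hsub : {t ∈ Ioc 0 X | ∃ q ∈ S, q ∣ t} ∪ S ⊆ V := by
    refine union_subset (fun t ht ↦ ?_) hSV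
    simp only [mem_filter, mem_Ioc] at ht
    obtain ⟨⟨h0, hX⟩, q, hq, hqt⟩ := ht
    exact hV t h0 hX q hq hqt
  have h := (card_le_card hsub).trans hb
  have h' : (#({t ∈ Ioc 0 X | ∃ q ∈ S, q ∣ t} ∪ S) : ℝ) ≤ b := by exact_mod_cast h
  linarith [mul_sum_inv_le_card_multiples X S hS (by omega)]

/-- A predicate that fails at `1` is left at most as often as it is entered. -/
theorem card_exits_le_card_entrances (P : ℕ → Prop) [DecidablePred P] (h1 : ¬P 1) (n : ℕ) :
    #{t ∈ Ioc 0 n | P t ∧ ¬P (t + 1)} ≤ #{t ∈ Ioc 0 n | ¬P t ∧ P (t + 1)} := by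
  suffices h : #{t ∈ Ioc 0 n | P t ∧ ¬P (t + 1)} + (if P (n + 1) then 1 else 0) =
      #{t ∈ Ioc 0 n | ¬P t ∧ P (t + 1)} by omega
  induction n with
  | zero => simp [h1]
  | succ n ih =>
    have hI : Ioc 0 (n + 1) = insert (n + 1) (Ioc 0 n) := by ext; simp; omega
    have hn : n + 1 ∉ Ioc 0 n := by simp
    rw [hI, filter_insert, filter_insert]
    by_cases hp : P (n + 1) <;> by_cases hp' : P (n + 1 + 1) <;>
      simp_all [card_insert_of_notMem]

/-- The value `m` occurs among the first `N` terms of `a`. -/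
def SeenBy (a : ℕ → ℕ) (N m : ℕ) : Prop := ∃ i, 1 ≤ i ∧ i ≤ N ∧ a i = m

theorem SeenBy.mono {a : ℕ → ℕ} {N N' m : ℕ} (h : SeenBy a N m) (hN : N ≤ N') : SeenBy a N' m := by
  obtain ⟨i, h1, h2, h3⟩ := h
  exact ⟨i, h1, h2.trans hN, h3⟩

namespace IsEKG

variable {a : ℕ → ℕ}

theorem ne_of_lt (ha : IsEKG a) {i j : ℕ} (hi : 1 ≤ i) (hij : i < j) : a i ≠ a j := by
  obtain ⟨h1, h2, h⟩ := ha
  obtain ⟨n, rfl⟩ : ∃ n, j = n + 1 := ⟨j - 1, by omega⟩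
  by_cases hn : 2 ≤ n
  · exact (h n hn).1.2.1 i hi (by omega)
  · obtain rfl : n = 1 := by omega
    obtain rfl : i = 1 := by omega
    simp [h1, h2]

theorem inj (ha : IsEKG a) {i j : ℕ} (hi : 1 ≤ i) (hj : 1 ≤ j) (hij : a i = a j) : i = j := by
  rcases lt_trichotomy i j with h | h | h
  · exact absurd hij (ha.ne_of_lt hi h)
  · exact h
  · exact absurd hij.symm (ha.ne_of_lt hj h)

theorem pos (ha : IsEKG a) {n : ℕ} (hn : 1 ≤ n) : 0 < a n := by
  obtain ⟨h1, h2, h⟩ := ha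
  rcases lt_trichotomy n 2 with h' | rfl | h'
  · obtain rfl : n = 1 := by omega
    omega
  · omega
  · obtain ⟨m, rfl⟩ : ∃ m, n = m + 1 := ⟨n - 1, by omega⟩
    exact (h m (by omega)).1.1

theorem le_of_not_seenBy (ha : IsEKG a) {n q m : ℕ} (hn : 2 ≤ n) (hq : q.Prime) (hqn : q ∣ a n)
    (hm : 0 < m) (hqm : q ∣ m) (h : ¬SeenBy a n m) : a (n + 1) ≤ m := by
  refine (ha.2.2 n hn).2 ⟨hm, fun i h1 h2 h3 ↦ h ⟨i, h1, h2, h3⟩, ?_⟩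
  exact hq.one_lt.trans_le (Nat.le_of_dvd (Nat.gcd_pos_of_pos_left _ hm) (Nat.dvd_gcd hqm hqn))

theorem not_seenBy_succ (ha : IsEKG a) (n : ℕ) : ¬SeenBy a n (a (n + 1)) := by
  rintro ⟨i, h1, h2, h3⟩
  exact ha.ne_of_lt h1 (by omega) h3

/-- A common prime factor of two consecutive terms controls the transition between them. -/
theorem exists_control (ha : IsEKG a) {n : ℕ} (hn : 2 ≤ n) :
    ∃ q, q.Prime ∧ q ∣ a n ∧ q ∣ a (n + 1) ∧
      ∀ m, 0 < m → q ∣ m → m < a (n + 1) → SeenBy a n m := by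
  have hg := (ha.2.2 n hn).1.2.2
  obtain ⟨q, hq, hqg⟩ := Nat.exists_prime_and_dvd hg.ne'
  rw [Nat.dvd_gcd_iff] at hqg
  refine ⟨q, hq, hqg.2, hqg.1, fun m hm hqm hlt ↦ ?_⟩
  by_contra h
  exact absurd (ha.le_of_not_seenBy hn hq hqg.2 hm hqm h) (by omega)

theorem card_le_of_forall_seenBy {N : ℕ} {V : Finset ℕ} (h : ∀ v ∈ V, SeenBy a N v) : #V ≤ N := by
  have hsub : V ⊆ (Ioc 0 N).image a := by
    intro v hv
    obtain ⟨i, h1, h2, h3⟩ := h v hv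
    exact mem_image.2 ⟨i, by simp; omega, h3⟩
  simpa using (card_le_card hsub).trans card_image_le

/-- If `q` divides `a n` then `a (n + 1) ≤ q * (n + 1)`. -/
theorem succ_le_mul (ha : IsEKG a) {n q : ℕ} (hn : 2 ≤ n) (hq : q.Prime) (hqn : q ∣ a n) :
    a (n + 1) ≤ q * (n + 1) := by
  by_contra! hlt
  have h : ∀ v ∈ (Ioc 0 (n + 1)).image (q * ·), SeenBy a n v := by
    intro v hv
    simp only [mem_image, mem_Ioc] at hv
    obtain ⟨j, ⟨hj0, hj⟩, rfl⟩ := hv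
    by_contra hns
    have := ha.le_of_not_seenBy hn hq hqn (Nat.mul_pos hq.pos hj0) (Dvd.intro _ rfl) hns
    have := Nat.mul_le_mul_left q hj
    omega
  have := card_le_of_forall_seenBy h
  rw [card_image_of_injective _ (fun x y hxy ↦ Nat.eq_of_mul_eq_mul_left hq.pos hxy)] at this
  simp at this

/-- An odd prime dividing one of the first `n` terms is at most `n`. -/
theorem prime_le (ha : IsEKG a) {n p : ℕ} (hp : p.Prime) (hp2 : p ≠ 2) (hn : 1 ≤ n)
    (hpn : p ∣ a n) : p ≤ n := by
  induction n using Nat.strong_induction_on with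
  | _ n ih =>
    have hn1 : n ≠ 1 := by
      rintro rfl
      rw [ha.1] at hpn
      exact hp.one_lt.ne' (Nat.dvd_one.1 hpn)
    have hn2 : n ≠ 2 := by
      rintro rfl
      rw [ha.2.1] at hpn
      exact hp2 ((Nat.prime_dvd_prime_iff_eq hp Nat.prime_two).1 hpn)
    obtain ⟨j, rfl⟩ : ∃ j, n = j + 1 := ⟨n - 1, by omega⟩
    by_cases hpj : p ∣ a j
    · exact (ih j (by omega) (by omega) hpj).trans (by omega)
    obtain ⟨q, hq, hqj, hqj', -⟩ := ha.exists_control (n := j) (by omega)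
    have hpq : p ≠ q := by rintro rfl; exact hpj hqj
    have hdvd := Nat.Coprime.mul_dvd_of_dvd_of_dvd ((Nat.coprime_primes hq hp).2 hpq.symm) hqj' hpn
    have h1 := Nat.le_of_dvd (ha.pos hn) hdvd
    exact Nat.le_of_mul_le_mul_left (h1.trans (ha.succ_le_mul (by omega) hq hqj)) hq.pos


theorem le_mul (ha : IsEKG a) {n : ℕ} (hn : 1 ≤ n) : a n ≤ 320 * n := by
  classical
  induction n using Nat.strong_induction_on with
  | _ n ih =>
  by_contra! hlt
  have hn1 : n ≠ 1 := by rintro rfl; have := ha.1; omega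
  have hn2 : n ≠ 2 := by rintro rfl; have := ha.2.1; omega
  obtain ⟨N, rfl⟩ : ∃ N, n = N + 1 := ⟨n - 1, by omega⟩
  obtain ⟨p, hp, hpN, ⟨k, hk⟩, hseen⟩ := ha.exists_control (n := N) (by omega)
  have hp2 : p ≠ 2 := by
    rintro rfl
    have := ha.succ_le_mul (by omega) hp hpN
    omega
  have hp3 : 3 ≤ p := by have := hp.two_le; omega
  have hpN' : p ≤ N := ha.prime_le hp hp2 (by omega) hpN
  obtain ⟨X, hX⟩ : ∃ X, X = 16 * (N + 1) := ⟨_, rfl⟩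
  have hXk : 20 * X < p * k := by omega
  have hkbig : 320 < k := by
    by_contra! h
    have := Nat.mul_le_mul hpN' h
    omega
  have hM : ∀ t, 1 ≤ t → t ≤ N + 1 → a t ≤ p * k := by
    intro t h1 h2
    rcases Nat.lt_or_ge t (N + 1) with h | h
    · have := ih t h h1
      omega
    · obtain rfl : t = N + 1 := by omega
      omega
  let P : ℕ → Prop := fun t ↦ p ∣ a t ∧ X < a t
  have hP1 : ¬P 1 := by
    rintro ⟨h, -⟩
    rw [ha.1] at h
    exact hp.one_lt.ne' (Nat.dvd_one.1 h)
  have hP2 : ¬p ∣ a 2 := by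
    rw [ha.2.1]
    exact fun h ↦ hp2 ((Nat.prime_dvd_prime_iff_eq hp Nat.prime_two).1 h)
  let S : Finset ℕ := {q ∈ range (p * k + 1) | q.Prime ∧ q ≠ p ∧ SeenBy a N q ∧
    ∀ m, 0 < m → m ≤ X → q ∣ m → SeenBy a N m}
  have hS : ∀ q ∈ S, q.Prime ∧ q ≠ p ∧ SeenBy a N q ∧
      ∀ m, 0 < m → m ≤ X → q ∣ m → SeenBy a N m := fun q hq ↦ (mem_filter.1 hq).2
  have hmemV : ∀ m, SeenBy a N m → m ∈ (Ioc 0 N).image a := by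
    rintro m ⟨i, h1, h2, rfl⟩
    exact mem_image_of_mem a (by simp; omega)
  have hσ : (X : ℝ) * ∑ q ∈ S, (1 / q : ℝ) ≤ 4 * N :=
    mul_sum_inv_le_card (V := (Ioc 0 N).image a) (fun q hq ↦ (hS q hq).1)
      (fun q hq ↦ hmemV q (hS q hq).2.2.1)
      (fun t h0 hX q hq hqt ↦ hmemV t ((hS q hq).2.2.2 t h0 hX hqt))
      (by simpa using card_image_le (s := Ioc 0 N) (f := a)) (by omega)
  have hσ' : ∑ q ∈ S, (1 / q : ℝ) ≤ 1 / 4 := by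
    have hX' : (X : ℝ) = 16 * (N + 1) := by rw [hX]; push_cast; ring
    have : (0 : ℝ) ≤ N := Nat.cast_nonneg N
    rw [hX'] at hσ
    by_contra! h
    nlinarith
  have hexits : (k - 1) / 2 - X / p ≤ #{t ∈ Ioc 0 N | P t ∧ ¬P (t + 1)} := by
    have hsub : Ioc (X / p) ((k - 1) / 2) ⊆
        ({t ∈ Ioc 0 N | P t ∧ ¬P (t + 1)}).image fun t ↦ a t / (2 * p) := by
      intro u hu
      rw [mem_Ioc, Nat.div_lt_iff_lt_mul hp.pos] at hu
      have hu1 : p * (2 * u) < p * k := Nat.mul_lt_mul_of_pos_left (by omega) hp.pos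
      have hu2 : X < p * (2 * u) := by nlinarith
      obtain ⟨t, h1, h2, h3⟩ := hseen (p * (2 * u)) (by omega) (Dvd.intro _ rfl) (by omega)
      have ht2 : 2 ≤ t := by
        by_contra! h
        obtain rfl : t = 1 := by omega
        exact hP1 ⟨h3 ▸ Dvd.intro _ rfl, by omega⟩
      have hev : 2 ∣ a t := ⟨p * u, by rw [h3]; ring⟩
      have hnext := ha.succ_le_mul ht2 Nat.prime_two hev
      refine mem_image.2 ⟨t, mem_filter.2 ⟨by simp; omega, ⟨h3 ▸ Dvd.intro _ rfl, by omega⟩,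
        fun h ↦ ?_⟩, ?_⟩
      · have := h.2
        omega
      · rw [h3, show p * (2 * u) = 2 * p * u by ring]
        exact Nat.mul_div_cancel_left u (by omega)
    simpa using (card_le_card hsub).trans card_image_le
  have hentr : #{t ∈ Ioc 0 N | ¬P t ∧ P (t + 1)} ≤
      X / p + #{u ∈ Ioc 0 k | ∃ q ∈ S, q ∣ u} := by
    rw [← card_filter_add_card_filter_not (s := {t ∈ Ioc 0 N | ¬P t ∧ P (t + 1)})
      (fun t ↦ p ∣ a t)]
    refine add_le_add ?_ ?_
    · rw [← Nat.Ioc_filter_dvd_card_eq_div]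
      refine card_le_card_of_injOn a ?_ ?_
      · intro t ht
        simp only [coe_filter, mem_filter, mem_Ioc, Set.mem_ofPred_eq, P] at ht ⊢
        have := ha.pos (n := t) (by omega)
        grind
      · intro t ht t' ht' h
        simp only [coe_filter, mem_filter, mem_Ioc, Set.mem_ofPred_eq] at ht ht'
        exact ha.inj (by omega) (by omega) h
    · refine card_le_card_of_injOn (fun t ↦ a (t + 1) / p) ?_ ?_
      · intro t ht
        simp only [coe_filter, mem_filter, mem_Ioc, Set.mem_ofPred_eq, P] at ht ⊢
        obtain ⟨⟨⟨ht0, htN⟩, -, ⟨u, hu⟩, hXt⟩, hpt⟩ := ht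
        have ht2 : 2 ≤ t := by
          by_contra! h
          obtain rfl : t = 1 := by omega
          exact hP2 ⟨u, hu⟩
        have hMt := hM (t + 1) (by omega) (by omega)
        obtain ⟨q, hq, hqt, hqt', hqs⟩ := ha.exists_control ht2
        have hqp : q ≠ p := by rintro rfl; exact hpt hqt
        rw [hu, Nat.mul_div_cancel_left u hp.pos]
        have hu0 : 0 < u := by
          rcases Nat.eq_zero_or_pos u with rfl | h
          · omega
          · exact h
        have hqu : q ∣ u := by
          rw [hu] at hqt'
          exact (Nat.Coprime.dvd_mul_left ((Nat.coprime_primes hq hp).2 hqp)).1 hqt'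
        have hqu' : q ≤ u := Nat.le_of_dvd hu0 hqu
        have hqlt : q < a (t + 1) := by nlinarith
        refine ⟨⟨hu0, Nat.le_of_mul_le_mul_left (hu ▸ hMt) hp.pos⟩, q, ?_, hqu⟩
        refine mem_filter.2 ⟨by simp; omega, hq, hqp, ?_, ?_⟩
        · exact (hqs q hq.pos dvd_rfl hqlt).mono htN
        · exact fun m h0 hmX hqm ↦ (hqs m h0 hqm (by omega)).mono htN
      · intro t ht t' ht' h
        simp only [coe_filter, mem_filter, mem_Ioc, Set.mem_ofPred_eq, P] at ht ht'
        have := ha.inj (by omega) (by omega) (Nat.div_left_inj ht.1.2.2.1 ht'.1.2.2.1 |>.1 h)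
        omega
  have hmult : 4 * #{u ∈ Ioc 0 k | ∃ q ∈ S, q ∣ u} ≤ k := by
    have h := card_multiples_le S k
    have hk0 : (0 : ℝ) ≤ k := Nat.cast_nonneg k
    have h' : (4 * #{u ∈ Ioc 0 k | ∃ q ∈ S, q ∣ u} : ℝ) ≤ k := by nlinarith
    exact_mod_cast h'
  have hXp : 20 * (X / p) < k := by
    have := Nat.mul_div_le X p
    by_contra! h
    have := Nat.mul_le_mul_left p h
    nlinarith
  have := card_exits_le_card_entrances P hP1 N
  omega

theorem seenBy_of_two_dvd (ha : IsEKG a) {N m : ℕ} (hm : 0 < m) (h2 : 2 ∣ m)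
    (hN : 163968 * m ≤ N) : SeenBy a N m := by
  classical
  refine SeenBy.mono ?_ hN
  clear hN
  obtain ⟨X, hX⟩ : ∃ X, X = 20496 * m := ⟨_, rfl⟩
  obtain ⟨N, hN⟩ : ∃ N, N = 163968 * m := ⟨_, rfl⟩
  rw [← hN]
  by_contra hns
  have ha1 := ha.1
  have ha2 := ha.2.1
  let E : Finset ℕ := {i ∈ Ioc 0 N | 2 ∣ a i}
  have hE : #E ≤ m := by
    have : #E ≤ #(Ioc 0 m) := by
      refine card_le_card_of_injOn (fun i ↦ a (i + 1)) ?_ ?_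
      · intro i hi
        simp only [E, coe_filter, mem_Ioc, Set.mem_ofPred_eq] at hi
        have hi2 : 2 ≤ i := by
          by_contra! h
          obtain rfl : i = 1 := by omega
          omega
        have h0 := ha.pos (n := i + 1) (by omega)
        have h1 := ha.le_of_not_seenBy hi2 Nat.prime_two hi.2 hm h2
          (fun h ↦ hns (h.mono hi.1.2))
        simp
        omega
      · intro i hi j hj h
        have := ha.inj (by omega) (by omega) h
        omega
    simpa using this
  let S : Finset ℕ := {q ∈ range (320 * N + 1) | q.Prime ∧ SeenBy a N (2 * q) ∧
    ∀ t, 0 < t → t ≤ X → q ∣ t → SeenBy a N (2 * t)}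
  have hS : ∀ q ∈ S, q.Prime ∧ SeenBy a N (2 * q) ∧
      ∀ t, 0 < t → t ≤ X → q ∣ t → SeenBy a N (2 * t) := fun q hq ↦ (mem_filter.1 hq).2
  have hmemV : ∀ t, SeenBy a N (2 * t) → t ∈ E.image (a · / 2) := by
    rintro t ⟨i, h1, h2, h3⟩
    refine mem_image.2 ⟨i, mem_filter.2 ⟨by simp; omega, by omega⟩, by omega⟩
  have hσ : (X : ℝ) * ∑ q ∈ S, (1 / q : ℝ) ≤ 4 * m :=
    mul_sum_inv_le_card (V := E.image (a · / 2)) (fun q hq ↦ (hS q hq).1)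
      (fun q hq ↦ hmemV q (hS q hq).2.1)
      (fun t h0 hX q hq hqt ↦ hmemV t ((hS q hq).2.2 t h0 hX hqt))
      (card_image_le.trans hE) (by omega)
  let Q : Finset ℕ := {i ∈ Ioc 0 N | ∃ q ∈ S, q ∣ a i}
  have hQ : #Q ≤ 10240 * m := by
    have h1 : #Q ≤ #{t ∈ Ioc 0 (320 * N) | ∃ q ∈ S, q ∣ t} := by
      refine card_le_card_of_injOn a ?_ ?_
      · intro i hi
        simp only [Q, coe_filter, mem_Ioc, Set.mem_ofPred_eq] at hi ⊢
        have h0 := ha.pos (n := i) (by omega)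
        have h1 := ha.le_mul (n := i) (by omega)
        exact ⟨⟨h0, by omega⟩, hi.2⟩
      · intro i hi j hj h
        simp only [Q, coe_filter, mem_Ioc, Set.mem_ofPred_eq] at hi hj
        exact ha.inj (by omega) (by omega) h
    have h2 := card_multiples_le S (320 * N)
    have h3 : ((320 * N : ℕ) : ℝ) = 2560 * X := by
      have : 320 * N = 2560 * X := by omega
      rw [this]
      push_cast
      ring
    rw [h3] at h2
    have h4 : (#Q : ℝ) ≤ #{t ∈ Ioc 0 (320 * N) | ∃ q ∈ S, q ∣ t} := by exact_mod_cast h1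
    have h5 : (#Q : ℝ) ≤ 10240 * m := by linarith
    exact_mod_cast h5
  have hmemS : ∀ i, 1 ≤ i → i + 1 ≤ N → 2 * X < a (i + 1) → ∀ q, q.Prime →
      (∀ t, 0 < t → q ∣ t → t < a (i + 1) → SeenBy a i t) → 3 * q ≤ a (i + 1) → q ∈ S := by
    intro i hi hiN hXi q hq hseen hq3
    have h1 := ha.le_mul (n := i + 1) (by omega)
    have hq0 := hq.pos
    refine mem_filter.2 ⟨by simp; omega, hq, ?_, fun t h0 htX hqt ↦ ?_⟩
    · exact (hseen (2 * q) (by omega) (Dvd.intro_left _ rfl) (by omega)).mono (by omega)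
    · exact (hseen (2 * t) (by omega) (hqt.mul_left 2) (by omega)).mono (by omega)
  have hcover : Ioc 0 N ⊆
      ({i ∈ Ioc 0 N | a i ≤ 2 * X} ∪ (E ∪ Q)) ∪ (E ∪ Q).image (· + 1) := by
    intro i hi
    have hi' := mem_Ioc.1 hi
    by_contra hcon
    simp only [mem_union, mem_image, mem_filter, not_or, not_and, not_exists, E, Q] at hcon
    obtain ⟨⟨hsmall, hEi, hQi⟩, hpred⟩ := hcon
    have hXi := hsmall hi
    have hodd := hEi hi
    have hi3 : 3 ≤ i := by
      by_contra! h
      interval_cases i <;> omega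
    obtain ⟨j, rfl⟩ : ∃ j, i = j + 1 := ⟨i - 1, by omega⟩
    obtain ⟨q, hq, hqj, hqi, hseen⟩ := ha.exists_control (n := j) (by omega)
    have hj := hpred j
    simp only [mem_Ioc, not_true_eq_false, imp_false, not_or, not_and, not_exists] at hj
    obtain ⟨hj2, hjQ⟩ := hj
    have hj2 := hj2 (by omega)
    have hjQ := hjQ (by omega)
    obtain ⟨s, hs⟩ := hqi
    have hq2 : q ≠ 2 := by rintro rfl; exact hodd ⟨s, hs⟩
    have hq3 : 3 ≤ q := by have := hq.two_le; omega
    have hs0 : s ≠ 0 := by rintro rfl; omega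
    have hs2 : s ≠ 2 := by rintro rfl; omega
    have hs1 : s = 1 := by
      by_contra hs1
      have h3 : 3 * q ≤ a (j + 1) := by
        rw [hs, mul_comm]
        exact Nat.mul_le_mul_left q (by omega)
      exact hQi hi q (hmemS j (by omega) (by omega) (by omega) q hq hseen h3) ⟨s, hs⟩
    subst hs1
    rw [mul_one] at hs
    obtain ⟨s, hs'⟩ := hqj
    have hs0 : s ≠ 0 := by
      rintro rfl
      have := ha.pos (n := j) (by omega)
      omega
    have hs1 : s ≠ 1 := by
      rintro rfl
      exact ha.ne_of_lt (i := j) (j := j + 1) (by omega) (by omega) (by omega)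
    have hs2 : s ≠ 2 := by rintro rfl; omega
    have hs3 : 3 * q ≤ a j := by
      rw [hs', mul_comm]
      exact Nat.mul_le_mul_left q (by omega)
    have hj3 : 3 ≤ j := by
      by_contra! h
      obtain rfl : j = 2 := by omega
      omega
    obtain ⟨l, rfl⟩ : ∃ l, j = l + 1 := ⟨j - 1, by omega⟩
    obtain ⟨r, hr, -, hrj, hrseen⟩ := ha.exists_control (n := l) (by omega)
    have hrq : r ≠ q := by
      rintro rfl
      refine ha.not_seenBy_succ (l + 1) ?_
      rw [hs]
      exact (hrseen r hr.pos dvd_rfl (by omega)).mono (by omega)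
    have hdvd := Nat.Coprime.mul_dvd_of_dvd_of_dvd ((Nat.coprime_primes hr hq).2 hrq) hrj
      ⟨s, hs'⟩
    have hle := Nat.le_of_dvd (ha.pos (by omega)) hdvd
    refine hjQ r (hmemS l (by omega) (by omega) (by omega) r hr hrseen ?_) hrj
    nlinarith
  have hsmall : #{i ∈ Ioc 0 N | a i ≤ 2 * X} ≤ 2 * X := by
    have : #{i ∈ Ioc 0 N | a i ≤ 2 * X} ≤ #(Ioc 0 (2 * X)) := by
      refine card_le_card_of_injOn a ?_ ?_
      · intro i hi
        simp only [coe_filter, mem_Ioc, Set.mem_ofPred_eq, coe_Ioc, Set.mem_Ioc] at hi ⊢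
        exact ⟨ha.pos (by omega), hi.2⟩
      · intro i hi j hj h
        simp only [coe_filter, mem_Ioc, Set.mem_ofPred_eq] at hi hj
        exact ha.inj (by omega) (by omega) h
    simpa using this
  have h1 := card_le_card hcover
  rw [Nat.card_Ioc] at h1
  have h2 := card_union_le ({i ∈ Ioc 0 N | a i ≤ 2 * X} ∪ (E ∪ Q)) ((E ∪ Q).image (· + 1))
  have h3 := card_union_le {i ∈ Ioc 0 N | a i ≤ 2 * X} (E ∪ Q)
  have h4 := card_union_le E Q
  have h5 := card_image_le (s := E ∪ Q) (f := (· + 1))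
  omega

theorem exists_forall_seenBy (ha : IsEKG a) :
    ∃ K, ∀ N m, 0 < m → K * m ≤ N → SeenBy a N m := by
  classical
  refine ⟨327936 * 1679032324, fun N m hm hN ↦ ?_⟩
  by_contra hns
  have hm1 : m ≠ 1 := by
    rintro rfl
    exact hns ⟨1, le_rfl, by omega, ha.1⟩
  obtain ⟨p, hp, hpm⟩ := Nat.exists_prime_and_dvd hm1
  have hpm' := Nat.le_of_dvd hm hpm
  obtain ⟨X, hX⟩ : ∃ X, X = 16 * m := ⟨_, rfl⟩
  obtain ⟨N₁, hN₁⟩ : ∃ N₁, N₁ = 327936 * X := ⟨_, rfl⟩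
  obtain ⟨Z, hZ⟩ : ∃ Z, Z = 1679032324 * m := ⟨_, rfl⟩
  have heven₁ : ∀ t, 0 < t → t ≤ X → SeenBy a N₁ (2 * t) := fun t h0 ht ↦
    ha.seenBy_of_two_dvd (by omega) (by omega) (by omega)
  have heven : ∀ t, 0 < t → t ≤ Z → SeenBy a N (2 * t) := fun t h0 ht ↦
    ha.seenBy_of_two_dvd (by omega) (by omega) (by omega)
  let R : Finset ℕ := {r ∈ Ioc 0 m | r.Prime ∧ ∃ t, 0 < t ∧ t ≤ m ∧ r ∣ t ∧ ¬SeenBy a N₁ t}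
  have hR : ∀ r ∈ R, r ≤ m ∧ r.Prime ∧ ∃ t, 0 < t ∧ t ≤ m ∧ r ∣ t ∧ ¬SeenBy a N₁ t := by
    intro r hr
    have := mem_filter.1 hr
    exact ⟨(mem_Ioc.1 this.1).2, this.2⟩
  let V : Finset ℕ := {t ∈ Ioc 0 X | ∃ r ∈ R, r ∣ t}
  have hV : #V ≤ m := by
    have hsub : V ⊆
        ({i ∈ Ioc 0 N₁ | a (i + 1) ∈ Ioc 0 m}).image fun i ↦ a i / 2 := by
      intro v hv
      obtain ⟨hvX, r, hr, hrv⟩ := mem_filter.1 hv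
      rw [mem_Ioc] at hvX
      obtain ⟨i, h1, h2, h3⟩ := heven₁ v hvX.1 hvX.2
      obtain ⟨-, hrp, t, ht0, htm, hrt, hts⟩ := hR r hr
      have hi2 : 2 ≤ i := by
        by_contra! h
        obtain rfl : i = 1 := by omega
        have := ha.1
        omega
      have h4 := ha.le_of_not_seenBy hi2 hrp (by rw [h3]; exact hrv.mul_left 2) ht0 hrt
        (fun h ↦ hts (h.mono h2))
      have h5 := ha.pos (n := i + 1) (by omega)
      refine mem_image.2 ⟨i, mem_filter.2 ⟨by simp; omega, by simp; omega⟩, by omega⟩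
    have hle : #{i ∈ Ioc 0 N₁ | a (i + 1) ∈ Ioc 0 m} ≤ #(Ioc 0 m) := by
      refine card_le_card_of_injOn (fun i ↦ a (i + 1)) ?_ ?_
      · intro i hi
        exact (mem_filter.1 hi).2
      · intro i hi j hj h
        have := ha.inj (by omega) (by omega) h
        omega
    simpa using (card_le_card hsub).trans (card_image_le.trans hle)
  have hσ : (X : ℝ) * ∑ r ∈ R, (1 / r : ℝ) ≤ 4 * m := by
    refine mul_sum_inv_le_card (V := V) (fun r hr ↦ (hR r hr).2.1) (fun r hr ↦ ?_)
      (fun t h0 hX r hr hrt ↦ mem_filter.2 ⟨by simp; omega, r, hr, hrt⟩) hV (by omega)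
    have h1 := (hR r hr).1
    have h2 := (hR r hr).2.1.pos
    exact mem_filter.2 ⟨by simp; omega, r, hr, dvd_rfl⟩
  have hσ' : ∑ r ∈ R, (1 / r : ℝ) ≤ 1 / 4 := by
    have hX' : (X : ℝ) = 16 * m := by rw [hX]; push_cast; ring
    have hm' : (0 : ℝ) < m := by exact_mod_cast hm
    rw [hX'] at hσ
    by_contra! h
    nlinarith
  have hex : ∀ j, ∃ i, j ∈ Ioc 0 (Z / p) → 2 ≤ i ∧ i ≤ N ∧ a i = 2 * (p * j) := by
    intro j
    by_cases hj : j ∈ Ioc 0 (Z / p)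
    · have hj' := mem_Ioc.1 hj
      rw [Nat.le_div_iff_mul_le hp.pos, mul_comm] at hj'
      obtain ⟨i, h1, h2, h3⟩ := heven (p * j) (Nat.mul_pos hp.pos hj'.1) hj'.2
      refine ⟨i, fun _ ↦ ⟨?_, h2, h3⟩⟩
      by_contra! h
      obtain rfl : i = 1 := by omega
      have := ha.1
      omega
    · exact ⟨0, fun h ↦ absurd h hj⟩
  choose f hf using hex
  have hnext : ∀ j ∈ Ioc 0 (Z / p), a (f j + 1) ∈ Ioc 0 m := by
    intro j hj
    obtain ⟨h1, h2, h3⟩ := hf j hj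
    rw [mem_Ioc]
    refine ⟨ha.pos (by omega), ha.le_of_not_seenBy h1 hp ?_ hm hpm fun h ↦ hns (h.mono h2)⟩
    exact h3 ▸ ⟨2 * j, by ring⟩
  have hcover : Ioc 0 (Z / p) ⊆ (Ioc 0 (160 * N₁ / p) ∪
      {j ∈ Ioc 0 (Z / p) | p ∣ a (f j + 1)}) ∪ {j ∈ Ioc 0 (Z / p) | ∃ r ∈ R, r ∣ j} := by
    intro j hj
    obtain ⟨h1, h2, h3⟩ := hf j hj
    have hj' := mem_Ioc.1 hj
    have hn := mem_Ioc.1 (hnext j hj)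
    rcases (Nat.lt_or_ge N₁ (f j)).symm with hfj | hfj
    · refine mem_union_left _ (mem_union_left _ (mem_Ioc.2 ⟨hj'.1, ?_⟩))
      have := ha.le_mul (n := f j) (by omega)
      rw [Nat.le_div_iff_mul_le hp.pos, mul_comm]
      omega
    by_cases hpj : p ∣ a (f j + 1)
    · exact mem_union_left _ (mem_union_right _ (mem_filter.2 ⟨hj, hpj⟩))
    obtain ⟨r, hr, hrj, hrj', -⟩ := ha.exists_control h1
    have hrp : r ≠ p := by rintro rfl; exact hpj hrj'
    have hns₁ : ¬SeenBy a N₁ (a (f j + 1)) :=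
      fun h ↦ ha.not_seenBy_succ (f j) (h.mono hfj.le)
    have hr2 : r ≠ 2 := by
      rintro rfl
      obtain ⟨u, hu⟩ := hrj'
      rw [hu] at hns₁
      exact hns₁ (heven₁ u (by omega) (by omega))
    rw [h3] at hrj
    have hrj2 := (Nat.Coprime.dvd_mul_left ((Nat.coprime_primes hr Nat.prime_two).2 hr2)).1 hrj
    have hrj3 := (Nat.Coprime.dvd_mul_left ((Nat.coprime_primes hr hp).2 hrp)).1 hrj2
    have hrm := (Nat.le_of_dvd hn.1 hrj').trans hn.2
    exact mem_union_right _ (mem_filter.2 ⟨hj, r, mem_filter.2 ⟨mem_Ioc.2 ⟨hr.pos, hrm⟩, hr,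
      _, hn.1, hn.2, hrj', hns₁⟩, hrj3⟩)
  have hcard₂ : #{j ∈ Ioc 0 (Z / p) | p ∣ a (f j + 1)} ≤ m / p := by
    rw [← Nat.Ioc_filter_dvd_card_eq_div m p]
    refine card_le_card_of_injOn (fun j ↦ a (f j + 1)) ?_ ?_
    · intro j hj
      have hj' := mem_filter.1 hj
      exact mem_filter.2 ⟨hnext j hj'.1, hj'.2⟩
    · intro j hj j' hj' h
      obtain ⟨-, -, h1⟩ := hf j (mem_filter.1 hj).1
      obtain ⟨-, -, h2⟩ := hf j' (mem_filter.1 hj').1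
      have h3 : f j = f j' := by
        have := ha.inj (by omega) (by omega) h
        omega
      rw [h3, h2] at h1
      exact (Nat.eq_of_mul_eq_mul_left hp.pos (by omega : p * j' = p * j)).symm
  have hcard₃ : 4 * #{j ∈ Ioc 0 (Z / p) | ∃ r ∈ R, r ∣ j} ≤ Z / p := by
    have h := card_multiples_le R (Z / p)
    have h0 : (0 : ℝ) ≤ (Z / p : ℕ) := Nat.cast_nonneg _
    have h' : (4 * #{j ∈ Ioc 0 (Z / p) | ∃ r ∈ R, r ∣ j} : ℝ) ≤ (Z / p : ℕ) := by nlinarith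
    exact_mod_cast h'
  have h1 := (card_le_card hcover).trans (card_union_le _ _)
  have h2 := card_union_le (Ioc 0 (160 * N₁ / p)) {j ∈ Ioc 0 (Z / p) | p ∣ a (f j + 1)}
  simp only [Nat.card_Ioc] at h1 h2
  have h3 : 3 * (Z / p) ≤ 4 * (160 * N₁ / p) + 4 * (m / p) := by omega
  have h4 := Nat.mul_le_mul_left p h3
  have h5 := Nat.mul_div_le (160 * N₁) p
  have h6 := Nat.mul_div_le m p
  have h7 := Nat.div_add_mod Z p
  have h8 := Nat.mod_lt Z hp.pos
  have h9 : 3 * (p * (Z / p)) ≤ 4 * (p * (160 * N₁ / p)) + 4 * (p * (m / p)) := by linarith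
  omega

end IsEKG

end

theorem ekg_linear_growth (a : ℕ → ℕ) (ha : IsEKG a) :
    ∃ c₁ c₂ : ℝ, 0 < c₁ ∧ 0 < c₂ ∧
      ∀ n : ℕ, 1 ≤ n → c₁ * n < (a n : ℝ) ∧ (a n : ℝ) < c₂ * n := by
  obtain ⟨K, hK⟩ := ha.exists_forall_seenBy
  refine ⟨1 / (K + 2), 321, by positivity, by norm_num, fun n hn ↦ ⟨?_, ?_⟩⟩
  · have hpos := ha.pos hn
    obtain ⟨N, rfl⟩ : ∃ N, n = N + 1 := ⟨n - 1, by omega⟩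
    have hlt : N < K * a (N + 1) := by
      by_contra! h
      exact ha.not_seenBy_succ N (hK N _ hpos h)
    rw [one_div, inv_mul_lt_iff₀ (by positivity)]
    have h : N + 1 < (K + 2) * a (N + 1) := by nlinarith
    exact_mod_cast h
  · have h1 : a n < 321 * n := by
      have := ha.le_mul hn
      omega
    exact_mod_cast h1
end

section
/- Let b : ℕ → ℕ (indexed from 1) satisfy: b(1) = 1, and for every n ≥ 1, b(n+1) is the largest k such that the finite word b(1), b(2), …, b(n) can be written as a concatenation X Y^k, where X is a (possibly empty) finite word and Y is a nonempty finite word repeated k times. Then every positive integer occurs in the sequence: for every m ≥ 1 there exists n with b(n) = m. In particular, the sequence is unbounded. -/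
/-- The word `b 1, b 2, …, b n` as a list. -/
def gword (b : ℕ → ℕ) (n : ℕ) : List ℕ :=
  (List.range n).map fun i => b (i + 1)

/-- Gijswijt's sequence property: `b 1 = 1` and for `n ≥ 1`, `b (n+1)` is the
largest `k` such that `b 1, …, b n` can be written as `X ++ Y^k` with `Y` nonempty. -/
def IsGijswijt (b : ℕ → ℕ) : Prop :=
  b 1 = 1 ∧
    ∀ n, 1 ≤ n →
      IsGreatest {k : ℕ | ∃ X Y : List ℕ, Y ≠ [] ∧
        gword b n = X ++ (List.replicate k Y).flatten} (b (n + 1))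


namespace Gijswijt

/-- `EndsInPow a n k y` says that the word `a 0, …, a (n-1)` ends in a `k`-th power of a word of
length `y`. -/
def EndsInPow (a : ℕ → ℕ) (n k y : ℕ) : Prop :=
  0 < y ∧ k * y ≤ n ∧ ∀ i, n ≤ i + k * y → i + y < n → a (i + y) = a i

/-- The sequence `a` satisfies Gijswijt's recurrence with every term raised to at least `m`. -/
def IsLevel (m : ℕ) (a : ℕ → ℕ) : Prop :=
  ∀ n, m ≤ a n ∧ ∀ k, m < k → (k ≤ a n ↔ ∃ y, EndsInPow a n k y)

theorem EndsInPow.le {a : ℕ → ℕ} {n k y : ℕ} (h : EndsInPow a n k y) : k ≤ n :=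
  (Nat.le_mul_of_pos_right k h.1).trans h.2.1

theorem EndsInPow.congr {a a' : ℕ → ℕ} {n k y : ℕ} (h : EndsInPow a n k y) (e : ∀ i < n, a i = a' i) :
    EndsInPow a' n k y :=
  ⟨h.1, h.2.1, fun i h1 h2 => by rw [← e _ h2, ← e i (by omega)]; exact h.2.2 i h1 h2⟩

theorem endsInPow_shift {a a' : ℕ → ℕ} {t M k y : ℕ} (e : ∀ i < M, a (t + i) = a' i)
    (hk : k * y ≤ M) : EndsInPow a (t + M) k y ↔ EndsInPow a' M k y := by
  constructor
  · rintro ⟨h0, -, h⟩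
    refine ⟨h0, hk, fun i h1 h2 => ?_⟩
    rw [← e _ h2, ← e i (by omega)]
    simpa only [add_assoc] using h (t + i) (by omega) (by omega)
  · rintro ⟨h0, -, h⟩
    refine ⟨h0, by omega, fun i h1 h2 => ?_⟩
    obtain ⟨j, rfl⟩ : ∃ j, i = t + j := ⟨i - t, by omega⟩
    rw [add_assoc, e _ (by omega), e j (by omega)]
    exact h j (by omega) (by omega)

theorem EndsInPow.of_period {a : ℕ → ℕ} {k y : ℕ} (hy : 0 < y)
    (h : ∀ i, i + y < k * y → a (i + y) = a i) : EndsInPow a (k * y) k y :=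
  ⟨hy, le_rfl, fun i _ h2 => h i h2⟩

theorem eq_of_forall_gt_le_iff {m x y : ℕ} (hx : m ≤ x) (hy : m ≤ y)
    (h : ∀ k, m < k → (k ≤ x ↔ k ≤ y)) : x = y := by
  by_contra hne
  rcases Nat.lt_or_gt_of_ne hne with hlt | hlt
  · have := (h y (by omega)).2 le_rfl
    omega
  · have := (h x (by omega)).1 le_rfl
    omega

theorem IsLevel.zero {m : ℕ} {a : ℕ → ℕ} (h : IsLevel m a) : a 0 = m := by
  by_contra hne
  have h0 := (h 0).1
  obtain ⟨y, hy⟩ := ((h 0).2 (a 0) (by omega)).1 le_rfl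
  have := hy.le
  omega

open Classical in
/-- The sequence starting with `m` which satisfies Gijswijt's recurrence with every term raised
to at least `m`. -/
noncomputable def level (m : ℕ) (n : ℕ) : ℕ :=
  Nat.findGreatest
    (fun k => k ≤ m ∨ ∃ y, EndsInPow (fun i => if _h : i < n then level m i else 0) n k y) (n + m)
termination_by n

theorem exists_endsInPow_mono {a : ℕ → ℕ} {n k k' : ℕ} (h : ∃ y, EndsInPow a n k y) (hk : k' ≤ k) :
    ∃ y, EndsInPow a n k' y := by
  obtain ⟨y, h0, h1, h2⟩ := h
  have := Nat.mul_le_mul_right y hk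
  exact ⟨y, h0, by omega, fun i h3 h4 => h2 i (by omega) h4⟩

theorem isLevel_level (m : ℕ) : IsLevel m (level m) := by
  classical
  intro n
  have hc : ∀ k, (∃ y, EndsInPow (fun i => if _h : i < n then level m i else 0) n k y) ↔
      ∃ y, EndsInPow (level m) n k y := fun k =>
    ⟨fun ⟨y, h⟩ => ⟨y, h.congr fun i hi => by simp [hi]⟩,
      fun ⟨y, h⟩ => ⟨y, h.congr fun i hi => by simp [hi]⟩⟩
  have hd : level m n =
      Nat.findGreatest (fun k => k ≤ m ∨ ∃ y, EndsInPow (level m) n k y) (n + m) := by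
    conv_lhs => rw [level]
    simp only [hc]
  have hm : m ≤ level m n := by
    rw [hd]
    exact Nat.le_findGreatest (by omega) (Or.inl le_rfl)
  refine ⟨hm, fun k hk => ⟨fun h => ?_, fun h => ?_⟩⟩
  · have := Nat.findGreatest_spec (P := fun k => k ≤ m ∨ ∃ y, EndsInPow (level m) n k y)
      (m := m) (n := n + m) (by omega) (Or.inl le_rfl)
    rw [← hd] at this
    rcases this with h' | h'
    · omega
    · exact exists_endsInPow_mono h' h
  · rw [hd]
    obtain ⟨y, hy⟩ := h
    have := hy.le
    exact Nat.le_findGreatest (by omega) (Or.inr ⟨y, hy⟩)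

/-- The prefix of `A` of length `L` ends in the letter `m` followed by the first `N` terms of
`A'`, and contains no other occurrence of `m` followed by `N` letters larger than `m`. -/
structure IsBlock (m : ℕ) (A A' : ℕ → ℕ) (L N : ℕ) : Prop where
  tail : ∃ t, L = t + 1 + N ∧ A t = m ∧ ∀ i < N, A (t + 1 + i) = A' i
  uniq : ∀ i, i + N + 1 < L → A i = m → (∀ x < N, m < A (i + 1 + x)) → False

/-- If the prefix of length `L` ends in `v u`, where `v` is a prefix of `A` which is followed
by `m` there, and `u` is a nonempty word of letters larger than `m`, then it ends in `v v u`. -/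
def DoublesPrefix (m : ℕ) (A : ℕ → ℕ) (L : ℕ) : Prop :=
  ∀ d r e, d + r + e = L → 0 < r → 0 < e → A r = m → (∀ i < r, A (d + i) = A i) →
    (∀ i < e, m < A (d + r + i)) → ∃ c, d = c + r ∧ ∀ i < r, A (c + i) = A i

theorem apply_mul_add {A : ℕ → ℕ} {L n : ℕ} (h : ∀ i, i + L < n → A (i + L) = A i) (q x : ℕ)
    (hx : q * L + x < n) : A (q * L + x) = A x := by
  induction q with
  | zero => simp
  | succ q ih =>
    rw [Nat.succ_mul] at hx
    rw [← ih (by omega), Nat.succ_mul, ← h (q * L + x) (by omega)]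
    congr 1
    omega

section

variable {m : ℕ} {A A' : ℕ → ℕ} {L N : ℕ}

theorem IsBlock.dvd (hB : IsBlock m A A' L N) (hA : A 0 = m) {n i : ℕ}
    (h : ∀ i, i + L < n → A (i + L) = A i) (hi : i + N < n) (h0 : A i = m)
    (h1 : ∀ x < N, m < A (i + 1 + x)) : L ∣ i + N + 1 := by
  obtain ⟨t, ht, -, -⟩ := hB.tail
  have hL : 0 < L := by omega
  obtain ⟨q, r, hr, rfl⟩ : ∃ q r, r < L ∧ i = q * L + r :=
    ⟨i / L, i % L, Nat.mod_lt _ hL, (Nat.div_add_mod' i L).symm⟩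
  rcases lt_trichotomy (r + N + 1) L with hlt | heq | hgt
  · refine (hB.uniq r hlt ?_ ?_).elim
    · rw [← h0, apply_mul_add h q r (by omega)]
    · intro x hx
      rw [← apply_mul_add h q (r + 1 + x) (by omega)]
      simpa only [add_assoc] using h1 x hx
  · exact ⟨q + 1, by rw [mul_comm L, Nat.succ_mul]; omega⟩
  · have e := apply_mul_add h (q + 1) 0 (by rw [Nat.succ_mul]; omega)
    have := h1 (L - r - 1) (by omega)
    rw [Nat.succ_mul] at e
    rw [show q * L + r + 1 + (L - r - 1) = q * L + L + 0 by omega, e] at this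
    omega

/-- A power at the end of a block which is at least a square lies in the final run. -/
theorem IsBlock.mul_le_of_endsInPow (hB : IsBlock m A A' L N) (hA' : ∀ i, m < A' i) {k y : ℕ}
    (hk : 2 ≤ k) (h : EndsInPow A L k y) : k * y ≤ N := by
  by_contra! hlt
  obtain ⟨t, ht, htm, htail⟩ := hB.tail
  obtain ⟨h0, h1, h2⟩ := h
  have hky := Nat.mul_le_mul_right y hk
  have hy : N < y := by
    by_contra! hy
    have e := h2 t (by omega) (by omega)
    have := htail (y - 1) (by omega)
    rw [show t + 1 + (y - 1) = t + y by omega] at this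
    have := hA' (y - 1)
    omega
  have e : ∀ x, x ≤ N → A (t - y + x) = A (t + x) := fun x hx => by
    rw [← h2 (t - y + x) (by omega) (by omega)]
    congr 1
    omega
  refine hB.uniq (t - y) (by omega) ?_ ?_
  · simpa [htm] using e 0 (by omega)
  · intro x hx
    rw [add_assoc, e (1 + x) (by omega), ← add_assoc, htail x hx]
    exact hA' x

theorem IsBlock.apply_gt (hB : IsBlock m A A' L N) (hA' : ∀ i, m < A' i) {j : ℕ}
    (h1 : L ≤ j + N) (h2 : j < L) : m < A j := by
  obtain ⟨t, ht, htm, htail⟩ := hB.tail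
  have := htail (j - t - 1) (by omega)
  rw [show t + 1 + (j - t - 1) = j by omega] at this
  rw [this]
  exact hA' _

/-- Extending `m + 1` copies of a block by `s` further terms of `A'` gives a block. -/
theorem IsBlock.extend (hB : IsBlock m A A' L N) (hA : A 0 = m) (hA' : ∀ i, m < A' i)
    (hper : ∀ i, i + L < (m + 1) * L → A (i + L) = A i) {s : ℕ} (hs : 0 < s)
    (hext : ∀ i < s, A ((m + 1) * L + i) = A' (N + i)) :
    IsBlock m A A' ((m + 1) * L + s) (N + s) := by
  obtain ⟨t, ht, htm, htail⟩ := hB.tail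
  have hmul : (m + 1) * L = m * L + L := Nat.succ_mul m L
  have hlast : ∀ i < N, A (m * L + t + 1 + i) = A' i := fun i hi => by
    rw [← htail i hi, ← apply_mul_add hper m (t + 1 + i) (by omega)]
    simp only [add_assoc]
  have htl : ∀ i < N + s, A (m * L + t + 1 + i) = A' i := fun i hi => by
    rcases lt_or_ge i N with h | h
    · exact hlast i h
    · have := hext (i - N) (by omega)
      rw [show N + (i - N) = i by omega] at this
      rw [← this]
      congr 1
      omega
  refine ⟨⟨m * L + t, by omega, ?_, htl⟩, fun i hi h0 h1 => ?_⟩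
  · rw [apply_mul_add hper m t (by omega), htm]
  · rcases lt_or_ge (i + N) ((m + 1) * L) with h | h
    · obtain ⟨q, hq⟩ := hB.dvd hA hper h h0 fun x hx => h1 x (by omega)
      rw [mul_comm] at hq
      rcases lt_or_ge q (m + 1) with hqm | hqm
      · have hlt : q * L + 0 < (m + 1) * L := by
          have := Nat.mul_le_mul_right L (Nat.lt_succ_iff.1 hqm)
          omega
        have e := apply_mul_add hper q 0 hlt
        have := h1 N (by omega)
        rw [show i + 1 + N = q * L + 0 by omega, e] at this
        omega
      · have := Nat.mul_le_mul_right L hqm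
        omega
    · have := htl (i - (m * L + t + 1)) (by omega)
      rw [show m * L + t + 1 + (i - (m * L + t + 1)) = i by omega] at this
      have := hA' (i - (m * L + t + 1))
      omega

end

section

variable {m : ℕ} {A A' : ℕ → ℕ} {L N : ℕ}

/-- If a block `X u v u`, with `u` inside its final run, is followed by `v`, so that a square
`u v u v` overlaps the next copy of the block, then the final run ends in a square. -/
theorem DoublesPrefix.exists_endsInPow (hD : DoublesPrefix 1 A L)
    (hB : IsBlock 1 A A' L N) (hA : A 0 = 1) (hA' : ∀ i, 1 < A' i) {r e : ℕ} (hr : 0 < r)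
    (he : 0 < e) (heN : e ≤ N) (hrm : A r = 1) (hper : ∀ i < r, A (L + i) = A i)
    (hP : EndsInPow A (L + r) 2 (r + e)) : ∃ y, EndsInPow A' N 2 y := by
  obtain ⟨t, ht, htm, htail⟩ := hB.tail
  obtain ⟨-, h1, h2⟩ := hP
  have hv : ∀ i < r, A (L - e - r + i) = A i := fun i hi => by
    rw [← hper i hi, ← h2 (L - e - r + i) (by omega) (by omega)]
    congr 1
    omega
  obtain ⟨c, hc, hcv⟩ := hD (L - e - r) r e (by omega) hr he hrm hv fun i hi =>
    hB.apply_gt hA' (by omega) (by omega)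
  have hu : ∀ i < e, A (L - e - r - e + i) = A (L - e + i) := fun i hi => by
    rw [← h2 (L - e - r - e + i) (by omega) (by omega)]
    congr 1
    omega
  have her : e ≤ r := by
    by_contra! hlt
    have e1 := hcv 0 hr
    have e2 := hu (c + e - (L - e - r)) (by omega)
    rw [show L - e - r - e + (c + e - (L - e - r)) = c + 0 by omega, e1, hA] at e2
    have := hB.apply_gt hA' (j := L - e + (c + e - (L - e - r))) (by omega) (by omega)
    omega
  have huu : ∀ i < e, A (L - e - e + i) = A (L - e + i) := fun i hi => by
    rw [← hu i hi, show L - e - e + i = L - e - r + (r - e + i) by omega, hv _ (by omega),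
      ← hcv _ (by omega)]
    congr 1
    omega
  have ht2 : t + 2 * e < L := by
    by_contra! hlt
    rcases lt_or_ge t (L - e) with hte | hte
    · have e1 := huu (t - (L - e - e)) (by omega)
      rw [show L - e - e + (t - (L - e - e)) = t by omega] at e1
      have := hB.apply_gt hA' (j := L - e + (t - (L - e - e))) (by omega) (by omega)
      omega
    · omega
  refine ⟨e, (endsInPow_shift htail (by omega)).1 ⟨he, by omega, fun i h3 h4 => ?_⟩⟩
  have := huu (i - (L - e - e)) (by omega)
  rw [show L - e - e + (i - (L - e - e)) = i by omega,
    show L - e + (i - (L - e - e)) = i + e by omega] at this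
  exact this.symm

/-- A power with exponent larger than `m` at the end of a partial repetition of a block either
lies in the last partial copy of the block, or forces the next term of that copy to be as
large. -/
theorem IsBlock.le_apply_of_endsInPow (hm : 1 ≤ m) (hA : IsLevel m A) (hA' : ∀ i, m < A' i)
    (hB : IsBlock m A A' L N) (hD : m = 1 → DoublesPrefix m A L)
    (hT : ∀ k y, m < k → ¬ EndsInPow A' N k y) {j r k y : ℕ} (hj : 1 ≤ j) (hjm : j ≤ m)
    (hr : r < L) (hper : ∀ i, i + L < j * L + r → A (i + L) = A i) (hk : m < k)
    (hP : EndsInPow A (j * L + r) k y) : k ≤ A r := by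
  have hA0 := hA.zero
  have hv : ∀ i < r, A (j * L + i) = A i := fun i hi => apply_mul_add hper j i (by omega)
  rcases le_or_gt (k * y) r with hkr | hkr
  · exact ((hA r).2 k hk).2 ⟨y, (endsInPow_shift hv hkr).1 hP⟩
  have hjL : (j - 1) * L + L = j * L := by
    rw [← Nat.succ_mul]
    congr 1
    omega
  obtain ⟨t, ht, htm, htail⟩ := hB.tail
  have htl : ∀ x ≤ N, A ((j - 1) * L + t + x) = A (t + x) := fun x hx => by
    rw [add_assoc]
    exact apply_mul_add hper (j - 1) (t + x) (by omega)
  have hrun : ∀ i, j * L ≤ i + N → i < j * L → m < A i := fun i h1 h2 => by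
    have e := htl (i - ((j - 1) * L + t)) (by omega)
    rw [show (j - 1) * L + t + (i - ((j - 1) * L + t)) = i by omega] at e
    rw [e]
    exact hB.apply_gt hA' (by omega) (by omega)
  obtain ⟨h0, h1, h2⟩ := hP
  obtain ⟨k, rfl⟩ : ∃ k', k = k' + 1 := ⟨k - 1, by omega⟩
  have hmk : m * y ≤ k * y := Nat.mul_le_mul_right y (by omega)
  have hmy : y ≤ m * y := Nat.le_mul_of_pos_left y hm
  have hky : (k + 1) * y = k * y + y := Nat.succ_mul k y
  rcases le_or_gt ((k + 1) * y) (r + N) with hkN | hkN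
  · rcases Nat.eq_zero_or_pos r with rfl | hr0
    · refine (hT (k + 1) y hk ((endsInPow_shift (a := A) (t := j * L - N) (fun i hi => ?_)
        (by omega)).1 ?_)).elim
      · have e := htl (1 + i) (by omega)
        rw [← add_assoc t, htail i hi] at e
        rw [← e]
        congr 1
        omega
      · rw [show j * L - N + N = j * L + 0 by omega]
        exact ⟨h0, h1, h2⟩
    have hwy : (k + 1) * y - r < y := by
      by_contra! hlt
      have e := h2 (j * L - y) (by omega) (by omega)
      rw [show j * L - y + y = j * L + 0 by omega, hv 0 hr0] at e
      have := hrun (j * L - y) (by omega) (by omega)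
      omega
    have hpr : ∀ i, i + y < r → A (i + y) = A i := fun i hi => by
      rw [← hv _ hi, ← hv i (by omega), ← add_assoc]
      exact h2 _ (by omega) (by omega)
    by_cases hkm : m < k
    · have e : A (k * y + 0) = A 0 := apply_mul_add (n := r) hpr k 0 (by omega)
      have := ((hA (k * y)).2 k hkm).2 ⟨y, .of_period h0 fun i hi => hpr i (by omega)⟩
      rw [add_zero] at e
      omega
    · have hz : m < A (r - k * y) := by
        rw [← hv _ (by omega)]
        have e := h2 (j * L + r - (k + 1) * y) (by omega) (by omega)
        rw [show j * L + r - (k + 1) * y + y = j * L + (r - k * y) by omega] at e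
        rw [e]
        exact hrun _ (by omega) (by omega)
      obtain ⟨z, hz'⟩ := ((hA (r - k * y)).2 (k + 1) hk).1 (by omega)
      refine ((hA r).2 (k + 1) hk).2 ⟨z, ?_⟩
      have := (endsInPow_shift (a := A) (t := k * y) (fun i hi =>
        apply_mul_add (n := r) hpr k i (by omega)) hz'.2.1).2 hz'
      rwa [show k * y + (r - k * y) = r by omega] at this
  · have hNy : N < y := by
      by_contra! hlt
      have e := h2 ((j - 1) * L + t) (by omega) (by omega)
      have e' := htl 0 (by omega)
      simp only [add_zero] at e'
      have := hrun ((j - 1) * L + t + y) (by omega) (by omega)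
      omega
    have hlen : ¬ L ≤ y := fun hle => by
      have a1 : m * L ≤ m * y := Nat.mul_le_mul_left m hle
      have a2 : j * L ≤ m * L := Nat.mul_le_mul_right L hjm
      omega
    have hndvd : ∀ i, i + N < j * L + r → (i = (j - 1) * L + t + y ∨ i + y = (j - 1) * L + t) →
        (∀ x ≤ N, A (i + x) = A ((j - 1) * L + t + x)) → False := fun i hi hor hx => by
      have hd : L ∣ i + N + 1 := by
        refine hB.dvd hA0 hper hi ?_ fun x hxN => ?_
        · have := hx 0 (by omega)
          rw [htl 0 (by omega)] at this
          simpa [htm] using this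
        · rw [add_assoc, hx _ (by omega)]
          exact hrun _ (by omega) (by omega)
      have hd' : L ∣ (j - 1) * L + t + N + 1 := ⟨j, by rw [mul_comm L]; omega⟩
      refine hlen (Nat.le_of_dvd h0 ?_)
      rcases hor with rfl | hor
      · have := Nat.dvd_sub hd hd'
        rwa [show (j - 1) * L + t + y + N + 1 - ((j - 1) * L + t + N + 1) = y by omega] at this
      · have := Nat.dvd_sub hd' hd
        rwa [show (j - 1) * L + t + N + 1 - (i + N + 1) = y by omega] at this
    rcases lt_or_ge ((j - 1) * L + t + N + y) (j * L + r) with hR | hR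
    · refine (hndvd ((j - 1) * L + t + y) (by omega) (Or.inl rfl) fun x hx => ?_).elim
      rw [← h2 ((j - 1) * L + t + x) (by omega) (by omega)]
      congr 1
      omega
    rcases le_or_gt (j * L + r) ((j - 1) * L + t + k * y) with hLs | hLs
    · refine (hndvd ((j - 1) * L + t - y) (by omega) (Or.inr (by omega)) fun x hx => ?_).elim
      rw [← h2 ((j - 1) * L + t - y + x) (by omega) (by omega)]
      congr 1
      omega
    have hk1 : k = 1 := by
      by_contra hne
      have := Nat.mul_le_mul_right y (show 2 ≤ k by omega)
      omega
    subst hk1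
    obtain rfl : m = 1 := by omega
    obtain rfl : j = 1 := by omega
    by_contra hlt
    have hAr := (hA r).1
    obtain ⟨e, rfl⟩ : ∃ e, y = r + e := ⟨y - r, by omega⟩
    rw [one_mul] at *
    obtain ⟨z, hz⟩ := (hD rfl).exists_endsInPow hB hA0 hA' (r := r) (e := e)
      (by
        rcases Nat.eq_zero_or_pos r with rfl | hr0
        · omega
        · exact hr0)
      (by omega) (by omega) (by omega) hv ⟨h0, h1, h2⟩
    exact hT _ _ hk hz

/-- A block whose final run has no large power at its end is repeated `m + 1` times. -/
theorem IsBlock.periodic (hm : 1 ≤ m) (hA : IsLevel m A) (hA' : ∀ i, m < A' i)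
    (hB : IsBlock m A A' L N) (hD : m = 1 → DoublesPrefix m A L)
    (hT : ∀ k y, m < k → ¬ EndsInPow A' N k y) (n : ℕ) :
    n + L < (m + 1) * L → A (n + L) = A n := by
  induction n using Nat.strong_induction_on with
  | _ n ih =>
  intro hn
  have hL : 0 < L := by
    obtain ⟨t, ht, -⟩ := hB.tail
    omega
  obtain ⟨q, r, hr, rfl⟩ : ∃ q r, r < L ∧ n = q * L + r :=
    ⟨n / L, n % L, Nat.mod_lt _ hL, (Nat.div_add_mod' n L).symm⟩
  have hqL : (q + 1) * L = q * L + L := Nat.succ_mul q L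
  have hper : ∀ i, i + L < (q + 1) * L + r → A (i + L) = A i := fun i hi =>
    ih i (by omega) (by omega)
  have hqm : q + 1 ≤ m := by
    by_contra! hlt
    have := Nat.mul_le_mul_right L (show m + 1 ≤ q + 1 by omega)
    omega
  rw [show q * L + r + L = (q + 1) * L + r by omega, apply_mul_add hper q r (by omega)]
  refine eq_of_forall_gt_le_iff (hA _).1 (hA _).1 fun k hk => ⟨fun h => ?_, fun h => ?_⟩
  · obtain ⟨y, hy⟩ := ((hA _).2 k hk).1 h
    exact hB.le_apply_of_endsInPow hm hA hA' hD hT (by omega) hqm hr hper hk hy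
  · obtain ⟨y, hy⟩ := ((hA _).2 k hk).1 h
    exact ((hA _).2 k hk).2 ⟨y, (endsInPow_shift (fun i hi =>
      apply_mul_add hper (q + 1) i (by omega)) hy.2.1).2 hy⟩

theorem IsBlock.doublesPrefix_extend (hB : IsBlock 1 A A' L N) (hD : DoublesPrefix 1 A L)
    (hA : A 0 = 1) (hA' : ∀ i, 1 < A' i) (hper : ∀ i, i + L < 2 * L → A (i + L) = A i) {s : ℕ}
    (hext : ∀ i < s, A (2 * L + i) = A' (N + i)) :
    DoublesPrefix 1 A (2 * L + s) := by
  intro d r e hsum hr he hAr hv hu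
  obtain ⟨t, ht, htm, htail⟩ := hB.tail
  have hAL : ∀ i < L, A (L + i) = A i := fun i hi => by
    rw [add_comm]
    exact hper i (by omega)
  have hrun : ∀ i, L ≤ i + N → i < L → 1 < A i := fun i h1 h2 => hB.apply_gt hA' h1 h2
  have hrun2 : ∀ i, 2 * L ≤ i + N → i < 2 * L → 1 < A i := fun i h1 h2 => by
    have := hAL (i - L) (by omega)
    rw [show L + (i - L) = i by omega] at this
    rw [this]
    exact hrun _ (by omega) (by omega)
  have hS : ∀ i, 2 * L ≤ i → i < 2 * L + s → 1 < A i := fun i h1 h2 => by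
    have := hext (i - 2 * L) (by omega)
    rw [show 2 * L + (i - 2 * L) = i by omega] at this
    rw [this]
    exact hA' _
  have hd0 : d ≠ 0 := by
    rintro rfl
    have := hu 0 he
    simp only [zero_add, add_zero] at this
    omega
  have hAd : A d = 1 := by
    have := hv 0 hr
    simpa [hA] using this
  have hdt : d ≤ L + t := by
    by_contra! hlt
    rcases lt_or_ge d (2 * L) with h | h
    · have := hrun2 d (by omega) h
      omega
    · have := hS d h (by omega)
      omega
  have hAt : A (L + t) = 1 := by rw [hAL t (by omega), htm]
  have hrd : L + t < d + r := by
    by_contra! hlt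
    have := hu (L + t - (d + r)) (by omega)
    rw [show d + r + (L + t - (d + r)) = L + t by omega] at this
    omega
  rcases le_or_gt e s with hes | hes
  · have ev : ∀ x, L + t + x < d + r → A (L + t - d + x) = A (L + t + x) := fun x hx => by
      rw [← hv (L + t - d + x) (by omega)]
      congr 1
      omega
    have hocc0 : A (L + t - d) = 1 := by
      have := ev 0 (by omega)
      simpa [hAt] using this
    rcases hes.eq_or_lt with rfl | hlt
    · have hdvd : L ∣ L + t - d + N + 1 := by
        refine hB.dvd (n := 2 * L) hA hper (by omega) hocc0 fun x hx => ?_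
        rw [add_assoc, ev _ (by omega)]
        exact hrun2 _ (by omega) (by omega)
      obtain ⟨c, hc⟩ := hdvd
      have hrc : r = L * c := by omega
      have hc1 : c = 1 := by
        have hc0 : c ≠ 0 := by
          rintro rfl
          omega
        by_contra hne
        have := Nat.mul_le_mul_left L (show 2 ≤ c by omega)
        omega
      subst hc1
      exact ⟨0, by omega, fun i _ => by rw [zero_add]⟩
    · have hE := hB.extend (m := 1) (s := s - e) hA hA' hper (by omega)
        (fun i hi => hext i (by omega))
      refine (hE.uniq (L + t - d) (by omega) hocc0 fun x hx => ?_).elim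
      rw [add_assoc, ev _ (by omega)]
      rcases lt_or_ge (L + t + (1 + x)) (2 * L) with h | h
      · exact hrun2 _ (by omega) h
      · exact hS _ h (by omega)
  · rcases le_or_gt L r with hLr | hLr
    · obtain ⟨c, hc⟩ : L ∣ d + t + N + 1 := by
        refine hB.dvd (n := 2 * L) hA hper (by omega) (by rw [hv t (by omega), htm])
          fun x hx => ?_
        rw [show d + t + 1 + x = d + (t + 1 + x) by omega, hv _ (by omega)]
        exact hrun _ (by omega) (by omega)
      have h1 : 1 < c := by
        by_contra! h
        have := Nat.mul_le_mul_left L h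
        omega
      have := Nat.mul_le_mul_left L h1
      omega
    rcases lt_trichotomy d L with hdL | rfl | hdL
    · have hdt' : d ≤ t := by
        by_contra! hlt
        have := hrun d (by omega) hdL
        omega
      have ev : ∀ x ≤ N, A (t - d + x) = A (t + x) := fun x hx => by
        rw [← hv (t - d + x) (by omega)]
        congr 1
        omega
      refine (hB.uniq (t - d) (by omega) ?_ fun x hx => ?_).elim
      · simpa [htm] using ev 0 (by omega)
      · rw [add_assoc, ev _ (by omega)]
        exact hrun _ (by omega) (by omega)
    · have := hu 0 he
      rw [add_zero, hAL r hLr] at this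
      omega
    · obtain ⟨c, hc, hcv⟩ := hD (d - L) r (e - s) (by omega) hr (by omega) hAr
        (fun i hi => by
          rw [← hv i hi, ← hAL _ (by omega)]
          congr 1
          omega)
        (fun i hi => by
          rw [← hAL _ (by omega)]
          have := hu i (by omega)
          rwa [show L + (d - L + r + i) = d + r + i by omega])
      refine ⟨L + c, by omega, fun i hi => ?_⟩
      rw [add_assoc, hAL _ (by omega), hcv i hi]

end

section

variable {m : ℕ} {A A' : ℕ → ℕ}

/-- The stages of the construction of `A'` from `A`: the sequence `A` begins with `m + 1` copies
of a block followed by `s` further terms of `A'`. -/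
theorem exists_block (hm : 1 ≤ m) (hA : IsLevel m A) (hA' : IsLevel (m + 1) A') (M : ℕ) :
    ∃ L N s, M = N + s ∧ IsBlock m A A' L N ∧ (m = 1 → DoublesPrefix m A L) ∧
      (∀ i, i + L < (m + 1) * L → A (i + L) = A i) ∧
      ∀ i < s, A ((m + 1) * L + i) = A' (N + i) := by
  have hlt : ∀ i, m < A' i := fun i => (hA' i).1
  induction M with
  | zero =>
    have hB : IsBlock m A A' 1 0 := ⟨⟨0, rfl, hA.zero, by simp⟩, fun i hi => by omega⟩
    have hD : m = 1 → DoublesPrefix m A 1 := fun _ d r e h hr he => by omega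
    refine ⟨1, 0, 0, rfl, hB, hD, hB.periodic hm hA hlt hD fun k y hk h => ?_, by simp⟩
    have := h.le
    omega
  | succ M ih =>
    -- a block without an extension is followed by the next term of `A'`
    have key : ∀ L, IsBlock m A A' L M → (∀ i, i + L < (m + 1) * L → A (i + L) = A i) →
        A ((m + 1) * L) = A' M := by
      intro L hB hper
      obtain ⟨t, ht, htm, htail⟩ := hB.tail
      have hmul : (m + 1) * L = m * L + L := Nat.succ_mul m L
      have htl : ∀ x ≤ M, A (m * L + t + x) = A (t + x) := fun x hx => by
        rw [add_assoc]
        exact apply_mul_add hper m (t + x) (by omega)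
      have hsuf : ∀ i < M, A (m * L + t + 1 + i) = A' i := fun i hi => by
        rw [add_assoc _ 1, htl _ (by omega), ← add_assoc, htail i hi]
      have hn : m * L + t + 1 + M = (m + 1) * L := by omega
      have hge : m + 1 ≤ A ((m + 1) * L) :=
        ((hA _).2 (m + 1) (by omega)).2 ⟨L, .of_period (by omega) hper⟩
      refine eq_of_forall_gt_le_iff hge (hA' M).1 fun k hk => ?_
      rw [(hA _).2 k (by omega), (hA' _).2 k hk, ← hn]
      refine exists_congr fun y => ?_
      rcases le_or_gt (k * y) M with h | h
      · exact endsInPow_shift hsuf h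
      refine iff_of_false (fun hP => ?_) fun hP => by have := hP.2.1; omega
      obtain ⟨h0, h1, h2⟩ := hP
      have hky := Nat.mul_le_mul_right y (show m + 2 ≤ k by omega)
      have hky2 := Nat.mul_le_mul_right y (show 2 ≤ k by omega)
      have hy : M < y := by
        by_contra! hy
        have e := h2 (m * L + t) (by omega) (by omega)
        have e' := htl 0 (by omega)
        have := hsuf (y - 1) (by omega)
        rw [show m * L + t + 1 + (y - 1) = m * L + t + y by omega] at this
        have := hlt (y - 1)
        simp only [add_zero] at e'
        omega
      have ev : ∀ x ≤ M, A (m * L + t - y + x) = A (m * L + t + x) := fun x hx => by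
        rw [← h2 (m * L + t - y + x) (by omega) (by omega)]
        congr 1
        omega
      have hd : L ∣ m * L + t - y + M + 1 := by
        refine hB.dvd hA.zero hper (by omega) ?_ fun x hx => ?_
        · have := ev 0 (by omega)
          rw [htl 0 (by omega)] at this
          simpa [htm] using this
        · rw [add_assoc, ev _ (by omega), ← add_assoc, hsuf x hx]
          exact hlt x
      have hd' : L ∣ (m + 1) * L := Nat.dvd_mul_left _ _
      have hdy := Nat.dvd_sub hd' hd
      rw [show (m + 1) * L - (m * L + t - y + M + 1) = y by omega] at hdy
      have := Nat.mul_le_mul_left (m + 2) (Nat.le_of_dvd h0 hdy)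
      have : (m + 2) * L = (m + 1) * L + L := Nat.succ_mul (m + 1) L
      omega
    obtain ⟨L, N, s, rfl, hB, hD, hper, hext⟩ := ih
    rcases Nat.eq_zero_or_pos s with rfl | hs
    · refine ⟨L, N, 1, rfl, hB, hD, hper, fun i hi => ?_⟩
      obtain rfl : i = 0 := by omega
      exact key L hB hper
    · have hE := hB.extend hA.zero hlt hper hs hext
      obtain ⟨t, ht, -, htail⟩ := hE.tail
      have hrep : ∀ k y, m < k → (EndsInPow A ((m + 1) * L + s) k y ↔
          EndsInPow A' (N + s) k y) := fun k y hk => by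
        have hiff := fun h => endsInPow_shift (k := k) (y := y) htail h
        rw [← ht] at hiff
        exact ⟨fun h => (hiff (hE.mul_le_of_endsInPow hlt (by omega) h)).1 h,
          fun h => (hiff h.2.1).2 h⟩
      have hle : ∀ k, m + 1 < k → (k ≤ A ((m + 1) * L + s) ↔ k ≤ A' (N + s)) := fun k hk => by
        rw [(hA _).2 k (by omega), (hA' _).2 k hk]
        exact exists_congr fun y => hrep k y (by omega)
      rcases (hA ((m + 1) * L + s)).1.lt_or_eq with hgt | heq
      · refine ⟨L, N, s + 1, rfl, hB, hD, hper, fun i hi => ?_⟩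
        rcases Nat.lt_succ_iff_lt_or_eq.1 hi with h | rfl
        · exact hext i h
        · exact eq_of_forall_gt_le_iff hgt (hA' _).1 hle
      · have hDE : m = 1 → DoublesPrefix m A ((m + 1) * L + s) := by
          rintro rfl
          exact hB.doublesPrefix_extend (hD rfl) hA.zero hlt hper hext
        have hperE := hE.periodic hm hA hlt hDE fun k y hk h => by
          have := ((hA _).2 k hk).2 ⟨y, (hrep k y hk).2 h⟩
          omega
        refine ⟨(m + 1) * L + s, N + s, 1, rfl, hE, hDE, hperE, fun i hi => ?_⟩
        obtain rfl : i = 0 := by omega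
        exact key _ hE hperE

/-- Every term of the next level sequence is a term of the given one. -/
theorem exists_apply_eq (hm : 1 ≤ m) (hA : IsLevel m A) (hA' : IsLevel (m + 1) A') (i : ℕ) :
    ∃ n, A n = A' i := by
  obtain ⟨L, N, s, hM, hB, -, -, hext⟩ := exists_block hm hA hA' (i + 1)
  rcases lt_or_ge i N with h | h
  · obtain ⟨t, -, -, htail⟩ := hB.tail
    exact ⟨_, htail i h⟩
  · have := hext (i - N) (by omega)
    rw [show N + (i - N) = i by omega] at this
    exact ⟨_, this⟩

end

theorem IsLevel.exists_apply_eq_of_le {m : ℕ} (hm : 1 ≤ m) {A : ℕ → ℕ} (hA : IsLevel 1 A) :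
    ∀ i, ∃ n, A n = level m i := by
  induction m, hm using Nat.le_induction with
  | base =>
    intro i
    refine ⟨i, ?_⟩
    induction i using Nat.strong_induction_on with
    | _ i ih =>
    refine eq_of_forall_gt_le_iff (hA i).1 (isLevel_level 1 i).1 fun k hk => ?_
    rw [(hA i).2 k hk, (isLevel_level 1 i).2 k hk]
    exact exists_congr fun y =>
      ⟨fun h => h.congr fun j hj => ih j hj, fun h => h.congr fun j hj => (ih j hj).symm⟩
  | succ m hm ih =>
    intro i
    obtain ⟨j, hj⟩ := exists_apply_eq hm (isLevel_level m) (isLevel_level (m + 1)) i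
    obtain ⟨n, hn⟩ := ih j
    exact ⟨n, hn.trans hj⟩

theorem length_flatten_replicate (k : ℕ) (Y : List ℕ) :
    (List.replicate k Y).flatten.length = k * Y.length := by
  simp

theorem getElem?_flatten_replicate_add (k : ℕ) (Y : List ℕ) {i : ℕ}
    (hi : i + Y.length < k * Y.length) :
    (List.replicate k Y).flatten[i + Y.length]? = (List.replicate k Y).flatten[i]? := by
  obtain ⟨k, rfl⟩ : ∃ k', k = k' + 1 :=
    Nat.exists_eq_succ_of_ne_zero (by rintro rfl; simp at hi)
  rw [Nat.succ_mul] at hi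
  conv_lhs => rw [List.replicate_succ, List.flatten_cons,
    List.getElem?_append_right (by omega), Nat.add_sub_cancel]
  rw [List.replicate_succ', List.flatten_append,
    List.getElem?_append_left (by rw [length_flatten_replicate]; omega)]

theorem eq_flatten_replicate {w : List ℕ} {k y : ℕ} (hw : w.length = k * y)
    (h : ∀ i, i + y < k * y → w[i + y]? = w[i]?) :
    w = (List.replicate k (w.take y)).flatten := by
  induction k generalizing w with
  | zero => simpa using hw
  | succ k ih =>
    have hky : (k + 1) * y = k * y + y := Nat.succ_mul k y
    rw [List.replicate_succ, List.flatten_cons]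
    rcases Nat.eq_zero_or_pos k with rfl | hk
    · rw [List.take_of_length_le (by omega)]
      simp
    have hyk : y ≤ k * y := Nat.le_mul_of_pos_left y hk
    have ht : (w.drop y).take y = w.take y := by
      refine List.ext_getElem? fun i => ?_
      simp only [List.getElem?_take, List.getElem?_drop]
      split_ifs with hi
      · rw [add_comm, h i (by omega)]
      · rfl
    have := ih (w := w.drop y) (by rw [List.length_drop]; omega) fun i hi => by
      rw [List.getElem?_drop, List.getElem?_drop, ← add_assoc, h _ (by omega), add_comm]
    rw [ht] at this
    rw [← this, List.take_append_drop]

theorem getElem?_gword (b : ℕ → ℕ) {n i : ℕ} (hi : i < n) :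
    (gword b n)[i]? = some (b (i + 1)) := by
  simp [gword, hi]

theorem length_gword (b : ℕ → ℕ) (n : ℕ) : (gword b n).length = n := by
  simp [gword]

theorem exists_endsInPow_iff (b : ℕ → ℕ) (n k : ℕ) :
    (∃ y, EndsInPow (fun i => b (i + 1)) n k y) ↔
      ∃ X Y : List ℕ, Y ≠ [] ∧ gword b n = X ++ (List.replicate k Y).flatten := by
  constructor
  · rintro ⟨y, h0, h1, h2⟩
    have hw : ((gword b n).drop (n - k * y)).length = k * y := by
      rw [List.length_drop, length_gword]
      omega
    rcases Nat.eq_zero_or_pos k with rfl | hk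
    · exact ⟨gword b n, [0], by simp, by simp⟩
    have hyk : y ≤ k * y := Nat.le_mul_of_pos_left y hk
    refine ⟨(gword b n).take (n - k * y), ((gword b n).drop (n - k * y)).take y, ?_, ?_⟩
    · rw [← List.length_pos_iff, List.length_take]
      omega
    · rw [← eq_flatten_replicate hw, List.take_append_drop]
      intro i hi
      rw [List.getElem?_drop, List.getElem?_drop, getElem?_gword b (by omega),
        getElem?_gword b (by omega), ← add_assoc]
      exact congrArg some (h2 _ (by omega) (by omega))
  · rintro ⟨X, Y, hY, h⟩
    have hlen := congrArg List.length h
    rw [length_gword, List.length_append, length_flatten_replicate] at hlen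
    refine ⟨Y.length, List.length_pos_iff.2 hY, by omega, fun i h1 h2 => ?_⟩
    have e := getElem?_flatten_replicate_add k Y (i := i - X.length) (by omega)
    have e1 := getElem?_gword b h2
    have e2 := getElem?_gword b (show i < n by omega)
    rw [h, List.getElem?_append_right (by omega)] at e1 e2
    rw [show i + Y.length - X.length = i - X.length + Y.length by omega, e, e2] at e1
    exact (Option.some.inj e1).symm

end Gijswijt

open Gijswijt

theorem gijswijt_unbounded (b : ℕ → ℕ) (hb : IsGijswijt b) :
    (∀ m : ℕ, 1 ≤ m → ∃ n : ℕ, 1 ≤ n ∧ b n = m) ∧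
      ¬ ∃ M : ℕ, ∀ n : ℕ, 1 ≤ n → b n ≤ M := by
  have hlevel : IsLevel 1 fun i => b (i + 1) := by
    intro n
    rcases Nat.eq_zero_or_pos n with rfl | hn
    · refine ⟨hb.1.ge, fun k hk => iff_of_false (by simpa [hb.1] using hk) ?_⟩
      rintro ⟨y, hy⟩
      have := hy.le
      omega
    · obtain ⟨hmem, hub⟩ := hb.2 n hn
      have hle : ∀ k, (∃ y, EndsInPow (fun i => b (i + 1)) n k y) → k ≤ b (n + 1) :=
        fun k h => hub ((exists_endsInPow_iff b n k).1 h)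
      refine ⟨hle 1 ⟨1, one_pos, by omega, fun i h1 h2 => by omega⟩, fun k _ => ⟨fun h => ?_,
        hle k⟩⟩
      exact exists_endsInPow_mono ((exists_endsInPow_iff b n _).2 hmem) h
  have hmain : ∀ m : ℕ, 1 ≤ m → ∃ n : ℕ, 1 ≤ n ∧ b n = m := fun m hm => by
    obtain ⟨n, hn⟩ := hlevel.exists_apply_eq_of_le hm 0
    exact ⟨n + 1, by omega, hn.trans (isLevel_level m).zero⟩
  refine ⟨hmain, ?_⟩
  rintro ⟨M, hM⟩
  obtain ⟨n, hn, h⟩ := hmain (M + 1) (by omega)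
  have := hM n hn
  omega
end

section
/- The kissing number in dimension 3 is 12: for every finite set S of points in Euclidean 3-space ℝ³ such that every point of S has norm 2 and any two distinct points of S are at distance at least 2 from each other, the cardinality of S is at most 12; moreover, there exists such a set S with exactly 12 points. -/
open Finset RealInnerProductSpace

/-- The real part of `z ^ n` as a polynomial in `c = re z` and `d = |z|²`. -/
def rePow : ℕ → ℝ → ℝ → ℝ
  | 0, _, _ => 1
  | 1, c, _ => c
  | n + 2, c, d => 2 * c * rePow (n + 1) c d - d * rePow n c d

lemma re_pow_eq_rePow (z : ℂ) (n : ℕ) : (z ^ n).re = rePow n z.re (Complex.normSq z) := by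
  induction n using Nat.twoStepInduction with
  | zero => simp [rePow]
  | one => simp [rePow]
  | more n h₀ h₁ =>
    rw [rePow, ← h₀, ← h₁, pow_succ, pow_succ]
    simp only [Complex.mul_re, Complex.mul_im, Complex.normSq_apply]
    ring

lemma sum_rePow_nonneg {ι : Type*} (S : Finset ι) (φ : ι → ℝ) (z : ι → ℂ) (n : ℕ) :
    0 ≤ ∑ i ∈ S, ∑ j ∈ S, φ i * φ j * rePow n ((z i).re * (z j).re + (z i).im * (z j).im)
      (Complex.normSq (z i) * Complex.normSq (z j)) := by
  have h : ∑ i ∈ S, ∑ j ∈ S, φ i * φ j * rePow n ((z i).re * (z j).re + (z i).im * (z j).im)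
      (Complex.normSq (z i) * Complex.normSq (z j))
      = Complex.normSq (∑ i ∈ S, φ i * z i ^ n) := by
    rw [← Complex.ofReal_re (Complex.normSq _), ← Complex.mul_conj, map_sum, sum_mul_sum,
      Complex.re_sum]
    refine sum_congr rfl fun i _ => ?_
    rw [Complex.re_sum]
    refine sum_congr rfl fun j _ => ?_
    have hz : (φ i * z i ^ n) * (starRingEnd ℂ) (φ j * z j ^ n)
        = ((φ i * φ j : ℝ) : ℂ) * (z i * (starRingEnd ℂ) (z j)) ^ n := by
      simp only [map_mul, map_pow, Complex.conj_ofReal]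
      push_cast
      ring
    rw [hz, Complex.re_ofReal_mul, re_pow_eq_rePow]
    simp [Complex.normSq_mul]
  rw [h]
  exact Complex.normSq_nonneg _

/-- A zonal function with an addition formula with nonnegative coefficients is positive
definite on the sphere. -/
lemma sum_zonal_nonneg {N : ℕ} {P : ℝ → ℝ} (κ : Fin N → ℝ) (q : Fin N → ℝ → ℝ)
    (hκ : ∀ m, 0 ≤ κ m)
    (hP : ∀ s t c, P (s * t + c) =
      ∑ m, κ m * (q m s * q m t * rePow m c ((1 - s ^ 2) * (1 - t ^ 2))))
    (S : Finset (EuclideanSpace ℝ (Fin 3))) (hS : ∀ x ∈ S, ‖x‖ = 1) :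
    0 ≤ ∑ x ∈ S, ∑ y ∈ S, P ⟪x, y⟫ := by
  let z : EuclideanSpace ℝ (Fin 3) → ℂ := fun x => ⟨x 0, x 1⟩
  have hz : ∀ x ∈ S, Complex.normSq (z x) = 1 - x 2 ^ 2 := fun x hx => by
    have h := EuclideanSpace.real_norm_sq_eq x
    rw [hS x hx, Fin.sum_univ_three] at h
    simp only [z, Complex.normSq_apply]
    linarith
  have h : ∀ x ∈ S, ∀ y ∈ S, P ⟪x, y⟫ = ∑ m, κ m * (q m (x 2) * q m (y 2) *
      rePow m ((z x).re * (z y).re + (z x).im * (z y).im)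
        (Complex.normSq (z x) * Complex.normSq (z y))) := fun x hx y hy => by
    rw [hz x hx, hz y hy, ← hP]
    simp only [PiLp.inner_apply, Fin.sum_univ_three, RCLike.inner_apply, conj_trivial, z]
    ring_nf
  rw [sum_congr rfl fun x hx => sum_congr rfl (h x hx)]
  simp_rw [sum_comm (s := S) (t := univ), ← mul_sum]
  exact sum_nonneg fun m _ => mul_nonneg (hκ m) (sum_rePow_nonneg S (fun x => q m (x 2)) z m)

noncomputable def legendreTwo (t : ℝ) : ℝ :=
  (3 * t ^ 2 - 1) / 2

noncomputable def legendreThree (t : ℝ) : ℝ :=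
  (5 * t ^ 3 - 3 * t) / 2

noncomputable def legendreFour (t : ℝ) : ℝ :=
  (35 * t ^ 4 - 30 * t ^ 2 + 3) / 8

noncomputable def legendreNine (t : ℝ) : ℝ :=
  (12155 * t ^ 9 - 25740 * t ^ 7 + 18018 * t ^ 5 - 4620 * t ^ 3 + 315 * t) / 128

lemma sum_id_nonneg (S : Finset (EuclideanSpace ℝ (Fin 3))) (hS : ∀ x ∈ S, ‖x‖ = 1) :
    0 ≤ ∑ x ∈ S, ∑ y ∈ S, ⟪x, y⟫ := by
  refine sum_zonal_nonneg (P := id)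
    ![1, 1]
    ![fun s => s, fun _ => 1]
    (fun m => by fin_cases m <;> norm_num) (fun s t c => ?_) S hS
  simp [Fin.sum_univ_succ, rePow, id]

lemma sum_legendreTwo_nonneg (S : Finset (EuclideanSpace ℝ (Fin 3))) (hS : ∀ x ∈ S, ‖x‖ = 1) :
    0 ≤ ∑ x ∈ S, ∑ y ∈ S, legendreTwo ⟪x, y⟫ := by
  refine sum_zonal_nonneg (P := legendreTwo)
    ![1/4, 3, 3/4]
    ![fun s => 3 * s ^ 2 - 1, fun s => s, fun _ => 1]
    (fun m => by fin_cases m <;> norm_num) (fun s t c => ?_) S hS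
  simp [Fin.sum_univ_succ, rePow, legendreTwo]
  ring

lemma sum_legendreThree_nonneg (S : Finset (EuclideanSpace ℝ (Fin 3))) (hS : ∀ x ∈ S, ‖x‖ = 1) :
    0 ≤ ∑ x ∈ S, ∑ y ∈ S, legendreThree ⟪x, y⟫ := by
  refine sum_zonal_nonneg (P := legendreThree)
    ![1/4, 3/8, 15/4, 5/8]
    ![fun s => 5 * s ^ 3 - 3 * s, fun s => 5 * s ^ 2 - 1, fun s => s, fun _ => 1]
    (fun m => by fin_cases m <;> norm_num) (fun s t c => ?_) S hS
  simp [Fin.sum_univ_succ, rePow, legendreThree]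
  ring

lemma sum_legendreFour_nonneg (S : Finset (EuclideanSpace ℝ (Fin 3))) (hS : ∀ x ∈ S, ‖x‖ = 1) :
    0 ≤ ∑ x ∈ S, ∑ y ∈ S, legendreFour ⟪x, y⟫ := by
  refine sum_zonal_nonneg (P := legendreFour)
    ![1/64, 5/8, 5/16, 35/8, 35/64]
    ![fun s => 35 * s ^ 4 - 30 * s ^ 2 + 3, fun s => 7 * s ^ 3 - 3 * s, fun s => 7 * s ^ 2 - 1,
      fun s => s, fun _ => 1]
    (fun m => by fin_cases m <;> norm_num) (fun s t c => ?_) S hS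
  simp [Fin.sum_univ_succ, rePow, legendreFour]
  ring

lemma sum_legendreNine_nonneg (S : Finset (EuclideanSpace ℝ (Fin 3))) (hS : ∀ x ∈ S, ‖x‖ = 1) :
    0 ≤ ∑ x ∈ S, ∑ y ∈ S, legendreNine ⟪x, y⟫ := by
  refine sum_zonal_nonneg (P := legendreNine)
    ![1/16384, 45/16384, 495/2048, 1155/8192, 45045/4096, 1287/8192, 2145/2048, 6435/32768,
      109395/16384, 12155/32768]
    ![fun s => 12155 * s ^ 9 - 25740 * s ^ 7 + 18018 * s ^ 5 - 4620 * s ^ 3 + 315 * s,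
      fun s => 2431 * s ^ 8 - 4004 * s ^ 6 + 2002 * s ^ 4 - 308 * s ^ 2 + 7,
      fun s => 221 * s ^ 7 - 273 * s ^ 5 + 91 * s ^ 3 - 7 * s,
      fun s => 221 * s ^ 6 - 195 * s ^ 4 + 39 * s ^ 2 - 1, fun s => 17 * s ^ 5 - 10 * s ^ 3 + s,
      fun s => 85 * s ^ 4 - 30 * s ^ 2 + 1, fun s => 17 * s ^ 3 - 3 * s, fun s => 17 * s ^ 2 - 1,
      fun s => s, fun _ => 1]
    (fun m => by fin_cases m <;> norm_num) (fun s t c => ?_) S hS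
  simp [Fin.sum_univ_succ, rePow, legendreNine]
  ring

/-- A test polynomial with nonnegative Legendre coefficients, nonpositive on `[-0.7072, 1/2]`. -/
noncomputable def kissingPoly (t : ℝ) : ℝ :=
  1 + 1.771 * t + 3.504 * legendreTwo t + 1.732 * legendreThree t + 1.99 * legendreFour t
    + 0.43 * legendreNine t

lemma kissingPoly_eq (t : ℝ) : kissingPoly t = -23/4000 + 14797/64000 * t - 4413/2000 * t ^ 2
    - 35809/3200 * t ^ 3 + 1393/160 * t ^ 4 + 387387/6400 * t ^ 5 - 55341/640 * t ^ 7
    + 104533/2560 * t ^ 9 := by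
  simp only [kissingPoly, legendreTwo, legendreThree, legendreFour, legendreNine]
  ring

/-- Nonnegativity on `[a, b]` from an expansion in the Bernstein basis. -/
lemma bernstein_basis_nonneg {a b t : ℝ} (ha : a ≤ t) (hb : t ≤ b) (i : ℕ) :
    0 ≤ (t - a) ^ i * (b - t) ^ (9 - i) :=
  mul_nonneg (pow_nonneg (sub_nonneg.2 ha) _) (pow_nonneg (sub_nonneg.2 hb) _)

lemma kissingPoly_nonpos {t : ℝ} (h₁ : -0.7072 ≤ t) (h₂ : t ≤ 0.5) :
    kissingPoly t ≤ 0 := by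
  rw [kissingPoly_eq]
  obtain hb | hb := le_total t (-0.43)
  · have h := bernstein_basis_nonneg h₁ hb
    linarith [h 0, h 1, h 2, h 3, h 4, h 5, h 6, h 7, h 8, h 9]
  replace h₁ := hb
  obtain hb | hb := le_total t (-0.37)
  · have h := bernstein_basis_nonneg h₁ hb
    linarith [h 0, h 1, h 2, h 3, h 4, h 5, h 6, h 7, h 8, h 9]
  replace h₁ := hb
  obtain hb | hb := le_total t (0.03)
  · have h := bernstein_basis_nonneg h₁ hb
    linarith [h 0, h 1, h 2, h 3, h 4, h 5, h 6, h 7, h 8, h 9]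
  replace h₁ := hb
  obtain hb | hb := le_total t (0.17)
  · have h := bernstein_basis_nonneg h₁ hb
    linarith [h 0, h 1, h 2, h 3, h 4, h 5, h 6, h 7, h 8, h 9]
  replace h₁ := hb
  have h := bernstein_basis_nonneg h₁ h₂
  linarith [h 0, h 1, h 2, h 3, h 4, h 5, h 6, h 7, h 8, h 9]

lemma kissingPoly_neg_le {t : ℝ} (h₁ : 0.7072 ≤ t) (h₂ : t ≤ 1) :
    kissingPoly (-t) ≤ 2.572 := by
  rw [kissingPoly_eq]
  obtain hb | hb := le_total t (0.97)
  · have h := bernstein_basis_nonneg h₁ hb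
    linarith [h 0, h 1, h 2, h 3, h 4, h 5, h 6, h 7, h 8, h 9]
  replace h₁ := hb
  have h := bernstein_basis_nonneg h₁ h₂
  linarith [h 0, h 1, h 2, h 3, h 4, h 5, h 6, h 7, h 8, h 9]

lemma kissingPoly_neg_le_quadratic_two {t : ℝ} (h₁ : 0.7072 ≤ t) (h₂ : t ≤ 0.966) :
    kissingPoly (-t) ≤ 5.555 + 18.4 * (t ^ 2 - 1.134 * t) := by
  rw [kissingPoly_eq]
  obtain hb | hb := le_total t (0.91)
  · have h := bernstein_basis_nonneg h₁ hb
    linarith [h 0, h 1, h 2, h 3, h 4, h 5, h 6, h 7, h 8, h 9]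
  replace h₁ := hb
  have h := bernstein_basis_nonneg h₁ h₂
  linarith [h 0, h 1, h 2, h 3, h 4, h 5, h 6, h 7, h 8, h 9]

lemma kissingPoly_neg_le_quadratic_three {t : ℝ} (h₁ : 0.7072 ≤ t) (h₂ : t ≤ 0.966) :
    kissingPoly (-t) ≤ 3.01 + 14.5 * (t ^ 2 - t) := by
  rw [kissingPoly_eq]
  obtain hb | hb := le_total t (0.91)
  · have h := bernstein_basis_nonneg h₁ hb
    linarith [h 0, h 1, h 2, h 3, h 4, h 5, h 6, h 7, h 8, h 9]
  replace h₁ := hb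
  have h := bernstein_basis_nonneg h₁ h₂
  linarith [h 0, h 1, h 2, h 3, h 4, h 5, h 6, h 7, h 8, h 9]

section Geometry

variable {V : Type*} [NormedAddCommGroup V] [InnerProductSpace ℝ V]

/-- A quadratic form in four variables with unit diagonal and off-diagonal coefficients in
`(0, 1/2]` vanishes only at the origin. -/
lemma quadratic_form_four_pos {a b c d g₁ g₂ g₃ g₄ g₅ g₆ : ℝ}
    (h₁ : 0 < g₁) (h₁' : g₁ ≤ 1 / 2) (h₂ : 0 < g₂) (h₂' : g₂ ≤ 1 / 2)
    (h₃ : 0 < g₃) (h₃' : g₃ ≤ 1 / 2) (h₄ : 0 < g₄) (h₄' : g₄ ≤ 1 / 2)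
    (h₅ : 0 < g₅) (h₅' : g₅ ≤ 1 / 2) (h₆ : 0 < g₆) (h₆' : g₆ ≤ 1 / 2)
    (h : a ^ 2 + b ^ 2 + c ^ 2 + d ^ 2 + 2 * (a * b * g₁ + a * c * g₂ + a * d * g₃ + b * c * g₄
      + b * d * g₅ + c * d * g₆) ≤ 0) : a = 0 ∧ b = 0 ∧ c = 0 ∧ d = 0 := by
  have weak : ∀ {x y g : ℝ}, 0 < g → g ≤ 1 / 2 → (x * y - |x| * |y|) / 4 ≤ x * y * g := by
    intro x y g hg hg'
    rw [← abs_mul]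
    rcases abs_cases (x * y) with ⟨e, _⟩ | ⟨e, _⟩ <;> rw [e] <;> nlinarith
  have strict : ∀ {x y g : ℝ}, 0 < g → 0 < x * y → (x * y - |x| * |y|) / 4 < x * y * g := by
    intro x y g hg hxy
    rw [← abs_mul, abs_of_pos hxy]
    nlinarith
  have half : ∀ {x y g : ℝ}, g ≤ 1 / 2 → x * y ≤ 0 → x * y / 2 ≤ x * y * g := by
    intro x y g hg hxy
    nlinarith
  have e : a ^ 2 + b ^ 2 + c ^ 2 + d ^ 2 + 2 * ((a * b - |a| * |b|) / 4 + (a * c - |a| * |c|) / 4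
      + (a * d - |a| * |d|) / 4 + (b * c - |b| * |c|) / 4 + (b * d - |b| * |d|) / 4
      + (c * d - |c| * |d|) / 4) = ((a + b + c + d) ^ 2 + (|a| - |b|) ^ 2 + (|a| - |c|) ^ 2
      + (|a| - |d|) ^ 2 + (|b| - |c|) ^ 2 + (|b| - |d|) ^ 2 + (|c| - |d|) ^ 2) / 4 := by
    linear_combination (-3 / 4) * (sq_abs a + sq_abs b + sq_abs c + sq_abs d)
  have e' : 0 ≤ ((a + b + c + d) ^ 2 + (|a| - |b|) ^ 2 + (|a| - |c|) ^ 2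
      + (|a| - |d|) ^ 2 + (|b| - |c|) ^ 2 + (|b| - |d|) ^ 2 + (|c| - |d|) ^ 2) / 4 := by
    positivity
  have w₁ := weak (x := a) (y := b) h₁ h₁'
  have w₂ := weak (x := a) (y := c) h₂ h₂'
  have w₃ := weak (x := a) (y := d) h₃ h₃'
  have w₄ := weak (x := b) (y := c) h₄ h₄'
  have w₅ := weak (x := b) (y := d) h₅ h₅'
  have w₆ := weak (x := c) (y := d) h₆ h₆'
  have s₁ : a * b ≤ 0 := not_lt.1 fun hp => by linarith [strict h₁ hp]
  have s₂ : a * c ≤ 0 := not_lt.1 fun hp => by linarith [strict h₂ hp]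
  have s₃ : a * d ≤ 0 := not_lt.1 fun hp => by linarith [strict h₃ hp]
  have s₄ : b * c ≤ 0 := not_lt.1 fun hp => by linarith [strict h₄ hp]
  have s₅ : b * d ≤ 0 := not_lt.1 fun hp => by linarith [strict h₅ hp]
  have s₆ : c * d ≤ 0 := not_lt.1 fun hp => by linarith [strict h₆ hp]
  have hsum : a ^ 2 + b ^ 2 + c ^ 2 + d ^ 2 ≤ 0 := by
    linarith [half h₁' s₁, half h₂' s₂, half h₃' s₃, half h₄' s₄, half h₅' s₅, half h₆' s₆,
      sq_nonneg (a + b + c + d)]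
  refine ⟨?_, ?_, ?_, ?_⟩ <;>
  · rw [← sq_eq_zero_iff]
    linarith [sq_nonneg a, sq_nonneg b, sq_nonneg c, sq_nonneg d]

/-- At most three unit vectors of `ℝ³` have all their pairwise inner products in `(0, 1/2]`. -/
lemma card_le_three_of_inner_pos {T : Finset (EuclideanSpace ℝ (Fin 3))}
    (hT : ∀ y ∈ T, ‖y‖ = 1)
    (hpos : ∀ y ∈ T, ∀ z ∈ T, y ≠ z → 0 < ⟪y, z⟫)
    (hle : ∀ y ∈ T, ∀ z ∈ T, y ≠ z → ⟪y, z⟫ ≤ 1 / 2) : #T ≤ 3 := by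
  by_contra! hcard
  obtain ⟨U, hUT, hU⟩ := exists_subset_card_eq (Nat.succ_le_of_lt hcard)
  let y : Fin 4 → EuclideanSpace ℝ (Fin 3) := fun i => (U.equivFinOfCardEq hU).symm i
  have hy : ∀ i, y i ∈ T := fun i => hUT ((U.equivFinOfCardEq hU).symm i).2
  have hinj : ∀ {i j}, i ≠ j → y i ≠ y j := fun hij h =>
    hij ((U.equivFinOfCardEq hU).symm.injective (Subtype.ext h))
  have hdep : ¬ LinearIndependent ℝ y := fun h => by
    simpa using h.fintype_card_le_finrank
  obtain ⟨w, hw, i, hi⟩ := Fintype.not_linearIndependent_iff.1 hdep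
  have hquad : ⟪∑ i, w i • y i, ∑ i, w i • y i⟫ = 0 := by rw [hw, inner_zero_left]
  have hself : ∀ i, ⟪y i, y i⟫ = (1 : ℝ) := fun i => by
    rw [real_inner_self_eq_norm_sq, hT _ (hy i), one_pow]
  simp only [Fin.sum_univ_four, inner_add_left, inner_add_right, real_inner_smul_left,
    real_inner_smul_right, hself] at hquad
  rw [real_inner_comm (y 0) (y 1), real_inner_comm (y 0) (y 2), real_inner_comm (y 0) (y 3),
    real_inner_comm (y 1) (y 2), real_inner_comm (y 1) (y 3), real_inner_comm (y 2) (y 3)]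
    at hquad
  have pos : ∀ i j, i ≠ j → 0 < ⟪y i, y j⟫ := fun i j h => hpos _ (hy i) _ (hy j) (hinj h)
  have le : ∀ i j, i ≠ j → ⟪y i, y j⟫ ≤ 1 / 2 := fun i j h => hle _ (hy i) _ (hy j) (hinj h)
  have hzero := quadratic_form_four_pos (a := w 0) (b := w 1) (c := w 2) (d := w 3)
    (pos 0 1 (by decide)) (le 0 1 (by decide)) (pos 0 2 (by decide)) (le 0 2 (by decide))
    (pos 0 3 (by decide)) (le 0 3 (by decide)) (pos 1 2 (by decide)) (le 1 2 (by decide))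
    (pos 1 3 (by decide)) (le 1 3 (by decide)) (pos 2 3 (by decide)) (le 2 3 (by decide))
    (by linarith)
  fin_cases i <;> simp_all

lemma inner_pos_of_inner_lt {x y z : V} (hx : ‖x‖ = 1) (hy : ‖y‖ = 1) (hz : ‖z‖ = 1)
    (hxy : ⟪x, y⟫ < -0.7072) (hxz : ⟪x, z⟫ < -0.7072) : 0 < ⟪y, z⟫ := by
  have h := abs_real_inner_le_norm x (y + z)
  rw [hx, one_mul, ← abs_norm (y + z), ← sq_le_sq, norm_add_sq_real, hy, hz,
    inner_add_right] at h
  nlinarith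

/-- Cauchy–Schwarz for a conic combination of two unit vectors at angle at least `π / 3`. -/
lemma sq_combination_two_le {x y z : V} (hx : ‖x‖ = 1) (hy : ‖y‖ = 1) (hz : ‖z‖ = 1)
    (hyz : ⟪y, z⟫ ≤ 1 / 2) {a b : ℝ} (ha : 0 ≤ a) (hb : 0 ≤ b) :
    (a * ⟪x, y⟫ + b * ⟪x, z⟫) ^ 2 ≤ a ^ 2 + b ^ 2 + a * b := by
  have h := abs_real_inner_le_norm x (a • y + b • z)
  rw [hx, one_mul, ← abs_norm (a • y + b • z), ← sq_le_sq, norm_add_sq_real, inner_add_right]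
    at h
  simp only [real_inner_smul_left, real_inner_smul_right, norm_smul, hy, hz, mul_one,
    Real.norm_eq_abs, sq_abs] at h
  nlinarith [mul_nonneg ha hb]

/-- Cauchy–Schwarz for a conic combination of three unit vectors at angles at least `π / 3`. -/
lemma sq_combination_three_le {x y z w : V} (hx : ‖x‖ = 1) (hy : ‖y‖ = 1) (hz : ‖z‖ = 1)
    (hw : ‖w‖ = 1) (hyz : ⟪y, z⟫ ≤ 1 / 2) (hyw : ⟪y, w⟫ ≤ 1 / 2) (hzw : ⟪z, w⟫ ≤ 1 / 2)
    {a b c : ℝ} (ha : 0 ≤ a) (hb : 0 ≤ b) (hc : 0 ≤ c) :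
    (a * ⟪x, y⟫ + b * ⟪x, z⟫ + c * ⟪x, w⟫) ^ 2
      ≤ a ^ 2 + b ^ 2 + c ^ 2 + a * b + a * c + b * c := by
  have h := abs_real_inner_le_norm x (a • y + b • z + c • w)
  rw [hx, one_mul, ← abs_norm (a • y + b • z + c • w), ← sq_le_sq, norm_add_sq_real,
    norm_add_sq_real] at h
  simp only [inner_add_left, inner_add_right, real_inner_smul_left, real_inner_smul_right,
    norm_smul, hy, hz, hw, mul_one, Real.norm_eq_abs, sq_abs] at h
  nlinarith [mul_le_mul_of_nonneg_left hyz (mul_nonneg ha hb),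
    mul_le_mul_of_nonneg_left hyw (mul_nonneg ha hc),
    mul_le_mul_of_nonneg_left hzw (mul_nonneg hb hc)]

lemma neg_inner_le_one {x y : V} (hx : ‖x‖ = 1) (hy : ‖y‖ = 1) : -⟪x, y⟫ ≤ 1 := by
  have h := neg_le_of_abs_le (abs_real_inner_le_norm x y)
  rw [hx, hy] at h
  linarith

lemma sq_sub_mul_add_sq_le {x y z : V} (hx : ‖x‖ = 1) (hy : ‖y‖ = 1) (hz : ‖z‖ = 1)
    (hyz : ⟪y, z⟫ ≤ 1 / 2) (hxy : ⟪x, y⟫ < -0.7072) (hxz : ⟪x, z⟫ < -0.7072) :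
    ⟪x, y⟫ ^ 2 - ⟪x, y⟫ * ⟪x, z⟫ + ⟪x, z⟫ ^ 2 ≤ 3 / 4 := by
  have hy₁ := neg_inner_le_one hx hy
  have hz₁ := neg_inner_le_one hx hz
  have h := sq_combination_two_le hx hy hz hyz (a := ⟪x, z⟫ - 2 * ⟪x, y⟫)
    (b := ⟪x, y⟫ - 2 * ⟪x, z⟫) (by linarith) (by linarith)
  by_contra! hlt
  nlinarith

lemma neg_inner_le {x y z : V} (hx : ‖x‖ = 1) (hy : ‖y‖ = 1) (hz : ‖z‖ = 1)
    (hyz : ⟪y, z⟫ ≤ 1 / 2) (hxy : ⟪x, y⟫ < -0.7072) (hxz : ⟪x, z⟫ < -0.7072) :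
    -⟪x, y⟫ ≤ 0.966 := by
  have h := sq_sub_mul_add_sq_le hx hy hz hyz hxy hxz
  have hz₁ := neg_inner_le_one hx hz
  by_contra! hlt
  nlinarith

end Geometry

section LocalBounds

variable {V : Type*} [NormedAddCommGroup V] [InnerProductSpace ℝ V]

lemma kissingPoly_lt_of_norm_one {x y : V} (hx : ‖x‖ = 1) (hy : ‖y‖ = 1)
    (hxy : ⟪x, y⟫ < -0.7072) : kissingPoly ⟪x, y⟫ < 2.573 := by
  have h := kissingPoly_neg_le (t := -⟪x, y⟫) (by linarith) (neg_inner_le_one hx hy)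
  rw [neg_neg] at h
  linarith

lemma kissingPoly_add_lt {x y z : V} (hx : ‖x‖ = 1) (hy : ‖y‖ = 1) (hz : ‖z‖ = 1)
    (hyz : ⟪y, z⟫ ≤ 1 / 2) (hxy : ⟪x, y⟫ < -0.7072) (hxz : ⟪x, z⟫ < -0.7072) :
    kissingPoly ⟪x, y⟫ + kissingPoly ⟪x, z⟫ < 2.573 := by
  have hzy : ⟪z, y⟫ ≤ 1 / 2 := by rwa [real_inner_comm]
  have h₁ := kissingPoly_neg_le_quadratic_two (t := -⟪x, y⟫) (by linarith)
    (neg_inner_le hx hy hz hyz hxy hxz)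
  have h₂ := kissingPoly_neg_le_quadratic_two (t := -⟪x, z⟫) (by linarith)
    (neg_inner_le hx hz hy hzy hxz hxy)
  have hD := sq_sub_mul_add_sq_le hx hy hz hyz hxy hxz
  rw [neg_neg] at h₁ h₂
  generalize ⟪x, y⟫ = u at *
  generalize ⟪x, z⟫ = v at *
  have hprod : 0 ≤ (-u - 0.7072) * (-v - 0.7072) :=
    mul_nonneg (by linarith) (by linarith)
  have hS : -u - v ≤ 1.73206 := by nlinarith [sq_nonneg (u - v)]
  suffices u ^ 2 + v ^ 2 + 1.134 * (u + v) ≤ -0.464 by linarith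
  obtain h | h := le_total 1.67 (-u - v)
  · nlinarith [mul_nonneg (sub_nonneg.2 h) (sub_nonneg.2 hS)]
  · nlinarith [mul_nonneg (sub_nonneg.2 h) (show 0 ≤ -u - v - 1.4144 by linarith)]

lemma kissingPoly_add_add_lt {x y z w : V} (hx : ‖x‖ = 1) (hy : ‖y‖ = 1) (hz : ‖z‖ = 1)
    (hw : ‖w‖ = 1) (hyz : ⟪y, z⟫ ≤ 1 / 2) (hyw : ⟪y, w⟫ ≤ 1 / 2) (hzw : ⟪z, w⟫ ≤ 1 / 2)
    (hxy : ⟪x, y⟫ < -0.7072) (hxz : ⟪x, z⟫ < -0.7072) (hxw : ⟪x, w⟫ < -0.7072) :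
    kissingPoly ⟪x, y⟫ + kissingPoly ⟪x, z⟫ + kissingPoly ⟪x, w⟫ < 2.573 := by
  have hzy : ⟪z, y⟫ ≤ 1 / 2 := by rwa [real_inner_comm]
  have hwy : ⟪w, y⟫ ≤ 1 / 2 := by rwa [real_inner_comm]
  have h₁ := kissingPoly_neg_le_quadratic_three (t := -⟪x, y⟫) (by linarith)
    (neg_inner_le hx hy hz hyz hxy hxz)
  have h₂ := kissingPoly_neg_le_quadratic_three (t := -⟪x, z⟫) (by linarith)
    (neg_inner_le hx hz hy hzy hxz hxy)
  have h₃ := kissingPoly_neg_le_quadratic_three (t := -⟪x, w⟫) (by linarith)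
    (neg_inner_le hx hw hy hwy hxw hxy)
  have hone := sq_combination_three_le hx hy hz hw hyz hyw hzw zero_le_one zero_le_one zero_le_one
  have hS : -⟪x, y⟫ - ⟪x, z⟫ - ⟪x, w⟫ ≤ 2.4495 := by nlinarith
  have hE := sq_combination_three_le hx hy hz hw hyz hyw hzw
    (a := -4 * ⟪x, y⟫ + (⟪x, y⟫ + ⟪x, z⟫ + ⟪x, w⟫)) (b := -4 * ⟪x, z⟫ + (⟪x, y⟫ + ⟪x, z⟫ + ⟪x, w⟫))
    (c := -4 * ⟪x, w⟫ + (⟪x, y⟫ + ⟪x, z⟫ + ⟪x, w⟫)) (by linarith) (by linarith) (by linarith)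
  rw [neg_neg] at h₁ h₂ h₃
  generalize ⟪x, y⟫ = u at *
  generalize ⟪x, z⟫ = v at *
  generalize ⟪x, w⟫ = t at *
  have hF : 4 * (u ^ 2 + v ^ 2 + t ^ 2) - (u + v + t) ^ 2 ≤ 2 := by
    by_contra! hlt
    nlinarith [mul_pos (sub_pos.2 hlt) (sub_pos.2 (hlt.trans' two_pos))]
  suffices u ^ 2 + v ^ 2 + t ^ 2 + (u + v + t) ≤ -0.449 by linarith
  nlinarith [mul_nonneg (sub_nonneg.2 hS) (show 0 ≤ -u - v - t - 2.1216 by linarith)]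

end LocalBounds

/-- The total contribution to `kissingPoly` of the points seen from a fixed point. -/
lemma sum_kissingPoly_lt {S : Finset (EuclideanSpace ℝ (Fin 3))} (hS : ∀ x ∈ S, ‖x‖ = 1)
    (hle : ∀ x ∈ S, ∀ y ∈ S, x ≠ y → ⟪x, y⟫ ≤ 1 / 2) {x : EuclideanSpace ℝ (Fin 3)} (hx : x ∈ S) :
    ∑ y ∈ S, kissingPoly ⟪x, y⟫ < 13 := by
  have hself : ⟪x, x⟫ = (1 : ℝ) := by rw [real_inner_self_eq_norm_sq, hS x hx, one_pow]
  have hone : kissingPoly 1 = 10.427 := by rw [kissingPoly_eq]; norm_num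
  rw [← sum_filter_add_sum_filter_not S (fun y => ⟪x, y⟫ < -0.7072)]
  have hfar : ∑ y ∈ S with ¬ ⟪x, y⟫ < -0.7072, kissingPoly ⟪x, y⟫ ≤ 10.427 := by
    have hmem : x ∈ S.filter (fun y => ¬ ⟪x, y⟫ < -0.7072) := by
      rw [mem_filter, hself]
      norm_num [hx]
    rw [← add_sum_erase _ _ hmem, hself, hone, add_le_iff_nonpos_right]
    refine sum_nonpos fun y hy => ?_
    obtain ⟨hyx, hy⟩ := mem_erase.1 hy
    obtain ⟨hyS, hy⟩ := mem_filter.1 hy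
    exact kissingPoly_nonpos (not_lt.1 hy) (by linarith [hle x hx y hyS hyx.symm])
  set T := S.filter (fun y => ⟪x, y⟫ < -0.7072)
  have hTS : ∀ y ∈ T, y ∈ S ∧ ⟪x, y⟫ < -0.7072 := fun y hy => mem_filter.1 hy
  have hnear : ∑ y ∈ T, kissingPoly ⟪x, y⟫ < 2.573 := by
    have hcard : #T ≤ 3 := card_le_three_of_inner_pos (fun y hy => hS y (hTS y hy).1)
      (fun y hy z hz _ => inner_pos_of_inner_lt (hS x hx) (hS y (hTS y hy).1)
        (hS z (hTS z hz).1) (hTS y hy).2 (hTS z hz).2)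
      (fun y hy z hz => hle y (hTS y hy).1 z (hTS z hz).1)
    clear_value T
    interval_cases h : #T
    · rw [card_eq_zero.1 h, sum_empty]
      norm_num
    · obtain ⟨y, rfl⟩ := card_eq_one.1 h
      obtain ⟨hy, hxy⟩ := hTS y (by simp)
      rw [sum_singleton]
      exact kissingPoly_lt_of_norm_one (hS x hx) (hS y hy) hxy
    · obtain ⟨y, z, hyz, rfl⟩ := card_eq_two.1 h
      obtain ⟨hy, hxy⟩ := hTS y (by simp)
      obtain ⟨hz, hxz⟩ := hTS z (by simp)
      rw [sum_pair hyz]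
      exact kissingPoly_add_lt (hS x hx) (hS y hy) (hS z hz) (hle y hy z hz hyz) hxy hxz
    · obtain ⟨y, z, w, hyz, hyw, hzw, rfl⟩ := card_eq_three.1 h
      obtain ⟨hy, hxy⟩ := hTS y (by simp)
      obtain ⟨hz, hxz⟩ := hTS z (by simp)
      obtain ⟨hw, hxw⟩ := hTS w (by simp)
      rw [sum_insert (by simp [hyz, hyw]), sum_pair hzw, ← add_assoc]
      exact kissingPoly_add_add_lt (hS x hx) (hS y hy) (hS z hz) (hS w hw) (hle y hy z hz hyz)
        (hle y hy w hw hyw) (hle z hz w hw hzw) hxy hxz hxw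
  linarith

lemma card_sq_le_sum_kissingPoly {S : Finset (EuclideanSpace ℝ (Fin 3))}
    (hS : ∀ x ∈ S, ‖x‖ = 1) :
    (#S : ℝ) ^ 2 ≤ ∑ x ∈ S, ∑ y ∈ S, kissingPoly ⟪x, y⟫ := by
  simp only [kissingPoly, sum_add_distrib, ← mul_sum, sum_const, nsmul_eq_mul, mul_one]
  linarith [sum_id_nonneg S hS, sum_legendreTwo_nonneg S hS, sum_legendreThree_nonneg S hS,
    sum_legendreFour_nonneg S hS, sum_legendreNine_nonneg S hS]

/-- A spherical code in `ℝ³` of minimal angle `π / 3` has at most twelve points. -/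
lemma card_le_twelve_of_inner_le {S : Finset (EuclideanSpace ℝ (Fin 3))} (hS : ∀ x ∈ S, ‖x‖ = 1)
    (hle : ∀ x ∈ S, ∀ y ∈ S, x ≠ y → ⟪x, y⟫ ≤ 1 / 2) : #S ≤ 12 := by
  by_contra! hcard
  have hne : S.Nonempty := card_pos.1 (by omega)
  have h := (card_sq_le_sum_kissingPoly hS).trans_lt
    (sum_lt_sum_of_nonempty hne fun x hx => sum_kissingPoly_lt hS hle hx)
  rw [sum_const, nsmul_eq_mul] at h
  have hcard' : (13 : ℝ) ≤ #S := by exact_mod_cast hcard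
  nlinarith

lemma card_le_twelve {S : Finset (EuclideanSpace ℝ (Fin 3))} (hS : ∀ x ∈ S, ‖x‖ = 2)
    (hdist : ∀ x ∈ S, ∀ y ∈ S, x ≠ y → 2 ≤ dist x y) : #S ≤ 12 := by
  have hinj : Function.Injective fun x : EuclideanSpace ℝ (Fin 3) => (1 / 2 : ℝ) • x :=
    smul_right_injective _ (by norm_num)
  rw [← card_image_of_injective S hinj]
  refine card_le_twelve_of_inner_le ?_ ?_
  · rw [forall_mem_image]
    intro x hx
    rw [norm_smul, hS x hx]
    norm_num
  · simp only [forall_mem_image]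
    intro x hx y hy hxy
    have h := hdist x hx y hy (fun h => hxy (by rw [h]))
    rw [dist_eq_norm] at h
    have hsq := norm_sub_sq_real x y
    rw [hS x hx, hS y hy] at hsq
    rw [real_inner_smul_left, real_inner_smul_right]
    nlinarith

/-- The roots of the `D₃` lattice: integer vectors of squared length two. -/
def rootsDThree : Finset (Fin 3 → ℤ) :=
  {v ∈ Fintype.piFinset fun _ => {-1, 0, 1} | ∑ i, v i ^ 2 = 2}

lemma card_rootsDThree : #rootsDThree = 12 := by
  decide

lemma two_le_of_mem_rootsDThree : ∀ v ∈ rootsDThree, ∀ w ∈ rootsDThree, v ≠ w →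
    2 ≤ ∑ i, (v i - w i) ^ 2 := by
  decide

/-- The integer vector `v`, scaled by `√2`, as a point of Euclidean space. -/
noncomputable def scaledPoint (v : Fin 3 → ℤ) : EuclideanSpace ℝ (Fin 3) :=
  WithLp.toLp 2 fun i => √2 * (v i : ℝ)

lemma norm_sq_scaledPoint (v : Fin 3 → ℤ) :
    ‖scaledPoint v‖ ^ 2 = 2 * ((∑ i, v i ^ 2 : ℤ) : ℝ) := by
  rw [EuclideanSpace.real_norm_sq_eq]
  simp [scaledPoint, mul_pow, mul_sum]

lemma scaledPoint_sub (v w : Fin 3 → ℤ) :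
    scaledPoint v - scaledPoint w = scaledPoint (v - w) := by
  ext i
  simp [scaledPoint, mul_sub]

lemma scaledPoint_injective : Function.Injective scaledPoint := fun v w h => by
  ext i
  simpa [scaledPoint] using congrArg (fun x : EuclideanSpace ℝ (Fin 3) => x i) h

theorem kissingNumber_dim3 :
    (∀ S : Finset (EuclideanSpace ℝ (Fin 3)),
        (∀ x ∈ S, ‖x‖ = 2) →
        (∀ x ∈ S, ∀ y ∈ S, x ≠ y → 2 ≤ dist x y) →
        S.card ≤ 12) ∧
      ∃ S : Finset (EuclideanSpace ℝ (Fin 3)),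
        (∀ x ∈ S, ‖x‖ = 2) ∧
        (∀ x ∈ S, ∀ y ∈ S, x ≠ y → 2 ≤ dist x y) ∧
        S.card = 12 := by
  refine ⟨fun S hS hdist => card_le_twelve hS hdist, rootsDThree.image scaledPoint, ?_, ?_, ?_⟩
  · rw [forall_mem_image]
    intro v hv
    have h := norm_sq_scaledPoint v
    rw [(mem_filter.1 hv).2, Int.cast_ofNat] at h
    nlinarith [norm_nonneg (scaledPoint v)]
  · simp only [forall_mem_image]
    intro v hv w hw hne
    have h := norm_sq_scaledPoint (v - w)
    have h2 : (2 : ℝ) ≤ ((∑ i, (v - w) i ^ 2 : ℤ) : ℝ) := by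
      exact_mod_cast two_le_of_mem_rootsDThree v hv w hw (fun h => hne (by rw [h]))
    rw [dist_eq_norm, scaledPoint_sub]
    nlinarith [norm_nonneg (scaledPoint (v - w))]
  · rw [card_image_of_injective _ scaledPoint_injective, card_rootsDThree]
end

section
/- The kissing number in dimension 4 is 24 (Musin's theorem): for every finite set S of points in Euclidean 4-space ℝ⁴ such that every point of S has norm 2 and any two distinct points of S are at distance at least 2 from each other, the cardinality of S is at most 24; moreover, there exists such a set S with exactly 24 points (as realized by the minimal vectors of the D₄ lattice packing). -/
namespace Kissing

/-- The binary form `∑ i, lᵢ p ^ i q ^ (n - i)`, where `n + 1` is the length of `l`. -/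
def form : List ℤ → ℝ → ℝ → ℝ
  | [], _, _ => 0
  | c :: l, p, q => c * q ^ l.length + p * form l p q

/-- Auxiliary recursion for `mulAdd`. -/
def mulAddAux : ℤ → List ℤ → ℤ → List ℤ
  | b, [], c => [b + c]
  | b, a :: l, c => (b + a) :: mulAddAux a l c

/-- Coefficients of `(p + q) * form l p q + c * p ^ l.length`. -/
def mulAdd (l : List ℤ) (c : ℤ) : List ℤ := mulAddAux 0 l c

/-- Coefficients of the form `form l p (p + q)`. -/
def shift (l : List ℤ) : List ℤ := l.foldl mulAdd []

lemma length_mulAddAux (b : ℤ) (l : List ℤ) (c : ℤ) :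
    (mulAddAux b l c).length = l.length + 1 := by
  induction l generalizing b with
  | nil => rfl
  | cons a l ih => simp [mulAddAux, ih]

lemma form_mulAddAux (b : ℤ) (l : List ℤ) (c : ℤ) (p q : ℝ) :
    form (mulAddAux b l c) p q
      = b * q ^ l.length + (p + q) * form l p q + c * p ^ l.length := by
  induction l generalizing b with
  | nil => simp [mulAddAux, form]
  | cons a l ih =>
    simp only [mulAddAux, form, ih, length_mulAddAux, List.length_cons]
    push_cast
    ring

lemma form_append_singleton (l : List ℤ) (c : ℤ) (p q : ℝ) :
    form (l ++ [c]) p q = q * form l p q + c * p ^ l.length := by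
  induction l with
  | nil => simp [form]
  | cons a l ih =>
    simp only [List.cons_append, form, ih, List.length_append, List.length_cons, List.length_nil]
    ring

lemma form_reverse (l : List ℤ) (p q : ℝ) : form l.reverse p q = form l q p := by
  induction l with
  | nil => rfl
  | cons a l ih =>
    rw [List.reverse_cons, form_append_singleton, ih, form, List.length_reverse]
    ring

lemma length_shift (l : List ℤ) : (shift l).length = l.length := by
  induction l using List.reverseRecOn with
  | nil => rfl
  | append_singleton l c ih =>
    rw [shift, List.foldl_append, ← shift]
    simp [mulAdd, length_mulAddAux, ih]

lemma form_shift (l : List ℤ) (p q : ℝ) : form (shift l) p q = form l p (p + q) := by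
  induction l using List.reverseRecOn with
  | nil => rfl
  | append_singleton l c ih =>
    rw [shift, List.foldl_append, ← shift, form_append_singleton, ← ih]
    simp [mulAdd, form_mulAddAux, length_shift]

/-- The value of the biform `∑ form P p q * form Q p' q'`, summed over the pairs `(P, Q)`. -/
def biform (T : List (List ℤ × List ℤ)) (p q p' q' : ℝ) : ℝ :=
  (T.map fun t => form t.1 p q * form t.2 p' q').sum

/-- All coefficients of a biform of bidegree `(m - 1, n - 1)` are nonnegative. -/
def coeffsNonneg (m n : ℕ) (T : List (List ℤ × List ℤ)) : Bool :=
  (T.all fun t => t.1.length == m && t.2.length == n) &&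
    (List.range m).all fun i => (List.range n).all fun j =>
      decide (0 ≤ (T.map fun t => t.1.getD i 0 * t.2.getD j 0).sum)

/-- Nonnegativity test on the positive orthant by Bernstein subdivision, alternating between the
two pairs of variables. -/
def nonnegTest : ℕ → ℕ → ℕ → List (List ℤ × List ℤ) → Bool
  | 0, m, n, T => coeffsNonneg m n T
  | k + 1, m, n, T => coeffsNonneg m n T ||
      (nonnegTest k n m (T.map fun t => (t.2, shift t.1)) &&
        nonnegTest k n m (T.map fun t => (t.2, shift t.1.reverse)))

lemma form_eq_sum (l : List ℤ) (p q : ℝ) :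
    form l p q =
      ∑ i ∈ Finset.range l.length, (l.getD i 0 : ℝ) * p ^ i * q ^ (l.length - 1 - i) := by
  induction l with
  | nil => rfl
  | cons a l ih =>
    rw [form, ih, List.length_cons, Finset.sum_range_succ', Finset.mul_sum, add_comm]
    congr 1
    · refine Finset.sum_congr rfl fun i _ => ?_
      rw [List.getD_cons_succ, show l.length + 1 - 1 - (i + 1) = l.length - 1 - i by omega]
      ring
    · simp

lemma biform_nonneg_of_coeffsNonneg {m n : ℕ} {T : List (List ℤ × List ℤ)}
    (h : coeffsNonneg m n T = true) {p q p' q' : ℝ} (hp : 0 ≤ p) (hq : 0 ≤ q) (hp' : 0 ≤ p')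
    (hq' : 0 ≤ q') : 0 ≤ biform T p q p' q' := by
  simp only [coeffsNonneg, Bool.and_eq_true, List.all_eq_true, beq_iff_eq, List.mem_range,
    decide_eq_true_eq] at h
  obtain ⟨hlen, hpos⟩ := h
  have key : biform T p q p' q' = ∑ i ∈ Finset.range m, ∑ j ∈ Finset.range n,
      (((T.map fun t => t.1.getD i 0 * t.2.getD j 0).sum : ℤ) : ℝ) *
        (p ^ i * q ^ (m - 1 - i) * (p' ^ j * q' ^ (n - 1 - j))) := by
    clear hpos
    induction T with
    | nil => simp [biform]
    | cons t T ih =>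
      have ht := hlen t (by simp)
      have ih' := ih fun t ht => hlen t (by simp [ht])
      rw [biform, List.map_cons, List.sum_cons, ← biform, ih', form_eq_sum, form_eq_sum, ht.1, ht.2,
        Finset.sum_mul_sum, ← Finset.sum_add_distrib]
      refine Finset.sum_congr rfl fun i _ => ?_
      rw [← Finset.sum_add_distrib]
      refine Finset.sum_congr rfl fun j _ => ?_
      rw [List.map_cons, List.sum_cons]
      push_cast
      ring
  rw [key]
  refine Finset.sum_nonneg fun i hi => Finset.sum_nonneg fun j hj => ?_
  have := hpos i (Finset.mem_range.1 hi) j (Finset.mem_range.1 hj)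
  have : (0 : ℝ) ≤ ((T.map fun t => t.1.getD i 0 * t.2.getD j 0).sum : ℤ) := by exact_mod_cast this
  positivity

lemma biform_nonneg {k m n : ℕ} {T : List (List ℤ × List ℤ)} (h : nonnegTest k m n T = true)
    {p q p' q' : ℝ} (hp : 0 ≤ p) (hq : 0 ≤ q) (hp' : 0 ≤ p') (hq' : 0 ≤ q') :
    0 ≤ biform T p q p' q' := by
  induction k generalizing m n T p q p' q' with
  | zero => exact biform_nonneg_of_coeffsNonneg h hp hq hp' hq'
  | succ k ih =>
    simp only [nonnegTest, Bool.or_eq_true, Bool.and_eq_true] at h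
    obtain h | ⟨h₁, h₂⟩ := h
    · exact biform_nonneg_of_coeffsNonneg h hp hq hp' hq'
    · rcases le_total p q with hpq | hpq
      · convert ih h₁ hp' hq' hp (sub_nonneg.2 hpq) using 1
        simp [biform, Function.comp_def, form_shift, mul_comm]
      · convert ih h₂ hp' hq' hq (sub_nonneg.2 hpq) using 1
        simp [biform, Function.comp_def, form_shift, form_reverse, mul_comm]

open scoped ComplexConjugate in
/-- Powers of a Gram kernel are positive semidefinite. -/
lemma sum_sum_gram_pow_nonneg {ι α : Type*} [Fintype ι] (S : Finset α) (φ : α → ι → ℂ) (k : ℕ) :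
    0 ≤ (∑ x ∈ S, ∑ y ∈ S, (∑ i, conj (φ x i) * φ y i) ^ k).re := by
  have key : ∑ x ∈ S, ∑ y ∈ S, (∑ i, conj (φ x i) * φ y i) ^ k =
      ∑ l : Fin k → ι, conj (∑ x ∈ S, ∏ j, φ x (l j)) * ∑ x ∈ S, ∏ j, φ x (l j) := by
    simp_rw [Fintype.sum_pow, Finset.prod_mul_distrib, map_sum, map_prod, Finset.sum_mul_sum]
    simp_rw [Finset.sum_comm (s := S) (t := Finset.univ)]
  rw [key, Complex.re_sum]
  refine Finset.sum_nonneg fun l _ => ?_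
  rw [← Complex.normSq_eq_conj_mul_self]
  exact_mod_cast Complex.normSq_nonneg _

local notation "E₄" => EuclideanSpace ℝ (Fin 4)

/-- The imaginary part of the product of the quaternion `x` with the conjugate of `y`, up to
conjugation. -/
def imPart (x y : E₄) : Fin 3 → ℝ :=
  ![x 1 * y 0 - x 0 * y 1 + x 2 * y 3 - x 3 * y 2,
    x 2 * y 0 - x 0 * y 2 + x 3 * y 1 - x 1 * y 3,
    x 3 * y 0 - x 0 * y 3 + x 1 * y 2 - x 2 * y 1]

/-- The component of `imPart x y` along `v`. -/
def twist (v : Fin 3 → ℝ) (x y : E₄) : ℝ :=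
  v 0 * imPart x y 0 + v 1 * imPart x y 1 + v 2 * imPart x y 2

lemma inner_eq_coords (x y : E₄) :
    inner ℝ x y = x 0 * y 0 + x 1 * y 1 + x 2 * y 2 + x 3 * y 3 := by
  simp [PiLp.inner_apply, Fin.sum_univ_four, mul_comm]

lemma sum_sum_twist_nonneg (S : Finset E₄) {v : Fin 3 → ℝ} (hv : ∑ i, v i ^ 2 = 1) (k : ℕ) :
    0 ≤ ∑ x ∈ S, ∑ y ∈ S, ((inner ℝ x y + twist v x y * Complex.I : ℂ) ^ k).re := by
  have h := sum_sum_gram_pow_nonneg S (fun x : E₄ => (![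
    ⟨x 0, -(x 1 * v 0 + x 2 * v 1 + x 3 * v 2)⟩, ⟨x 1, x 0 * v 0 + x 2 * v 2 - x 3 * v 1⟩,
    ⟨x 2, x 0 * v 1 - x 1 * v 2 + x 3 * v 0⟩, ⟨x 3, x 0 * v 2 + x 1 * v 1 - x 2 * v 0⟩] :
      Fin 4 → ℂ)) k
  rw [Fin.sum_univ_three] at hv
  have key (x y : E₄) : (∑ i, (starRingEnd ℂ) ((![
    ⟨x 0, -(x 1 * v 0 + x 2 * v 1 + x 3 * v 2)⟩, ⟨x 1, x 0 * v 0 + x 2 * v 2 - x 3 * v 1⟩,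
    ⟨x 2, x 0 * v 1 - x 1 * v 2 + x 3 * v 0⟩, ⟨x 3, x 0 * v 2 + x 1 * v 1 - x 2 * v 0⟩] :
      Fin 4 → ℂ) i) * (![
    ⟨y 0, -(y 1 * v 0 + y 2 * v 1 + y 3 * v 2)⟩, ⟨y 1, y 0 * v 0 + y 2 * v 2 - y 3 * v 1⟩,
    ⟨y 2, y 0 * v 1 - y 1 * v 2 + y 3 * v 0⟩, ⟨y 3, y 0 * v 2 + y 1 * v 1 - y 2 * v 0⟩] :
      Fin 4 → ℂ) i) = 2 * (inner ℝ x y + twist v x y * Complex.I : ℂ) := by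
    apply Complex.ext
    · simp [Fin.sum_univ_four, inner_eq_coords, twist, imPart]
      linear_combination (x 0 * y 0 + x 1 * y 1 + x 2 * y 2 + x 3 * y 3) * hv
    · simp [Fin.sum_univ_four, inner_eq_coords, twist, imPart]
      ring
  simp_rw [key, mul_pow, ← Finset.mul_sum] at h
  rw [← Complex.ofReal_ofNat, ← Complex.ofReal_pow, Complex.re_ofReal_mul] at h
  simp_rw [Complex.re_sum] at h
  exact nonneg_of_mul_nonneg_right h (by positivity)

/-- Weighted axes in `ℝ³` forming a spherical design of strength 11. -/
def axes : List (ℚ × (Fin 3 → ℤ)) :=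
  [(8 / 315, ![1, 0, 0]), (8 / 315, ![0, 1, 0]), (8 / 315, ![0, 0, 1])]
   ++ [![0, 1, 1], ![0, 1, -1], ![1, 0, 1], ![1, 0, -1], ![1, 1, 0], ![1, -1, 0]].map
      (128 / 2835, ·)
   ++ [![1, 1, 1], ![1, 1, -1], ![1, -1, 1], ![-1, 1, 1]].map (27 / 640, ·)
   ++ [![1, 1, 3], ![1, 1, -3], ![1, -1, 3], ![-1, 1, 3], ![1, 3, 1], ![1, 3, -1],
        ![1, -3, 1], ![-1, 3, 1], ![3, 1, 1], ![3, 1, -1], ![3, -1, 1], ![-3, 1, 1]].map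
      (14641 / 362880, ·)

/-- The average over the design of the `2j`-th power of the coordinate of `m` along the axis. -/
noncomputable def moment (j : ℕ) (m : Fin 3 → ℝ) : ℝ :=
  (axes.map fun a => a.1 * ((a.2 0 * m 0 + a.2 1 * m 1 + a.2 2 * m 2) ^ 2 /
    (a.2 0 ^ 2 + a.2 1 ^ 2 + a.2 2 ^ 2)) ^ j).sum

lemma moment_eq {j : ℕ} (hj : j ≤ 4) (m : Fin 3 → ℝ) :
    moment j m = (m 0 ^ 2 + m 1 ^ 2 + m 2 ^ 2) ^ j / (2 * j + 1) := by
  interval_cases j <;>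
  · simp [moment, axes]
    ring

lemma re_pow_eq {k : ℕ} (hk : k ≤ 9) (t c : ℝ) :
    ((t + c * Complex.I : ℂ) ^ k).re = ∑ j ∈ Finset.range 5,
      (-1) ^ j * (k.choose (2 * j)) * t ^ (k - 2 * j) * (c ^ 2) ^ j := by
  interval_cases k <;>
  · simp [pow_succ, Finset.sum_range_succ, Nat.choose]
    try ring

/-- The zonal spherical function of degree `k ≤ 9` on `S³`, that is `U k t / (k + 1)` with `U` the
Chebyshev polynomials of the second kind, written as a Laplace integral. -/
noncomputable def zonal (k : ℕ) (t : ℝ) : ℝ :=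
  ∑ j ∈ Finset.range 5,
    (-1) ^ j * (k.choose (2 * j)) * t ^ (k - 2 * j) * ((1 - t ^ 2) ^ j / (2 * j + 1))

lemma sum_sum_list_sum_nonneg {α β : Type*} (S : Finset α) (L : List β) (F : β → α → α → ℝ)
    (h : ∀ a ∈ L, 0 ≤ ∑ x ∈ S, ∑ y ∈ S, F a x y) :
    0 ≤ ∑ x ∈ S, ∑ y ∈ S, (L.map fun a => F a x y).sum := by
  induction L with
  | nil => simp
  | cons a L ih =>
    simp only [List.map_cons, List.sum_cons, Finset.sum_add_distrib]
    exact add_nonneg (h a (by simp)) (ih fun b hb => h b (by simp [hb]))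

lemma axes_pos {a : ℚ × (Fin 3 → ℤ)} (ha : a ∈ axes) :
    0 ≤ a.1 ∧ 0 < a.2 0 ^ 2 + a.2 1 ^ 2 + a.2 2 ^ 2 := by
  revert a
  simp [axes, or_imp, forall_and]
  norm_num

theorem sum_sum_zonal_nonneg (S : Finset E₄) (hS : ∀ x ∈ S, ‖x‖ = 1) {k : ℕ} (hk : k ≤ 9) :
    0 ≤ ∑ x ∈ S, ∑ y ∈ S, zonal k (inner ℝ x y) := by
  set N : (Fin 3 → ℤ) → ℝ := fun n => n 0 ^ 2 + n 1 ^ 2 + n 2 ^ 2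
  have h := sum_sum_list_sum_nonneg S axes (fun a x y => a.1 *
    ((inner ℝ x y + twist (fun i => a.2 i / √(N a.2)) x y * Complex.I : ℂ) ^ k).re) fun a ha => by
      obtain ⟨hw, hN⟩ := axes_pos ha
      have hN : 0 < N a.2 := by simp only [N]; exact_mod_cast hN
      simp_rw [← Finset.mul_sum]
      refine mul_nonneg (by exact_mod_cast hw) (sum_sum_twist_nonneg S ?_ k)
      simp only [div_pow, Real.sq_sqrt hN.le, ← Finset.sum_div]
      rw [Fin.sum_univ_three]
      exact div_self hN.ne'
  refine h.trans_eq (Finset.sum_congr rfl fun x hx => Finset.sum_congr rfl fun y hy => ?_)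
  have hm : imPart x y 0 ^ 2 + imPart x y 1 ^ 2 + imPart x y 2 ^ 2 = 1 - inner ℝ x y ^ 2 := by
    have hx := real_inner_self_eq_norm_sq x
    have hy := real_inner_self_eq_norm_sq y
    rw [hS _ ‹_›, inner_eq_coords] at hx hy
    simp only [imPart, inner_eq_coords, Matrix.cons_val]
    linear_combination hx + (x 0 * x 0 + x 1 * x 1 + x 2 * x 2 + x 3 * x 3) * hy
  have hz : zonal k (inner ℝ x y) = ∑ j ∈ Finset.range 5,
      (-1) ^ j * (k.choose (2 * j)) * inner ℝ x y ^ (k - 2 * j) * moment j (imPart x y) := by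
    refine Finset.sum_congr rfl fun j hj => ?_
    rw [moment_eq (by simpa [Nat.lt_succ_iff] using hj), hm]
  have ht (a : ℚ × (Fin 3 → ℤ)) : twist (fun i => a.2 i / √(N a.2)) x y ^ 2 =
      (a.2 0 * imPart x y 0 + a.2 1 * imPart x y 1 + a.2 2 * imPart x y 2) ^ 2 / N a.2 := by
    rw [← Real.sq_sqrt (show 0 ≤ N a.2 by positivity), ← div_pow, Real.sq_sqrt (by positivity),
      twist]
    ring
  simp only [hz, moment, re_pow_eq hk, ht, N]
  induction axes with
  | nil => simp
  | cons a L ih =>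
    simp only [List.map_cons, List.sum_cons]
    rw [ih, Finset.mul_sum, ← Finset.sum_add_distrib]
    exact Finset.sum_congr rfl fun j _ => by ring

/-- The polynomial of the linear programming bound. -/
noncomputable def lpPoly (t : ℝ) : ℝ :=
  1 + 188 / 100 * zonal 1 t + 609 / 100 * zonal 2 t + 333 / 100 * zonal 3 t
    + 506 / 100 * zonal 4 t + 97 / 100 * zonal 9 t

lemma lpPoly_eq (t : ℝ) : lpPoly t =
    -9 / 500 - 12 / 25 * t - 503 / 125 * t ^ 2 - 443 / 50 * t ^ 3 + 2024 / 125 * t ^ 4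
      + 8148 / 125 * t ^ 5 - 12416 / 125 * t ^ 7 + 6208 / 125 * t ^ 9 := by
  norm_num [lpPoly, zonal, Finset.sum_range_succ, Nat.choose]
  ring

/-- Coefficients of `-lpPoly` as a form in barycentric coordinates on `[-14 / 25, 1 / 2]`. -/
def lpForm : List (List ℤ × List ℤ) :=
  [([46973599883652, 6495358308666100, -42754158268760000, 12986564389796875,
    374498700397656250, -537601796220703125, -64509120117187500, 211646295166015625,
    66409606933593750, 11444091796875], [1])]

/-- Coefficients, as a form in barycentric coordinates on `[14 / 25, 1]`, of the difference of the
two sides of `lpPoly_neg_le`. -/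
def capDiagForm : List (List ℤ × List ℤ) :=
  [([276107251976253, 7790235462435596, 34012575044255258, 51472694387861615,
    -151538942504210800, 203828472431303500, 3123374705832205000, 6167004457624656250,
    4142423085912890625, 725183593750000, -853464729003906250, -78805367431640625,
    56932873535156250], [1])]

/-- Multiplier of the constant zonal kernel on the cap `-⟪x, z⟫ = s ≥ 14 / 25`. -/
noncomputable def capConst (s : ℝ) : ℝ :=
  66 / 100 + 164 / 100 * (4 * s - 16 / 5) + 136 / 100 * (4 * s - 16 / 5) ^ 2
    + 38 / 100 * (4 * s - 16 / 5) ^ 3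

/-- Multiplier of the linear zonal kernel on the cap `-⟪x, z⟫ = s ≥ 14 / 25`. -/
noncomputable def capLin (s : ℝ) : ℝ :=
  172 / 100 + 253 / 100 * (4 * s - 16 / 5) + 90 / 100 * (4 * s - 16 / 5) ^ 2

/-- Multiplier of the quadratic zonal kernel on the cap `-⟪x, z⟫ = s ≥ 14 / 25`. -/
noncomputable def capQuad (s : ℝ) : ℝ :=
  4 * (1 - s) *
    (116 / 100 + 186 / 100 * (4 * s - 16 / 5) + 76 / 100 * (4 * s - 16 / 5) ^ 2)

lemma lpPoly_nonpos {t : ℝ} (h₁ : -(14 / 25) ≤ t) (h₂ : t ≤ 1 / 2) : lpPoly t ≤ 0 := by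
  have key := biform_nonneg (k := 8) (m := 10) (n := 1) (T := lpForm) (by decide +kernel)
    (p := (t + 14 / 25) / (53 / 50)) (q := (1 / 2 - t) / (53 / 50)) (p' := 1) (q' := 1)
    (by linarith) (by linarith) (by norm_num) (by norm_num)
  have : lpPoly t * -7629394531250000 =
      biform lpForm ((t + 14 / 25) / (53 / 50)) ((1 / 2 - t) / (53 / 50)) 1 1 := by
    simp only [biform, form, lpForm, lpPoly_eq, List.map_cons, List.map_nil, List.sum_cons,
      List.sum_nil, List.length_cons, List.length_nil]
    push_cast
    ring
  linarith

lemma lpPoly_neg_le {s : ℝ} (h₁ : 14 / 25 ≤ s) (h₂ : s ≤ 1) :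
    lpPoly (-s) ≤ 2 * (258 / 100) * capConst s
      - (capConst s ^ 2 + capLin s ^ 2 * (1 - s ^ 2) + capQuad s ^ 2 * (1 - s ^ 2) ^ 2) := by
  have key := biform_nonneg (k := 8) (m := 13) (n := 1) (T := capDiagForm) (by decide +kernel)
    (p := (s - 14 / 25) / (11 / 25)) (q := (1 - s) / (11 / 25)) (p' := 1) (q' := 1)
    (by linarith) (by linarith) (by norm_num) (by norm_num)
  have : (2 * (258 / 100) * capConst s - (capConst s ^ 2 + capLin s ^ 2 * (1 - s ^ 2)
      + capQuad s ^ 2 * (1 - s ^ 2) ^ 2) - lpPoly (-s)) * 119209289550781250 =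
      biform capDiagForm ((s - 14 / 25) / (11 / 25)) ((1 - s) / (11 / 25)) 1 1 := by
    simp only [biform, form, capDiagForm, lpPoly_eq, capConst, capLin, capQuad, List.map_cons,
      List.map_nil, List.sum_cons, List.sum_nil, List.length_cons, List.length_nil]
    push_cast
    ring
  linarith

lemma capQuad_nonneg {s : ℝ} (h : s ≤ 1) : 0 ≤ capQuad s := by
  have : 0 ≤ 116 / 100 + 186 / 100 * (4 * s - 16 / 5) + 76 / 100 * (4 * s - 16 / 5) ^ 2 := by
    nlinarith [sq_nonneg (4 * s - 16 / 5 + 93 / 76)]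
  unfold capQuad
  have : 0 ≤ 1 - s := by linarith
  positivity

lemma capQuad_le_capLin {s : ℝ} (h : 14 / 25 ≤ s) : 7 / 8 * capQuad s ≤ capLin s := by
  unfold capQuad capLin
  nlinarith [sq_nonneg (4 * s - 16 / 5), mul_nonneg (sub_nonneg.2 h) (sq_nonneg (4 * s - 16 / 5)),
    mul_nonneg (sub_nonneg.2 h) (sq_nonneg (s - 14 / 25))]

/-- The biform which is `-(4 * 5 ^ 24)` times the kernel of `capKernel_nonpos`, in barycentric
coordinates on `[14 / 25, 1]`. -/
def capForm : List (List ℤ × List ℤ) :=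
  [(-390625, [2169, 120053, 1101274, 4223690, 5612925, 2372625]),
    (-12207031250, [377, 6296, 30126, 56372, 45665, 13500]),
    (39062500, [5278, 92291, 486873, 1055485, 993125, 337500]),
    (-1134375000, [1169, 15698, 76864, 111310, 48975, 0]),
    (7260000, [16366, 232631, 1235915, 2244025, 1224375, 0]),
    (-11616, [229124, 3436860, 19681725, 42632500, 30609375, 0]),
    (468512, [45591, 579490, 2578025, 2448750, 0, 0])].map
    fun (w, l) => (l.map (w * ·), l)

lemma capKernel_nonpos {s s' : ℝ} (h₁ : 14 / 25 ≤ s) (h₂ : s ≤ 1) (h₁' : 14 / 25 ≤ s')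
    (h₂' : s' ≤ 1) :
    capConst s * capConst s' + capLin s * capLin s' * (1 / 2 - s * s')
      + capQuad s * capQuad s' *
        ((3 * (1 / 2 - s * s') ^ 2 - (1 - s ^ 2) * (1 - s' ^ 2)) / 2) ≤ 0 := by
  have key := biform_nonneg (k := 10) (m := 6) (n := 6) (T := capForm) (by decide +kernel)
    (p := (s - 14 / 25) / (11 / 25)) (q := (1 - s) / (11 / 25))
    (p' := (s' - 14 / 25) / (11 / 25)) (q' := (1 - s') / (11 / 25))
    (by linarith) (by linarith) (by linarith) (by linarith)
  have : (capConst s * capConst s' + capLin s * capLin s' * (1 / 2 - s * s')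
      + capQuad s * capQuad s' *
        ((3 * (1 / 2 - s * s') ^ 2 - (1 - s ^ 2) * (1 - s' ^ 2)) / 2)) * -(4 * 5 ^ 24) =
      biform capForm ((s - 14 / 25) / (11 / 25)) ((1 - s) / (11 / 25))
        ((s' - 14 / 25) / (11 / 25)) ((1 - s') / (11 / 25)) := by
    simp only [biform, form, capForm, capConst, capLin, capQuad, List.map_cons, List.map_nil,
      List.sum_cons, List.sum_nil, List.length_cons, List.length_nil]
    push_cast
    ring
  linarith

lemma sum_sum_mul_sum_nonneg {α ι : Type*} (S : Finset α) (I : Finset ι) (φ : α → ι → ℝ) :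
    0 ≤ ∑ x ∈ S, ∑ y ∈ S, ∑ i ∈ I, φ x i * φ y i := by
  have : ∑ x ∈ S, ∑ y ∈ S, ∑ i ∈ I, φ x i * φ y i = ∑ i ∈ I, (∑ x ∈ S, φ x i) ^ 2 := by
    simp_rw [Finset.sum_comm (s := S) (t := I), sq, Finset.sum_mul_sum]
  rw [this]
  positivity

/-- The quadratic zonal kernel of the three-dimensional space orthogonal to `z`. -/
lemma sum_sum_quadratic_nonneg {α : Type*} (S : Finset α) (d : α → ℝ) (v : α → E₄) {z : E₄}
    (hz : ‖z‖ = 1) (hv : ∀ x ∈ S, inner ℝ (v x) z = 0) :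
    0 ≤ ∑ x ∈ S, ∑ y ∈ S, d x * d y *
      ((3 * inner ℝ (v x) (v y) ^ 2 - ‖v x‖ ^ 2 * ‖v y‖ ^ 2) / 2) := by
  let φ (x : α) (i : Fin 4 × Fin 4) : ℝ := d x *
    (v x i.1 * v x i.2 - inner ℝ (v x) (v x) / 3 * ((if i.1 = i.2 then 1 else 0) - z i.1 * z i.2))
  have h := mul_nonneg (show (0 : ℝ) ≤ 3 / 2 by norm_num)
    (sum_sum_mul_sum_nonneg S Finset.univ φ)
  simp_rw [Finset.mul_sum (s := S)] at h
  refine h.trans_eq (Finset.sum_congr rfl fun x hx => Finset.sum_congr rfl fun y hy => ?_)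
  have hz : inner ℝ z z = 1 := by rw [real_inner_self_eq_norm_sq, hz, one_pow]
  have key : ∑ i, φ x i * φ y i = d x * d y * (inner ℝ (v x) (v y) ^ 2
      - inner ℝ (v x) (v x) / 3 * (inner ℝ (v y) (v y) - inner ℝ (v y) z ^ 2)
      - inner ℝ (v y) (v y) / 3 * (inner ℝ (v x) (v x) - inner ℝ (v x) z ^ 2)
      + inner ℝ (v x) (v x) * inner ℝ (v y) (v y) / 9
        * (4 - 2 * inner ℝ z z + inner ℝ z z ^ 2)) := by
    simp only [φ, inner_eq_coords]
    simp [Fintype.sum_prod_type, Fin.sum_univ_four]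
    ring
  rw [key, hv x hx, hv y hy, hz, ← real_inner_self_eq_norm_sq, ← real_inner_self_eq_norm_sq]
  ring

/-- The kernel on the cap is nonpositive on pairs of points at angle at least `π / 3`; here `τ` is
the inner product of the components orthogonal to the axis. -/
lemma capKernel_le_zero {s s' τ : ℝ} (h₁ : 14 / 25 ≤ s) (h₂ : s ≤ 1) (h₁' : 14 / 25 ≤ s')
    (h₂' : s' ≤ 1) (hτ : τ ≤ 1 / 2 - s * s') (hτ' : -((1 - s ^ 2) + (1 - s' ^ 2)) / 2 ≤ τ) :
    capConst s * capConst s' + capLin s * capLin s' * τ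
      + capQuad s * capQuad s' * ((3 * τ ^ 2 - (1 - s ^ 2) * (1 - s' ^ 2)) / 2) ≤ 0 := by
  have hd := capQuad_nonneg h₂
  have hd' := capQuad_nonneg h₂'
  have hdd : 0 ≤ capQuad s * capQuad s' := mul_nonneg hd hd'
  have hb : 7 / 8 * capQuad s * (7 / 8 * capQuad s') ≤ capLin s * capLin s' :=
    mul_le_mul (capQuad_le_capLin h₁) (capQuad_le_capLin h₁') (by positivity)
      ((by positivity : 0 ≤ 7 / 8 * capQuad s).trans (capQuad_le_capLin h₁))
  have hsum : -1 / 2 ≤ τ + (1 / 2 - s * s') := by nlinarith [sq_nonneg (s - s')]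
  have hslope : 0 ≤ capLin s * capLin s'
      + 3 / 2 * (capQuad s * capQuad s') * (τ + (1 / 2 - s * s')) := by
    nlinarith [mul_le_mul_of_nonneg_left hsum hdd]
  linarith [mul_nonneg (sub_nonneg.2 hτ) hslope, capKernel_nonpos h₁ h₂ h₁' h₂']

/-- The bound for the points in the cap around `-z`. -/
lemma sum_lpPoly_cap_le {S : Finset E₄} {z : E₄} (hz : ‖z‖ = 1) (hS : ∀ x ∈ S, ‖x‖ = 1)
    (hSz : ∀ x ∈ S, inner ℝ x z ≤ -(14 / 25))
    (hSS : ∀ x ∈ S, ∀ y ∈ S, x ≠ y → inner ℝ x y ≤ 1 / 2) :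
    ∑ x ∈ S, lpPoly (inner ℝ x z) ≤ (258 / 100) ^ 2 := by
  let s (x : E₄) : ℝ := -inner ℝ x z
  let v (x : E₄) : E₄ := x + s x • z
  have hzz : inner ℝ z z = 1 := by rw [real_inner_self_eq_norm_sq, hz, one_pow]
  have hv (x : E₄) : inner ℝ (v x) z = 0 := by
    simp [v, s, inner_add_left, inner_smul_left, hz]
  have hvv (x y : E₄) : inner ℝ (v x) (v y) = inner ℝ x y - s x * s y := by
    simp only [v, s, inner_add_left, inner_add_right, inner_smul_left, inner_smul_right, hzz,
      real_inner_comm y z]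
    simp
    ring
  have hnorm {x : E₄} (hx : x ∈ S) : ‖v x‖ ^ 2 = 1 - s x ^ 2 := by
    rw [← real_inner_self_eq_norm_sq, hvv, real_inner_self_eq_norm_sq, hS x hx]
    ring
  have hs₁ {x : E₄} (hx : x ∈ S) : 14 / 25 ≤ s x := by linarith [hSz x hx]
  have hs₂ {x : E₄} (hx : x ∈ S) : s x ≤ 1 := by
    have := hnorm hx
    nlinarith [sq_nonneg ‖v x‖]
  have hoff {x y : E₄} (hx : x ∈ S) (hy : y ∈ S) (hxy : x ≠ y) :
      capConst (s x) * capConst (s y) + capLin (s x) * capLin (s y) * inner ℝ (v x) (v y)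
        + capQuad (s x) * capQuad (s y) *
          ((3 * inner ℝ (v x) (v y) ^ 2 - ‖v x‖ ^ 2 * ‖v y‖ ^ 2) / 2) ≤ 0 := by
    rw [hnorm hx, hnorm hy]
    refine capKernel_le_zero (hs₁ hx) (hs₂ hx) (hs₁ hy) (hs₂ hy) ?_ ?_
    · linarith [hvv x y, hSS x hx y hy hxy]
    · have := norm_add_sq_real (v x) (v y)
      rw [hnorm hx, hnorm hy] at this
      linarith [sq_nonneg ‖v x + v y‖]
  have hdiag : ∑ x ∈ S, ∑ y ∈ S, (capConst (s x) * capConst (s y)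
      + capLin (s x) * capLin (s y) * inner ℝ (v x) (v y)
      + capQuad (s x) * capQuad (s y) *
          ((3 * inner ℝ (v x) (v y) ^ 2 - ‖v x‖ ^ 2 * ‖v y‖ ^ 2) / 2)) ≤
      ∑ x ∈ S, (capConst (s x) ^ 2 + capLin (s x) ^ 2 * (1 - s x ^ 2)
        + capQuad (s x) ^ 2 * (1 - s x ^ 2) ^ 2) := by
    refine Finset.sum_le_sum fun x hx => ?_
    rw [← Finset.add_sum_erase _ _ hx, real_inner_self_eq_norm_sq, hnorm hx]
    have := Finset.sum_nonpos fun y (hy : y ∈ S.erase x) =>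
      hoff hx (Finset.mem_of_mem_erase hy) (Finset.ne_of_mem_erase hy).symm
    rw [hnorm hx] at this
    linarith
  have hlin : 0 ≤ ∑ x ∈ S, ∑ y ∈ S, capLin (s x) * capLin (s y) * inner ℝ (v x) (v y) := by
    refine (real_inner_self_nonneg (x := ∑ x ∈ S, capLin (s x) • v x)).trans_eq ?_
    simp only [sum_inner, inner_sum, inner_smul_left, inner_smul_right, conj_trivial, mul_assoc,
      Finset.mul_sum, real_inner_comm]
  have hquad := sum_sum_quadratic_nonneg S (fun x => capQuad (s x)) v hz fun x _ => hv x
  have hconst : ∑ x ∈ S, ∑ y ∈ S, capConst (s x) * capConst (s y) =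
      (∑ x ∈ S, capConst (s x)) ^ 2 := by rw [sq, Finset.sum_mul_sum]
  have hpoint : ∑ x ∈ S, lpPoly (inner ℝ x z) ≤ ∑ x ∈ S, (2 * (258 / 100) * capConst (s x)
      - (capConst (s x) ^ 2 + capLin (s x) ^ 2 * (1 - s x ^ 2)
        + capQuad (s x) ^ 2 * (1 - s x ^ 2) ^ 2)) := by
    refine Finset.sum_le_sum fun x hx => ?_
    simpa [s] using lpPoly_neg_le (hs₁ hx) (hs₂ hx)
  rw [Finset.sum_sub_distrib, ← Finset.mul_sum] at hpoint
  simp only [Finset.sum_add_distrib, hconst] at hdiag hpoint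
  nlinarith [sq_nonneg (258 / 100 - ∑ x ∈ S, capConst (s x))]

/-- The local bound: the sum of `lpPoly` over the neighbours of a point `z`. -/
lemma sum_lpPoly_le {S : Finset E₄} {z : E₄} (hz : ‖z‖ = 1) (hS : ∀ x ∈ S, ‖x‖ = 1)
    (hSz : ∀ x ∈ S, inner ℝ x z ≤ 1 / 2)
    (hSS : ∀ x ∈ S, ∀ y ∈ S, x ≠ y → inner ℝ x y ≤ 1 / 2) :
    ∑ x ∈ S, lpPoly (inner ℝ x z) ≤ (258 / 100) ^ 2 := by
  classical
  rw [← Finset.sum_filter_add_sum_filter_not S fun x => inner ℝ x z ≤ -(14 / 25)]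
  have hcap := sum_lpPoly_cap_le (S := S.filter fun x => inner ℝ x z ≤ -(14 / 25)) hz
    (fun x hx => hS x (Finset.mem_filter.1 hx).1) (fun x hx => (Finset.mem_filter.1 hx).2)
    (fun x hx y hy => hSS x (Finset.mem_filter.1 hx).1 y (Finset.mem_filter.1 hy).1)
  have hrest := Finset.sum_nonpos (s := S.filter fun x => ¬ inner ℝ x z ≤ -(14 / 25))
    (f := fun x => lpPoly (inner ℝ x z)) fun x hx => by
      rw [Finset.mem_filter, not_le] at hx
      exact lpPoly_nonpos hx.2.le (hSz x hx.1)
  linarith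

/-- At most 24 unit vectors of `ℝ⁴` have pairwise angles at least `π / 3`. -/
theorem card_le_of_inner_le {S : Finset E₄} (hS : ∀ x ∈ S, ‖x‖ = 1)
    (hSS : ∀ x ∈ S, ∀ y ∈ S, x ≠ y → inner ℝ x y ≤ 1 / 2) : S.card ≤ 24 := by
  have hlow : (S.card : ℝ) * S.card ≤ ∑ x ∈ S, ∑ y ∈ S, lpPoly (inner ℝ x y) := by
    simp only [lpPoly, Finset.sum_add_distrib, ← Finset.mul_sum, Finset.sum_const, nsmul_eq_mul,
      mul_one]
    have h {k : ℕ} (hk : k ≤ 9) := sum_sum_zonal_nonneg S hS hk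
    linarith [h (k := 1) (by norm_num), h (k := 2) (by norm_num), h (k := 3) (by norm_num),
      h (k := 4) (by norm_num), h (k := 9) (by norm_num)]
  have hupp : ∑ x ∈ S, ∑ y ∈ S, lpPoly (inner ℝ x y) ≤ ∑ x ∈ S, 24.99 := by
    rw [Finset.sum_comm]
    refine Finset.sum_le_sum fun z hz => ?_
    have hloc := sum_lpPoly_le (S := S.erase z) (hS z hz)
      (fun x hx => hS x (Finset.mem_of_mem_erase hx))
      (fun x hx => hSS x (Finset.mem_of_mem_erase hx) z hz (Finset.ne_of_mem_erase hx))
      (fun x hx y hy => hSS x (Finset.mem_of_mem_erase hx) y (Finset.mem_of_mem_erase hy))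
    rw [← Finset.add_sum_erase _ _ hz, real_inner_self_eq_norm_sq, hS z hz, lpPoly_eq]
    linarith
  rw [Finset.sum_const, nsmul_eq_mul] at hupp
  by_contra! hcard
  have : (25 : ℝ) ≤ S.card := by exact_mod_cast hcard
  nlinarith

/-- The 24 minimal vectors of (a scaled copy of) the lattice `D₄`. -/
def minVectors : Finset (Fin 4 → ℤ) :=
  (Fintype.piFinset fun _ => {-2, -1, 0, 1, 2}).filter fun n =>
    (∑ i, n i ^ 2 = 4) ∧ ∀ i, n i % 2 = n 0 % 2

lemma card_minVectors : minVectors.card = 24 := by decide +kernel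

lemma sum_sq_sub_ge_of_mem_minVectors :
    ∀ m ∈ minVectors, ∀ n ∈ minVectors, m ≠ n → 4 ≤ ∑ i, (m i - n i) ^ 2 := by
  decide +kernel

end Kissing

theorem kissingNumber_dim4 :
    (∀ S : Finset (EuclideanSpace ℝ (Fin 4)),
      (∀ x ∈ S, ‖x‖ = 2) →
      (∀ x ∈ S, ∀ y ∈ S, x ≠ y → 2 ≤ dist x y) →
      S.card ≤ 24) ∧
    ∃ S : Finset (EuclideanSpace ℝ (Fin 4)),
      (∀ x ∈ S, ‖x‖ = 2) ∧
      (∀ x ∈ S, ∀ y ∈ S, x ≠ y → 2 ≤ dist x y) ∧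
      S.card = 24 := by
  classical
  constructor
  · intro S hS hSS
    have hinj : Function.Injective fun x : EuclideanSpace ℝ (Fin 4) => (1 / 2 : ℝ) • x :=
      smul_right_injective _ (by norm_num)
    rw [← Finset.card_image_of_injective S hinj]
    refine Kissing.card_le_of_inner_le ?_ ?_
    · simp only [Finset.forall_mem_image]
      intro x hx
      rw [norm_smul, hS x hx]
      norm_num
    · simp only [Finset.forall_mem_image]
      intro x hx y hy hxy
      have h := hSS x hx y hy fun h => hxy (by rw [h])
      rw [dist_eq_norm] at h
      have := norm_sub_sq_real x y
      rw [hS x hx, hS y hy] at this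
      rw [inner_smul_left, inner_smul_right]
      simp only [map_div₀, map_one, map_ofNat]
      nlinarith
  · let f (n : Fin 4 → ℤ) : EuclideanSpace ℝ (Fin 4) := WithLp.toLp 2 fun i => (n i : ℝ)
    have hf : Function.Injective f := fun m n h => by
      ext i
      have : (m i : ℝ) = n i := congrArg (fun x => x i) h
      exact_mod_cast this
    refine ⟨Kissing.minVectors.image f, ?_, ?_, ?_⟩
    · simp only [Finset.forall_mem_image]
      intro n hn
      have : ∑ i, (n i : ℝ) ^ 2 = 4 := by exact_mod_cast (Finset.mem_filter.1 hn).2.1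
      rw [EuclideanSpace.norm_eq, Real.sqrt_eq_iff_mul_self_eq (by positivity) (by norm_num)]
      simp only [f, Real.norm_eq_abs, sq_abs]
      linarith
    · simp only [Finset.forall_mem_image]
      intro m hm n hn hmn
      have h := Kissing.sum_sq_sub_ge_of_mem_minVectors m hm n hn fun h => hmn (by rw [h])
      have : (4 : ℝ) ≤ ∑ i, ((m i : ℝ) - n i) ^ 2 := by exact_mod_cast h
      rw [EuclideanSpace.dist_eq]
      apply Real.le_sqrt_of_sq_le
      simp only [f, Real.dist_eq, sq_abs]
      linarith
    · rw [Finset.card_image_of_injective _ hf, Kissing.card_minVectors]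
end

section
/- The kissing number in dimension 8 is 240: for every finite set S of points in Euclidean 8-space ℝ⁸ such that every point of S has norm 2 and any two distinct points of S are at distance at least 2 from each other, the cardinality of S is at most 240; moreover, there exists such a set S with exactly 240 points (as realized by the minimal vectors of the E₈ lattice). -/
open MvPolynomial

section Fischer

variable {σ : Type*} [Fintype σ]

/-- The Fischer (apolar) pairing of real polynomials: monomials are orthogonal, and the monomial
with exponent `α` has squared length `∏ i, (α i)!`. -/
noncomputable def fischer : MvPolynomial σ ℝ →ₗ[ℝ] MvPolynomial σ ℝ →ₗ[ℝ] ℝ :=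
  (basisMonomials σ ℝ).constr ℝ fun α => (∏ i, ((α i).factorial : ℝ)) • lcoeff ℝ α

lemma fischer_monomial (α : σ →₀ ℕ) (a : ℝ) (q : MvPolynomial σ ℝ) :
    fischer (monomial α a) q = a * ((∏ i, ((α i).factorial : ℝ)) * coeff α q) := by
  have h : monomial α a = a • basisMonomials σ ℝ α := by simp [smul_monomial]
  rw [h, map_smul, fischer, Module.Basis.constr_basis]
  simp

lemma fischer_self_nonneg (p : MvPolynomial σ ℝ) : 0 ≤ fischer p p := by
  have h : fischer p p = ∑ α ∈ p.support, fischer (monomial α (coeff α p)) p := by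
    conv_lhs => enter [1]; rw [p.as_sum]
    simp only [map_sum, LinearMap.sum_apply]
  rw [h]
  refine Finset.sum_nonneg fun α _ => ?_
  rw [fischer_monomial, mul_left_comm]
  exact mul_nonneg (Finset.prod_nonneg fun _ _ => by positivity) (mul_self_nonneg _)

lemma fischer_X_mul (i : σ) (p q : MvPolynomial σ ℝ) :
    fischer (X i * p) q = fischer p (pderiv i q) := by
  classical
  induction p using MvPolynomial.induction_on' with
  | add p₁ p₂ h₁ h₂ => simp only [mul_add, map_add, LinearMap.add_apply, h₁, h₂]
  | monomial α a =>
    have h : X i * monomial α a = monomial (α + Finsupp.single i 1) a := by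
      rw [X, monomial_mul, one_mul, add_comm]
    have hw : ∏ j, (((α + Finsupp.single i 1 : σ →₀ ℕ) j).factorial : ℝ)
        = (α i + 1) * ∏ j, ((α j).factorial : ℝ) := by
      rw [← Finset.mul_prod_erase Finset.univ
          (fun j => (((α + Finsupp.single i 1 : σ →₀ ℕ) j).factorial : ℝ)) (Finset.mem_univ i),
        ← Finset.mul_prod_erase Finset.univ (fun j => ((α j).factorial : ℝ)) (Finset.mem_univ i),
        ← mul_assoc]
      congr 1
      · simp [Nat.factorial_succ]
      · refine Finset.prod_congr rfl fun j hj => ?_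
        simp [Finsupp.single_eq_of_ne (Finset.ne_of_mem_erase hj)]
    rw [h, fischer_monomial, fischer_monomial, hw, coeff_pderiv]
    ring

/-- The linear form `∑ i, x i * X i`. -/
noncomputable def linForm (x : σ → ℝ) : MvPolynomial σ ℝ := ∑ i, C (x i) * X i

variable (σ) in
/-- The quadratic form `∑ i, X i ^ 2`. -/
noncomputable def normSqForm : MvPolynomial σ ℝ := ∑ i, X i ^ 2

/-- The Laplacian on polynomials. -/
noncomputable def laplacian (p : MvPolynomial σ ℝ) : MvPolynomial σ ℝ :=
  ∑ i, pderiv i (pderiv i p)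

lemma fischer_normSqForm_mul (p q : MvPolynomial σ ℝ) :
    fischer (normSqForm σ * p) q = fischer p (laplacian q) := by
  simp only [normSqForm, laplacian, Finset.sum_mul, map_sum, LinearMap.sum_apply, pow_two,
    mul_assoc, fischer_X_mul]

lemma fischer_linForm_mul (x : σ → ℝ) (p q : MvPolynomial σ ℝ) :
    fischer (linForm x * p) q = fischer p (∑ i, C (x i) * pderiv i q) := by
  simp only [linForm, Finset.sum_mul, map_sum, LinearMap.sum_apply, C_mul', map_smul,
    LinearMap.smul_apply, fischer_X_mul, smul_mul_assoc]

lemma linForm_isHomogeneous (x : σ → ℝ) : (linForm x).IsHomogeneous 1 :=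
  IsHomogeneous.sum _ _ _ fun i _ => (isHomogeneous_X ℝ i).C_mul (x i)

lemma normSqForm_isHomogeneous : (normSqForm σ).IsHomogeneous 2 :=
  IsHomogeneous.sum _ _ _ fun i _ => isHomogeneous_X_pow i 2

/-- Powers of linear forms are reproducing for the Fischer pairing. -/
lemma fischer_linForm_pow (x : σ → ℝ) {k : ℕ} {q : MvPolynomial σ ℝ} (hq : q.IsHomogeneous k) :
    fischer (linForm x ^ k) q = k.factorial * eval x q := by
  induction k generalizing q with
  | zero =>
    obtain ⟨c, rfl⟩ : ∃ c, q = C c := ⟨_, totalDegree_eq_zero_iff_eq_C.mp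
      (Nat.le_zero.mp hq.totalDegree_le)⟩
    rw [pow_zero, ← C_1, C_apply, fischer_monomial]
    simp
  | succ k ih =>
    have hD : (∑ i, C (x i) * pderiv i q).IsHomogeneous k :=
      IsHomogeneous.sum _ _ _ fun i _ => by simpa using (hq.pderiv (i := i)).C_mul (x i)
    have euler := congrArg (eval x) hq.sum_X_mul_pderiv
    simp only [map_sum, map_mul, eval_X, nsmul_eq_mul, map_natCast] at euler
    rw [pow_succ', fischer_linForm_mul, ih hD, Nat.factorial_succ]
    simp only [map_sum, map_mul, eval_C, euler]
    push_cast
    ring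

lemma pderiv_linForm (x : σ → ℝ) (i : σ) : pderiv i (linForm x) = C (x i) := by
  classical
  simp [linForm, pderiv_X, Pi.single_apply]

lemma pderiv_normSqForm (i : σ) : pderiv i (normSqForm σ) = 2 * X i := by
  classical
  simp [normSqForm, pderiv_X, Pi.single_apply]

lemma laplacian_normSqForm_pow_mul_linForm_pow {x : σ → ℝ} (hx : ∑ i, x i ^ 2 = 1) (j m : ℕ) :
    laplacian (normSqForm σ ^ j * linForm x ^ m) =
      C (2 * (j : ℝ) * (Fintype.card σ + 2 * (j - 1) + 2 * m)) *
          (normSqForm σ ^ (j - 1) * linForm x ^ m) +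
        C ((m : ℝ) * (m - 1)) * (normSqForm σ ^ j * linForm x ^ (m - 2)) := by
  set Q := normSqForm σ with hQ
  set L := linForm x with hL
  have key : ∀ i, pderiv i (pderiv i (Q ^ j * L ^ m)) =
      C (2 * (j : ℝ)) * (Q ^ (j - 1) * L ^ m) +
      C (4 * (j : ℝ) * (j - 1)) * (Q ^ (j - 1 - 1) * L ^ m) * X i ^ 2 +
      C (4 * (j : ℝ) * m) * (Q ^ (j - 1) * L ^ (m - 1)) * (C (x i) * X i) +
      C (m * (m - 1) : ℝ) * (Q ^ j * L ^ (m - 2)) * C (x i ^ 2) := by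
    intro i
    have hj : (j : MvPolynomial σ ℝ) * ((j - 1 : ℕ) : MvPolynomial σ ℝ) = j * (j - 1) := by
      cases j <;> simp
    have hm : (m : MvPolynomial σ ℝ) * ((m - 1 : ℕ) : MvPolynomial σ ℝ) = m * (m - 1) := by
      cases m <;> simp
    have h2 : pderiv i (2 : MvPolynomial σ ℝ) = 0 := (pderiv i).map_natCast 2
    have hn : ∀ n : ℕ, pderiv i (n : MvPolynomial σ ℝ) = 0 := (pderiv i).map_natCast
    simp only [pderiv_mul, pderiv_pow, hQ, hL, pderiv_linForm, pderiv_normSqForm, map_add,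
      pderiv_C, pderiv_X_self, h2, hn]
    simp only [map_mul, map_sub, map_natCast, map_ofNat, map_one, map_pow, Nat.sub_sub,
      one_add_one_eq_two]
    linear_combination (4 * normSqForm σ ^ (j - 2) * linForm x ^ m * (X i : MvPolynomial σ ℝ) ^ 2) * hj
      + (normSqForm σ ^ j * linForm x ^ (m - 2) * (C (x i) : MvPolynomial σ ℝ) ^ 2) * hm
  have hQj : C (4 * (j : ℝ) * (j - 1)) * (Q ^ (j - 1 - 1) * L ^ m) * Q =
      C (4 * (j : ℝ) * (j - 1)) * (Q ^ (j - 1) * L ^ m) := by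
    rcases j with _ | _ | j
    · simp
    · simp
    · simp only [Nat.add_sub_cancel, pow_succ]; ring
  have hLm : C (4 * (j : ℝ) * m) * (Q ^ (j - 1) * L ^ (m - 1)) * L =
      C (4 * (j : ℝ) * m) * (Q ^ (j - 1) * L ^ m) := by
    rcases m with _ | m
    · simp
    · simp only [Nat.add_sub_cancel, pow_succ]; ring
  have hX : ∑ i, (X i : MvPolynomial σ ℝ) ^ 2 = Q := rfl
  have hxX : ∑ i, (C (x i) * X i : MvPolynomial σ ℝ) = L := rfl
  rw [laplacian, Finset.sum_congr rfl fun i _ => key i]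
  simp only [Finset.sum_add_distrib, ← Finset.mul_sum, hX, hxX, hQj, hLm, ← map_sum, hx,
    Finset.sum_const, Finset.card_univ, nsmul_eq_mul]
  simp only [map_mul, map_sub, map_add, map_natCast, map_ofNat, map_one]
  ring

end Fischer

/-- The coefficients of the monic Gegenbauer polynomial of degree `k` in dimension `n`: the
coefficient of `t ^ (k - 2 * j)`. -/
noncomputable def gegenbauerCoeff (n k : ℕ) : ℕ → ℝ
  | 0 => 1
  | j + 1 => -gegenbauerCoeff n k j * ((k - 2 * j) * (k - 2 * j - 1)) /
      (2 * (j + 1) * (n + 2 * (k - j - 2)))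

/-- The monic Gegenbauer polynomial of degree `k` in dimension `n`. -/
noncomputable def gegenbauer (n k : ℕ) (t : ℝ) : ℝ :=
  ∑ j ∈ Finset.range (k / 2 + 1), gegenbauerCoeff n k j * t ^ (k - 2 * j)

section Zonal

variable {σ : Type*} [Fintype σ]

/-- The zonal harmonic polynomial of degree `k` with axis `x`. -/
noncomputable def zonal (k : ℕ) (x : σ → ℝ) : MvPolynomial σ ℝ :=
  ∑ j ∈ Finset.range (k / 2 + 1),
    C (gegenbauerCoeff (Fintype.card σ) k j) * (normSqForm σ ^ j * linForm x ^ (k - 2 * j))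

lemma zonal_isHomogeneous (k : ℕ) (x : σ → ℝ) : (zonal k x).IsHomogeneous k := by
  refine IsHomogeneous.sum _ _ _ fun j hj => IsHomogeneous.C_mul ?_ _
  have h := (normSqForm_isHomogeneous (σ := σ).pow j).mul
    ((linForm_isHomogeneous x).pow (k - 2 * j))
  have hk : 2 * j + 1 * (k - 2 * j) = k := by have := Finset.mem_range.mp hj; omega
  rwa [hk] at h

lemma laplacian_zonal [Nonempty σ] (k : ℕ) {x : σ → ℝ} (hx : ∑ i, x i ^ 2 = 1) :
    laplacian (zonal k x) = 0 := by
  set n := Fintype.card σ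
  have hn : (1 : ℝ) ≤ n := by exact_mod_cast Fintype.card_pos (α := σ)
  let T : ℕ → MvPolynomial σ ℝ := fun j =>
    C (gegenbauerCoeff n k j * (2 * j * (n + 2 * (k - j - 1)))) *
      (normSqForm σ ^ (j - 1) * linForm x ^ (k - 2 * j))
  have hT : ∀ j ∈ Finset.range (k / 2 + 1),
      laplacian (C (gegenbauerCoeff n k j) * (normSqForm σ ^ j * linForm x ^ (k - 2 * j)))
        = T j - T (j + 1) := by
    intro j hj
    have hjk : 2 * j ≤ k := by have := Finset.mem_range.mp hj; omega
    have hrec : gegenbauerCoeff n k (j + 1) *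
        (2 * (j + 1 : ℕ) * (n + 2 * (k - (j + 1 : ℕ) - 1))) =
        -(gegenbauerCoeff n k j * ((k - 2 * j) * (k - 2 * j - 1))) := by
      rw [gegenbauerCoeff]
      rcases Nat.lt_or_ge k (2 * j + 2) with h | h
      · have h0 : ((k : ℝ) - 2 * j) * (k - 2 * j - 1) = 0 := by
          obtain rfl | rfl : k = 2 * j ∨ k = 2 * j + 1 := by omega
          · push_cast; ring
          · push_cast; ring
        simp [h0]
      · have h' : (2 : ℝ) * j + 2 ≤ k := by exact_mod_cast h
        have hj0 : (0 : ℝ) ≤ j := j.cast_nonneg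
        have h1 : (n : ℝ) + 2 * (k - j - 2) ≠ 0 := by nlinarith
        have h2 : (j : ℝ) + 1 ≠ 0 := by positivity
        push_cast
        rw [show (k : ℝ) - (j + 1) - 1 = k - j - 2 by ring]
        field_simp
    have hlap : laplacian (C (gegenbauerCoeff n k j) *
        (normSqForm σ ^ j * linForm x ^ (k - 2 * j))) =
        C (gegenbauerCoeff n k j) *
          laplacian (normSqForm σ ^ j * linForm x ^ (k - 2 * j)) := by
      simp only [laplacian, pderiv_C_mul, Finset.mul_sum]
    simp only [T]
    rw [hlap, laplacian_normSqForm_pow_mul_linForm_pow hx, hrec, Nat.add_sub_cancel,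
      show k - 2 * (j + 1) = k - 2 * j - 2 by omega, Nat.cast_sub hjk]
    simp only [map_mul, map_sub, map_add, map_neg, map_natCast, map_ofNat, map_one, Nat.cast_mul,
      Nat.cast_ofNat]
    ring
  have hsum : laplacian (zonal k x) = ∑ j ∈ Finset.range (k / 2 + 1),
      laplacian (C (gegenbauerCoeff n k j) *
        (normSqForm σ ^ j * linForm x ^ (k - 2 * j))) := by
    simp only [laplacian, zonal, map_sum]
    exact Finset.sum_comm
  rw [hsum, Finset.sum_congr rfl hT, Finset.sum_range_sub']
  have hlast : gegenbauerCoeff n k (k / 2 + 1) = 0 := by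
    rw [gegenbauerCoeff]
    have h0 : ((k : ℝ) - 2 * (k / 2 : ℕ)) * (k - 2 * (k / 2 : ℕ) - 1) = 0 := by
      obtain h | h : k = 2 * (k / 2) ∨ k = 2 * (k / 2) + 1 := by omega
      · have h' : (k : ℝ) = 2 * (k / 2 : ℕ) := by exact_mod_cast h
        rw [← h']; ring
      · have h' : (k : ℝ) = 2 * (k / 2 : ℕ) + 1 := by exact_mod_cast h
        rw [sub_sub, ← h']; ring
    simp [h0]
  simp [T, hlast]

lemma eval_zonal (k : ℕ) {x : σ → ℝ} (hx : ∑ i, x i ^ 2 = 1) (y : σ → ℝ) :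
    eval x (zonal k y) = gegenbauer (Fintype.card σ) k (∑ i, y i * x i) := by
  simp [zonal, gegenbauer, normSqForm, linForm, hx]

lemma fischer_zonal [Nonempty σ] (k : ℕ) {x y : σ → ℝ} (hx : ∑ i, x i ^ 2 = 1)
    (hy : ∑ i, y i ^ 2 = 1) : fischer (zonal k x) (zonal k y) =
      k.factorial * gegenbauer (Fintype.card σ) k (∑ i, y i * x i) := by
  rw [zonal, Finset.sum_range_succ', map_add, map_sum, LinearMap.add_apply, LinearMap.sum_apply,
    Finset.sum_eq_zero, zero_add]
  · simp only [gegenbauerCoeff, C_1, pow_zero, one_mul, mul_zero, Nat.sub_zero]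
    rw [fischer_linForm_pow x (zonal_isHomogeneous k y), eval_zonal k hx]
  · intro j _
    rw [pow_succ', mul_assoc, mul_left_comm, fischer_normSqForm_mul, laplacian_zonal k hy, map_zero]

/-- Gegenbauer polynomials are positive definite on the sphere. -/
theorem sum_gegenbauer_nonneg [Nonempty σ] {ι : Type*} (s : Finset ι) (v : ι → σ → ℝ)
    (hv : ∀ a ∈ s, ∑ i, v a i ^ 2 = 1) (k : ℕ) :
    0 ≤ ∑ a ∈ s, ∑ b ∈ s, gegenbauer (Fintype.card σ) k (∑ i, v a i * v b i) := by
  have h := fischer_self_nonneg (∑ a ∈ s, zonal k (v a))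
  have hk : (0 : ℝ) < k.factorial := by positivity
  refine nonneg_of_mul_nonneg_right (h.trans_eq ?_) hk
  simp only [map_sum, LinearMap.sum_apply, Finset.mul_sum]
  exact Finset.sum_congr rfl fun a ha => Finset.sum_congr rfl fun b hb =>
    fischer_zonal k (hv b hb) (hv a ha)

end Zonal

theorem card_le_of_kissing_dim8 (S : Finset (EuclideanSpace ℝ (Fin 8)))
    (hS : ∀ x ∈ S, ‖x‖ = 2) (hd : ∀ x ∈ S, ∀ y ∈ S, x ≠ y → 2 ≤ dist x y) : S.card ≤ 240 := by
  set v : EuclideanSpace ℝ (Fin 8) → Fin 8 → ℝ := fun x i => x i / 2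
  set t : EuclideanSpace ℝ (Fin 8) → EuclideanSpace ℝ (Fin 8) → ℝ :=
    fun x y => ∑ i, v x i * v y i with ht
  have ht_inner : ∀ x y, t x y = inner ℝ x y / 4 := by
    intro x y
    rw [ht, PiLp.inner_apply, Finset.sum_div]
    exact Finset.sum_congr rfl fun i _ => by simp [v]; ring
  have hself : ∀ x ∈ S, t x x = 1 := fun x hx => by
    rw [ht_inner, real_inner_self_eq_norm_sq, hS x hx]; norm_num
  have hv : ∀ x ∈ S, ∑ i, v x i ^ 2 = 1 := fun x hx => by
    rw [← hself x hx]; simp only [ht, pow_two]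
  set f : ℝ → ℝ := fun u => (u + 1) * (u + 1 / 2) ^ 2 * u ^ 2 * (u - 1 / 2) with hf
  have hexp : ∀ u, f u = gegenbauer 8 6 u + 3 / 2 * gegenbauer 8 5 u + 19 / 16 * gegenbauer 8 4 u
      + 39 / 56 * gegenbauer 8 3 u + 15 / 56 * gegenbauer 8 2 u + 3 / 40 * gegenbauer 8 1 u
      + 3 / 320 := by
    intro u
    norm_num [hf, gegenbauer, Finset.sum_range_succ, gegenbauerCoeff]
    ring
  have hoff : ∀ x ∈ S, ∀ y ∈ S, x ≠ y → f (t x y) ≤ 0 := by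
    intro x hx y hy hxy
    have hlow : -1 ≤ t x y := by
      have h := norm_add_sq_real x y
      rw [hS x hx, hS y hy] at h
      rw [ht_inner]
      nlinarith [sq_nonneg ‖x + y‖]
    have hupp : t x y ≤ 1 / 2 := by
      have h := norm_sub_sq_real x y
      have h2 := hd x hx y hy hxy
      rw [dist_eq_norm] at h2
      rw [hS x hx, hS y hy] at h
      rw [ht_inner]
      nlinarith
    refine mul_nonpos_of_nonneg_of_nonpos ?_ (by linarith)
    have : 0 ≤ t x y + 1 := by linarith
    positivity
  have hupper : ∑ x ∈ S, ∑ y ∈ S, f (t x y) ≤ ∑ x ∈ S, (9 / 4 : ℝ) := by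
    refine Finset.sum_le_sum fun x hx => ?_
    rw [← Finset.add_sum_erase S _ hx, hself x hx]
    have hrest : ∑ y ∈ S.erase x, f (t x y) ≤ 0 := Finset.sum_nonpos fun y hy =>
      hoff x hx y (Finset.mem_of_mem_erase hy) (Finset.ne_of_mem_erase hy).symm
    have h1 : f 1 = 9 / 4 := by norm_num [hf]
    linarith
  have hpos : ∀ k, 0 ≤ ∑ x ∈ S, ∑ y ∈ S, gegenbauer 8 k (t x y) := fun k => by
    simpa using sum_gegenbauer_nonneg S v hv k
  simp only [hexp, Finset.sum_add_distrib, ← Finset.mul_sum, Finset.sum_const,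
    nsmul_eq_mul] at hupper
  have hmain : (S.card : ℝ) * S.card ≤ 240 * S.card := by
    linarith [hpos 1, hpos 2, hpos 3, hpos 4, hpos 5, hpos 6]
  have hnat : S.card * S.card ≤ 240 * S.card := by exact_mod_cast hmain
  rcases Nat.eq_zero_or_pos S.card with h0 | h0
  · omega
  · exact Nat.le_of_mul_le_mul_right hnat h0

section Construction

/-- The `E₈` lattice scaled by `2`: integer vectors whose coordinates all have the same parity and
whose coordinate sum is divisible by `4`. -/
def doubledE8 : AddSubgroup (Fin 8 → ℤ) where
  carrier := {z | (∀ i, 2 ∣ z i - z 0) ∧ 4 ∣ ∑ i, z i}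
  zero_mem' := by simp
  add_mem' := by
    rintro z w ⟨hz, hz'⟩ ⟨hw, hw'⟩
    refine ⟨fun i => ?_, ?_⟩
    · simpa only [Pi.add_apply, add_sub_add_comm] using dvd_add (hz i) (hw i)
    · simpa only [Pi.add_apply, Finset.sum_add_distrib] using dvd_add hz' hw'
  neg_mem' := by
    rintro z ⟨hz, hz'⟩
    refine ⟨fun i => ?_, ?_⟩
    · simpa only [Pi.neg_apply, neg_sub_neg, ← dvd_neg (b := z i - z 0), neg_sub] using hz i
    · simpa only [Pi.neg_apply, Finset.sum_neg_distrib, dvd_neg] using hz'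

lemma eight_dvd_sum_sq_of_mem_doubledE8 {z : Fin 8 → ℤ} (hz : z ∈ doubledE8) :
    8 ∣ ∑ i, z i ^ 2 := by
  obtain ⟨hpar, hsum⟩ := hz
  choose a ha using hpar
  have hz : ∀ i, z i = z 0 + 2 * a i := fun i => by linarith [ha i]
  generalize z 0 = p at hz
  have hlin : ∑ i, z i = 8 * p + 2 * ∑ i, a i := by
    simp [hz, Finset.sum_add_distrib, Finset.mul_sum]
  have hsq : ∑ i, z i ^ 2 =
      8 * p ^ 2 + 4 * p * ∑ i, a i + 4 * (∑ i, a i + ∑ i, a i * (a i - 1)) := by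
    rw [← Finset.sum_add_distrib, Finset.mul_sum, Finset.mul_sum]
    have hconst : 8 * p ^ 2 = ∑ _i : Fin 8, p ^ 2 := by simp
    rw [hconst, ← Finset.sum_add_distrib, ← Finset.sum_add_distrib]
    exact Finset.sum_congr rfl fun i _ => by rw [hz]; ring
  have hprod : 2 ∣ ∑ i, a i * (a i - 1) :=
    Finset.dvd_sum fun i _ => (Int.even_mul_pred_self (a i)).two_dvd
  obtain ⟨c, hc⟩ : 2 ∣ ∑ i, a i := by rw [hlin] at hsum; omega
  obtain ⟨d, hd⟩ := hprod
  rw [hsq, hc, hd]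
  exact ⟨p ^ 2 + p * c + c + d, by ring⟩

lemma eight_le_sum_sq_of_mem_doubledE8 {z : Fin 8 → ℤ} (hz : z ∈ doubledE8) (hz0 : z ≠ 0) :
    8 ≤ ∑ i, z i ^ 2 := by
  obtain ⟨i, hi⟩ := Function.ne_iff.mp hz0
  exact Int.le_of_dvd (Finset.sum_pos' (fun _ _ => sq_nonneg _)
    ⟨i, Finset.mem_univ i, by have : z i ≠ 0 := hi; positivity⟩)
    (eight_dvd_sum_sq_of_mem_doubledE8 hz)

/-- Index set of the minimal vectors of `E₈`: seven free signs for a vector with all coordinates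
odd, or two positions and two signs for a vector with two nonzero coordinates. -/
abbrev E8RootIndex : Type :=
  (Fin 7 → ℤˣ) ⊕ {p : Fin 8 × Fin 8 // p.1 < p.2} × ℤˣ × ℤˣ

/-- The minimal vectors of the doubled `E₈` lattice. -/
def doubledE8Root : E8RootIndex → Fin 8 → ℤ
  | .inl ε => Matrix.vecCons (∏ i, (ε i : ℤ)) fun i => (ε i : ℤ)
  | .inr ⟨p, a, b⟩ => Pi.single p.1.1 (2 * (a : ℤ)) + Pi.single p.1.2 (2 * (b : ℤ))

lemma units_sq_eq_one (u : ℤˣ) : (u : ℤ) ^ 2 = 1 := by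
  rcases Int.units_eq_one_or u with rfl | rfl <;> rfl

lemma doubledE8Root_mem (r : E8RootIndex) : doubledE8Root r ∈ doubledE8 := by
  rcases r with ε | ⟨⟨⟨i, j⟩, hij⟩, a, b⟩
  · have hodd : ∀ i, Odd (doubledE8Root (.inl ε) i) := by
      have h1 : ∀ u : ℤˣ, Odd (u : ℤ) := by decide
      refine Fin.cases ?_ fun i => ?_
      · simpa [doubledE8Root] using h1 (∏ i, ε i)
      · simpa [doubledE8Root] using h1 (ε i)
    refine ⟨fun i => ((hodd i).sub_odd (hodd 0)).two_dvd, ?_⟩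
    revert ε
    decide +kernel
  · have heven : ∀ k, 2 ∣ doubledE8Root (.inr ⟨⟨⟨i, j⟩, hij⟩, a, b⟩) k := by
      intro k
      simp only [doubledE8Root, Pi.add_apply, Pi.single_apply]
      split_ifs <;> omega
    refine ⟨fun k => dvd_sub (heven k) (heven 0), ?_⟩
    simp only [doubledE8Root, Pi.add_apply, Finset.sum_add_distrib, Finset.sum_pi_single',
      Finset.mem_univ, if_true]
    rcases Int.units_eq_one_or a with rfl | rfl <;>
      rcases Int.units_eq_one_or b with rfl | rfl <;> decide

lemma sum_sq_doubledE8Root (r : E8RootIndex) : ∑ i, doubledE8Root r i ^ 2 = 8 := by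
  rcases r with ε | ⟨⟨⟨i, j⟩, hij⟩, a, b⟩
  · have h := units_sq_eq_one (∏ i, ε i)
    rw [Units.coe_prod] at h
    simp [doubledE8Root, Fin.sum_univ_succ (n := 7), h, units_sq_eq_one]
  · have h : ∀ k, doubledE8Root (.inr ⟨⟨⟨i, j⟩, hij⟩, a, b⟩) k ^ 2 =
        Pi.single (M := fun _ => ℤ) i 4 k + Pi.single (M := fun _ => ℤ) j 4 k := by
      intro k
      have ha := units_sq_eq_one a
      have hb := units_sq_eq_one b
      simp only [doubledE8Root, Pi.add_apply, Pi.single_apply]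
      split_ifs with h1 h2
      · exact absurd (h1.symm.trans h2) hij.ne
      all_goals linarith
    simp [h, Finset.sum_add_distrib]

lemma doubledE8Root_injective : Function.Injective doubledE8Root := by
  have hodd : ∀ ε p, doubledE8Root (.inl ε) ≠ doubledE8Root (.inr p) := by
    rintro ε ⟨⟨⟨i, j⟩, hij⟩, a, b⟩ h
    have h1 := congrFun h (Fin.succ 0)
    have hε : ∀ u : ℤˣ, Odd (u : ℤ) := by decide
    obtain ⟨c, hc⟩ := hε (ε 0)
    simp only [doubledE8Root, Matrix.cons_val_succ, Pi.add_apply, Pi.single_apply] at h1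
    split_ifs at h1 <;> omega
  rintro (ε | p) (δ | q) h
  · congr 1
    funext i
    exact Units.ext (by simpa [doubledE8Root] using congrFun h i.succ)
  · exact absurd h (hodd ε q)
  · exact absurd h.symm (hodd δ p)
  · obtain ⟨⟨⟨i, j⟩, hij⟩, a, b⟩ := p
    obtain ⟨⟨⟨i', j'⟩, hij'⟩, a', b'⟩ := q
    have hne : ∀ u : ℤˣ, (u : ℤ) ≠ 0 := fun u => u.ne_zero
    have := hne a; have := hne b; have := hne a'; have := hne b'
    have hk : ∀ k, (if k = i then 2 * (a : ℤ) else 0) + (if k = j then 2 * (b : ℤ) else 0) =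
        (if k = i' then 2 * (a' : ℤ) else 0) + (if k = j' then 2 * (b' : ℤ) else 0) := fun k => by
      simpa only [doubledE8Root, Pi.add_apply, Pi.single_apply] using congrFun h k
    have hi := hk i
    have hj := hk j
    have hi' := hk i'
    have hj' := hk j'
    simp only at hij hij'
    have hii : i = i' ∧ j = j' := by grind
    obtain ⟨rfl, rfl⟩ := hii
    have hab : (a : ℤ) = a' ∧ (b : ℤ) = b' := by grind
    obtain ⟨ha, hb⟩ := hab
    rw [Units.ext ha, Units.ext hb]

theorem exists_kissing_dim8 : ∃ S : Finset (EuclideanSpace ℝ (Fin 8)),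
    (∀ x ∈ S, ‖x‖ = 2) ∧ (∀ x ∈ S, ∀ y ∈ S, x ≠ y → 2 ≤ dist x y) ∧ S.card = 240 := by
  let φ : (Fin 8 → ℤ) → EuclideanSpace ℝ (Fin 8) := fun z => WithLp.toLp 2 fun i => z i / √2
  have hφ : ∀ z w, dist (φ z) (φ w) ^ 2 = ((∑ i, (z - w) i ^ 2 : ℤ) : ℝ) / 2 := by
    intro z w
    rw [EuclideanSpace.dist_eq, Real.sq_sqrt (Finset.sum_nonneg fun _ _ => sq_nonneg _)]
    push_cast
    rw [Finset.sum_div]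
    refine Finset.sum_congr rfl fun i _ => ?_
    simp only [φ, Real.dist_eq, sq_abs, ← sub_div, div_pow, Real.sq_sqrt zero_le_two,
      Pi.sub_apply, Int.cast_sub]
  have hsep : ∀ r s, r ≠ s → 2 ≤ dist (φ (doubledE8Root r)) (φ (doubledE8Root s)) := by
    intro r s hrs
    have h8 := eight_le_sum_sq_of_mem_doubledE8
      (doubledE8.sub_mem (doubledE8Root_mem r) (doubledE8Root_mem s))
      (sub_ne_zero.mpr (doubledE8Root_injective.ne hrs))
    have h8' : (8 : ℝ) ≤ ((∑ i, (doubledE8Root r - doubledE8Root s) i ^ 2 : ℤ) : ℝ) := by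
      exact_mod_cast h8
    refine le_of_sq_le_sq ?_ dist_nonneg
    rw [hφ]
    linarith
  have hinj : Function.Injective (φ ∘ doubledE8Root) := by
    intro r s h
    by_contra hrs
    have h2 := hsep r s hrs
    rw [show φ (doubledE8Root r) = φ (doubledE8Root s) from h, dist_self] at h2
    norm_num at h2
  refine ⟨Finset.univ.map ⟨_, hinj⟩, ?_, ?_, ?_⟩
  · simp only [Finset.mem_map, Finset.mem_univ, true_and, Function.Embedding.coeFn_mk,
      Function.comp_apply, forall_exists_index, forall_apply_eq_imp_iff]
    intro r
    have h0 : φ 0 = 0 := by ext; simp [φ]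
    have h := hφ (doubledE8Root r) 0
    rw [h0, dist_zero_right, sub_zero, sum_sq_doubledE8Root] at h
    have h4 : ‖φ (doubledE8Root r)‖ ^ 2 = 2 ^ 2 := by rw [h]; norm_num
    exact (sq_eq_sq₀ (norm_nonneg _) zero_le_two).mp h4
  · simp only [Finset.mem_map, Finset.mem_univ, true_and, Function.Embedding.coeFn_mk,
      Function.comp_apply, forall_exists_index, forall_apply_eq_imp_iff]
    intro r s hrs
    exact hsep r s fun h => hrs (h ▸ rfl)
  · have hpairs : Fintype.card {p : Fin 8 × Fin 8 // p.1 < p.2} = 28 := by decide +kernel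
    simp [Finset.card_univ, hpairs]

end Construction


theorem kissingNumber_dim8 :
    (∀ S : Finset (EuclideanSpace ℝ (Fin 8)),
        (∀ x ∈ S, ‖x‖ = 2) →
        (∀ x ∈ S, ∀ y ∈ S, x ≠ y → 2 ≤ dist x y) →
        S.card ≤ 240) ∧
      ∃ S : Finset (EuclideanSpace ℝ (Fin 8)),
        (∀ x ∈ S, ‖x‖ = 2) ∧
        (∀ x ∈ S, ∀ y ∈ S, x ≠ y → 2 ≤ dist x y) ∧
        S.card = 240 := by
  exact ⟨card_le_of_kissing_dim8, exists_kissing_dim8⟩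
end
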